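/- arXiv:1404.4575 — 3 statements merged into one kernel-verified Lean document; each statement's English description precedes it below -/
import Mathlib

section
/- There exist absolute constants C > 0 and c > 0 such that the following holds. For every hypergraph H = (V,E) on n ≥ 2 vertices, all parameters ε ∈ (0,1) and δ ∈ (0,1/2), and every feasible SDP solution (ū)_{u∈V} for H-SSE with parameter δ and SDP value sdp, there exists a set S ⊆ V with 0 < |S| ≤ (1+ε)δn such that |E_cut(S)| ≤ C·ε^{-c}·δ^{-1}·log₂(2/δ)·log₂(2·log₂(2/δ))·√(log₂ n)·sdp·|S|. -/
open scoped Classical BigOperators RealInnerProductSpace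

noncomputable section

/-- A hyperedge `e` is cut by a set `S` if `e ∩ S ≠ ∅` and `e \ S ≠ ∅`. -/
def Cuts {V : Type*} [DecidableEq V] (S e : Finset V) : Prop :=
  (e ∩ S).Nonempty ∧ (e \ S).Nonempty

/-- Number of hyperedges (indexed by `ι`) cut by `S`. -/
def cutCount {V ι : Type*} [DecidableEq V] [Fintype ι]
    (ed : ι → Finset V) (S : Finset V) : ℕ :=
  (Finset.univ.filter (fun i => Cuts S (ed i))).card

/-- `max_{u,v ∈ e} ‖x u - x v‖²`. -/
def maxDistSq {V H : Type*} [NormedAddCommGroup H] (x : V → H) (e : Finset V) : ℝ :=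
  sSup {d : ℝ | ∃ u ∈ e, ∃ v ∈ e, d = ‖x u - x v‖ ^ 2}

/-- `max_{u,v ∈ e} ‖x u - x v‖`. -/
def maxDist {V H : Type*} [NormedAddCommGroup H] (x : V → H) (e : Finset V) : ℝ :=
  sSup {d : ℝ | ∃ u ∈ e, ∃ v ∈ e, d = ‖x u - x v‖}

/-- `min_{w ∈ e} ‖x w‖`. -/
def minNorm {V H : Type*} [NormedAddCommGroup H] (x : V → H) (e : Finset V) : ℝ :=
  sInf {d : ℝ | ∃ w ∈ e, d = ‖x w‖}

/-- SDP value of a vector solution. -/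
def sdpValue {V ι H : Type*} [Fintype ι] [NormedAddCommGroup H]
    (ed : ι → Finset V) (x : V → H) : ℝ :=
  ∑ i : ι, maxDistSq x (ed i)

/-- Expansion of a set `S` in the hypergraph. -/
def expansion {V ι : Type*} [Fintype V] [DecidableEq V] [Fintype ι]
    (ed : ι → Finset V) (S : Finset V) : ℝ :=
  (cutCount ed S : ℝ) / min (S.card : ℝ) ((Sᶜ : Finset V).card : ℝ)

/-- Small set expansion `φ*_{H,δ}`. -/
def phiStar {V ι : Type*} [Fintype V] [DecidableEq V] [Fintype ι]
    (ed : ι → Finset V) (δ : ℝ) : ℝ :=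
  sInf {c : ℝ | ∃ S : Finset V, S.Nonempty ∧ (S.card : ℝ) ≤ δ * Fintype.card V ∧
                c = expansion ed S}

/-- Feasibility for the SDP relaxation of H-SSE with parameter `δ`. -/
def SDPFeasible {V H : Type*} [Fintype V] [NormedAddCommGroup H] [InnerProductSpace ℝ H]
    (x : V → H) (δ : ℝ) : Prop :=
  (∀ u : V, ∑ v : V, (⟪x u, x v⟫ : ℝ) ≤ δ * (Fintype.card V : ℝ) * ‖x u‖ ^ 2) ∧
  (∑ u : V, ‖x u‖ ^ 2 = 1) ∧
  (∀ u v w : V, ‖x u - x w‖ ^ 2 ≤ ‖x u - x v‖ ^ 2 + ‖x v - x w‖ ^ 2) ∧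
  (∀ u v : V, 0 ≤ (⟪x u, x v⟫ : ℝ) ∧ (⟪x u, x v⟫ : ℝ) ≤ ‖x u‖ ^ 2)

/-- The `ℓ2²`-triangle inequalities for a family of vectors. -/
def L22 {V H : Type*} [NormedAddCommGroup H] [InnerProductSpace ℝ H] (x : V → H) : Prop :=
  (∀ u v w : V, ‖x u - x w‖ ^ 2 ≤ ‖x u - x v‖ ^ 2 + ‖x v - x w‖ ^ 2) ∧
  (∀ u v : V, 0 ≤ (⟪x u, x v⟫ : ℝ) ∧ (⟪x u, x v⟫ : ℝ) ≤ ‖x u‖ ^ 2)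

/-- Probability of an event under a finitely supported distribution. -/
def Pr {Ω : Type*} [Fintype Ω] (μ : Ω → ℝ) (P : Ω → Prop) : ℝ :=
  ∑ ω : Ω, if P ω then μ ω else 0

/-- A finitely supported probability distribution. -/
def IsProbDist {Ω : Type*} [Fintype Ω] (μ : Ω → ℝ) : Prop :=
  (∀ ω, 0 ≤ μ ω) ∧ ∑ ω : Ω, μ ω = 1

/-- `η(u)` for a choice `c` of subsets `e° ⊆ e`. -/
def eta {V ι : Type*} [Fintype ι] (ed c : ι → Finset V) (u : V) : ℝ :=
  ∑ i : ι, if u ∈ c i then Real.logb 2 ((ed i).card) / ((c i).card : ℝ) else 0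

/-- `η̂(H)`: the minimum over all valid choices `(e°)_{e∈E}` of `max_{u∈V} η(u)`. -/
def etaHat {V ι : Type*} [Fintype V] [Fintype ι] (ed : ι → Finset V) : ℝ :=
  sInf {b : ℝ | ∃ c : ι → Finset V, (∀ i, c i ⊆ ed i ∧ (c i).Nonempty) ∧
                b = ⨆ u : V, eta ed c u}

/-- The sign `±1` of a Boolean. -/
def boolSign (b : Bool) : ℝ := if b then 1 else -1

/-- The average of `f` over the Boolean cube. -/
def cubeMean {N : ℕ} (f : (Fin N → Bool) → ℝ) : ℝ := (∑ g, f g) / 2 ^ N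

/-- The Rademacher sum `∑ i, ± a i`. -/
def signedSum {N : ℕ} (a : Fin N → ℝ) (g : Fin N → Bool) : ℝ := ∑ i, a i * boolSign (g i)

/-- Flip the `i`-th coordinate of a point of the cube. -/
def cubeFlip {N : ℕ} (i : Fin N) (g : Fin N → Bool) : Fin N → Bool :=
  Function.update g i (!g i)

lemma cubeMean_mono {N : ℕ} {f f' : (Fin N → Bool) → ℝ} (h : ∀ g, f g ≤ f' g) :
    cubeMean f ≤ cubeMean f' := by
  unfold cubeMean
  gcongr with g _
  exact h g

lemma cubeMean_nonneg {N : ℕ} {f : (Fin N → Bool) → ℝ} (h : ∀ g, 0 ≤ f g) : 0 ≤ cubeMean f :=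
  div_nonneg (Finset.sum_nonneg fun g _ => h g) (by positivity)

lemma cubeMean_add {N : ℕ} (f f' : (Fin N → Bool) → ℝ) :
    cubeMean (fun g => f g + f' g) = cubeMean f + cubeMean f' := by
  simp only [cubeMean, Finset.sum_add_distrib, add_div]

lemma cubeMean_sub {N : ℕ} (f f' : (Fin N → Bool) → ℝ) :
    cubeMean (fun g => f g - f' g) = cubeMean f - cubeMean f' := by
  simp only [cubeMean, Finset.sum_sub_distrib, sub_div]

lemma cubeMean_const_mul {N : ℕ} (c : ℝ) (f : (Fin N → Bool) → ℝ) :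
    cubeMean (fun g => c * f g) = c * cubeMean f := by
  simp only [cubeMean, ← Finset.mul_sum, mul_div_assoc]

lemma cubeMean_const {N : ℕ} (c : ℝ) : cubeMean (fun _ : Fin N → Bool => c) = c := by
  simp [cubeMean]

lemma cubeMean_sum {N : ℕ} {κ : Type*} (s : Finset κ) (f : κ → (Fin N → Bool) → ℝ) :
    cubeMean (fun g => ∑ j ∈ s, f j g) = ∑ j ∈ s, cubeMean (f j) := by
  simp only [cubeMean, ← Finset.sum_div]
  rw [Finset.sum_comm]

lemma cubeMean_comp_equiv {N : ℕ} (σ : (Fin N → Bool) ≃ (Fin N → Bool))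
    (f : (Fin N → Bool) → ℝ) : cubeMean (fun g => f (σ g)) = cubeMean f := by
  simp only [cubeMean, Equiv.sum_comp σ f]

lemma cubeFlip_involutive {N : ℕ} (i : Fin N) : Function.Involutive (cubeFlip i) := by
  intro g
  simp [cubeFlip]

lemma cubeMean_comp_flip {N : ℕ} (i : Fin N) (f : (Fin N → Bool) → ℝ) :
    cubeMean (fun g => f (cubeFlip i g)) = cubeMean f :=
  cubeMean_comp_equiv (cubeFlip_involutive i).toPerm f

lemma cubeMean_comp_not {N : ℕ} (f : (Fin N → Bool) → ℝ) :
    cubeMean (fun g => f (fun i => !g i)) = cubeMean f :=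
  cubeMean_comp_equiv (Function.Involutive.toPerm (fun (g : Fin N → Bool) i => !g i)
    (fun g => by simp)) f

lemma cubeMean_zero (f : (Fin 0 → Bool) → ℝ) : cubeMean f = f Fin.elim0 := by
  simp only [cubeMean, pow_zero, div_one]
  rw [Fintype.sum_unique]
  congr 1

lemma cubeMean_succ {N : ℕ} (f : (Fin (N + 1) → Bool) → ℝ) :
    cubeMean f = (cubeMean (fun g => f (Fin.cons true g)) +
      cubeMean (fun g => f (Fin.cons false g))) / 2 := by
  have h : ∑ g, f g = ∑ p : Bool × (Fin N → Bool), f (Fin.cons p.1 p.2) :=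
    (Equiv.sum_comp (Fin.consEquiv fun _ => Bool) f).symm
  simp only [cubeMean, h, Fintype.sum_prod_type, Fintype.sum_bool]
  field_simp
  ring

lemma signedSum_cons {N : ℕ} (a : Fin (N + 1) → ℝ) (b : Bool) (g : Fin N → Bool) :
    signedSum a (Fin.cons b g) = a 0 * boolSign b + signedSum (fun i => a i.succ) g := by
  simp [signedSum, Fin.sum_univ_succ]

lemma signedSum_add {N : ℕ} (a b : Fin N → ℝ) (g : Fin N → Bool) :
    signedSum (a + b) g = signedSum a g + signedSum b g := by
  simp [signedSum, add_mul, Finset.sum_add_distrib]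

lemma signedSum_sub {N : ℕ} (a b : Fin N → ℝ) (g : Fin N → Bool) :
    signedSum (a - b) g = signedSum a g - signedSum b g := by
  simp [signedSum, sub_mul, Finset.sum_sub_distrib]

lemma signedSum_not {N : ℕ} (a : Fin N → ℝ) (g : Fin N → Bool) :
    signedSum a (fun i => !g i) = - signedSum a g := by
  simp only [signedSum, ← Finset.sum_neg_distrib]
  refine Finset.sum_congr rfl fun i _ => ?_
  cases g i <;> simp [boolSign]

lemma signedSum_sub_flip_sq {N : ℕ} (a : Fin N → ℝ) (i : Fin N) (g : Fin N → Bool) :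
    (signedSum a g - signedSum a (cubeFlip i g)) ^ 2 = 4 * a i ^ 2 := by
  have h : signedSum a g - signedSum a (cubeFlip i g) = 2 * (a i * boolSign (g i)) := by
    simp only [signedSum, ← Finset.sum_sub_distrib]
    rw [Finset.sum_eq_single i]
    · cases hg : g i <;> simp [cubeFlip, boolSign, hg] <;> ring
    · intro j _ hj
      simp [cubeFlip, hj]
    · simp
  rw [h]
  cases g i <;> simp [boolSign] <;> ring

lemma cubeMean_exp_signedSum_le {N : ℕ} (t : ℝ) (a : Fin N → ℝ) :
    cubeMean (fun g => Real.exp (t * signedSum a g)) ≤ Real.exp (t ^ 2 * (∑ i, a i ^ 2) / 2) := by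
  induction N with
  | zero => simp [cubeMean_zero, signedSum]
  | succ N ih =>
    have h := ih (fun i => a i.succ)
    rw [cubeMean_succ]
    simp only [signedSum_cons, mul_add, Real.exp_add, cubeMean_const_mul]
    rw [← add_mul, mul_div_right_comm]
    have hc : (Real.exp (t * (a 0 * boolSign true)) + Real.exp (t * (a 0 * boolSign false))) / 2
        ≤ Real.exp ((t * a 0) ^ 2 / 2) := by
      have := Real.cosh_le_exp_half_sq (t * a 0)
      rw [Real.cosh_eq] at this
      simpa [boolSign] using this
    calc _ ≤ Real.exp ((t * a 0) ^ 2 / 2) *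
          Real.exp (t ^ 2 * (∑ i : Fin N, a i.succ ^ 2) / 2) :=
            mul_le_mul hc h
              (div_nonneg (Finset.sum_nonneg fun _ _ => (Real.exp_pos _).le) (by positivity))
              (Real.exp_pos _).le
      _ = _ := by
        rw [← Real.exp_add, Fin.sum_univ_succ]
        congr 1
        ring

lemma cubeMean_signedSum {N : ℕ} (a : Fin N → ℝ) : cubeMean (signedSum a) = 0 := by
  have h := cubeMean_comp_not (signedSum a)
  simp only [signedSum_not] at h
  have h2 := cubeMean_const_mul (-1) (signedSum a)
  simp only [neg_one_mul] at h2
  linarith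

lemma cubeMean_signedSum_sq {N : ℕ} (a : Fin N → ℝ) :
    cubeMean (fun g => signedSum a g ^ 2) = ∑ i, a i ^ 2 := by
  induction N with
  | zero => simp [cubeMean_zero, signedSum]
  | succ N ih =>
    have h := ih (fun i => a i.succ)
    have h1 := cubeMean_signedSum (fun i => a i.succ)
    rw [cubeMean_succ, Fin.sum_univ_succ, ← h]
    simp only [signedSum_cons, add_sq, cubeMean_add, cubeMean_const_mul, cubeMean_const]
    rw [show cubeMean (fun g => signedSum (fun i : Fin N => a i.succ) g) = 0 from h1]
    simp [boolSign]

lemma cubeMean_signedSum_pow_four_le {N : ℕ} (a : Fin N → ℝ) :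
    cubeMean (fun g => signedSum a g ^ 4) ≤ 3 * (∑ i, a i ^ 2) ^ 2 := by
  induction N with
  | zero => simp [cubeMean_zero, signedSum]
  | succ N ih =>
    have h := ih (fun i => a i.succ)
    have h2 := cubeMean_signedSum_sq (fun i => a i.succ)
    have key : cubeMean (fun g => signedSum a g ^ 4) =
        a 0 ^ 4 + 6 * a 0 ^ 2 * (∑ i : Fin N, a i.succ ^ 2) +
          cubeMean (fun g => signedSum (fun i : Fin N => a i.succ) g ^ 4) := by
      rw [cubeMean_succ, ← h2, ← cubeMean_add]
      simp only [signedSum_cons]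
      rw [← cubeMean_const_mul, ← cubeMean_const (N := N) (a 0 ^ 4), ← cubeMean_add,
        ← cubeMean_add, div_eq_inv_mul, ← cubeMean_const_mul]
      congr 1
      funext g
      simp only [boolSign]
      norm_num
      ring
    rw [key, Fin.sum_univ_succ]
    nlinarith [sq_nonneg (a 0 ^ 2)]

lemma cubeMean_sq_le {N : ℕ} (f : (Fin N → Bool) → ℝ) :
    cubeMean f ^ 2 ≤ cubeMean (fun g => f g ^ 2) := by
  have h : 0 ≤ cubeMean (fun g => (f g - cubeMean f) ^ 2) :=
    cubeMean_nonneg fun g => sq_nonneg _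
  have e : (fun g => (f g - cubeMean f) ^ 2) =
      fun g => (f g ^ 2 - 2 * cubeMean f * f g) + cubeMean f ^ 2 := by
    funext g; ring
  rw [e, cubeMean_add, cubeMean_sub, cubeMean_const_mul, cubeMean_const] at h
  linarith

lemma cubeFlip_zero_cons {N : ℕ} (b : Bool) (g : Fin N → Bool) :
    cubeFlip 0 (Fin.cons b g : Fin (N + 1) → Bool) = Fin.cons (!b) g := by
  simp [cubeFlip, Fin.update_cons_zero]

lemma cubeFlip_succ_cons {N : ℕ} (i : Fin N) (b : Bool) (g : Fin N → Bool) :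
    cubeFlip i.succ (Fin.cons b g : Fin (N + 1) → Bool) = Fin.cons b (cubeFlip i g) := by
  simp [cubeFlip, Fin.cons_update]

/-- The Poincaré (Efron–Stein) inequality on the Boolean cube. -/
lemma cube_poincare {N : ℕ} (f : (Fin N → Bool) → ℝ) :
    4 * (cubeMean (fun g => f g ^ 2) - cubeMean f ^ 2) ≤
      ∑ i, cubeMean (fun g => (f g - f (cubeFlip i g)) ^ 2) := by
  induction N with
  | zero => simp [cubeMean_zero]
  | succ N ih =>
    have ht := ih (fun g => f (Fin.cons true g))
    have hf := ih (fun g => f (Fin.cons false g))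
    have hd := cubeMean_sq_le (fun g : Fin N → Bool => f (Fin.cons true g) - f (Fin.cons false g))
    rw [cubeMean_sub] at hd
    rw [Fin.sum_univ_succ]
    have e0 : cubeMean (fun g => (f g - f (cubeFlip 0 g)) ^ 2) =
        cubeMean (fun g : Fin N → Bool => (f (Fin.cons true g) - f (Fin.cons false g)) ^ 2) := by
      rw [cubeMean_succ]
      simp only [cubeFlip_zero_cons, Bool.not_true, Bool.not_false]
      simp only [sub_sq_comm (f (Fin.cons false _)), add_self_div_two]
    have es : ∑ i : Fin N, cubeMean (fun g => (f g - f (cubeFlip i.succ g)) ^ 2) =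
        (∑ i, cubeMean (fun g => (f (Fin.cons true g) - f (Fin.cons true (cubeFlip i g))) ^ 2) +
        ∑ i, cubeMean (fun g => (f (Fin.cons false g) - f (Fin.cons false (cubeFlip i g))) ^ 2))
          / 2 := by
      rw [← Finset.sum_add_distrib, Finset.sum_div]
      refine Finset.sum_congr rfl fun i _ => ?_
      rw [cubeMean_succ]
      simp only [cubeFlip_succ_cons]
    rw [e0, es, cubeMean_succ f, cubeMean_succ (fun g => f g ^ 2)]
    linarith

/-- The variance of a supremum of Rademacher sums. -/
lemma variance_sup_signedSum_le {N : ℕ} {κ : Type*} (B : Finset κ) (hB : B.Nonempty)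
    (a : κ → Fin N → ℝ) (R : ℝ) (hR : ∀ v ∈ B, ∑ i, a v i ^ 2 ≤ R) :
    cubeMean (fun g => (B.sup' hB (fun v => signedSum (a v) g) -
      cubeMean (fun g => B.sup' hB (fun v => signedSum (a v) g))) ^ 2) ≤ 2 * R := by
  set F : (Fin N → Bool) → ℝ := fun g => B.sup' hB (fun v => signedSum (a v) g) with hF
  have hmax : ∀ g, ∃ v ∈ B, F g = signedSum (a v) g := fun g => B.exists_mem_eq_sup' hB _
  choose v hv hFv using hmax
  have hle : ∀ g w, w ∈ B → signedSum (a w) g ≤ F g := fun g w hw =>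
    Finset.le_sup' (fun v => signedSum (a v) g) hw
  have hpt : ∀ i g, (F g - F (cubeFlip i g)) ^ 2 ≤
      4 * a (v g) i ^ 2 + 4 * a (v (cubeFlip i g)) i ^ 2 := by
    intro i g
    have h1 := signedSum_sub_flip_sq (a (v g)) i g
    have h2 := signedSum_sub_flip_sq (a (v (cubeFlip i g))) i g
    have h3 := hle (cubeFlip i g) (v g) (hv g)
    have h4 := hle g (v (cubeFlip i g)) (hv _)
    have h5 := hFv g
    have h6 := hFv (cubeFlip i g)
    rw [← h1, ← h2]
    rcases le_total (F (cubeFlip i g)) (F g) with h | h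
    · nlinarith [sq_nonneg (signedSum (a (v (cubeFlip i g))) g -
        signedSum (a (v (cubeFlip i g))) (cubeFlip i g))]
    · nlinarith [sq_nonneg (signedSum (a (v g)) g - signedSum (a (v g)) (cubeFlip i g))]
  have hmean : ∀ i, cubeMean (fun g => (F g - F (cubeFlip i g)) ^ 2) ≤
      8 * cubeMean (fun g => a (v g) i ^ 2) := by
    intro i
    have h := cubeMean_mono (hpt i)
    rw [cubeMean_add, cubeMean_const_mul, cubeMean_const_mul,
      cubeMean_comp_flip i (fun g => a (v g) i ^ 2)] at h
    linarith
  have hsum : ∑ i, cubeMean (fun g => (F g - F (cubeFlip i g)) ^ 2) ≤ 8 * R := by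
    calc _ ≤ ∑ i, 8 * cubeMean (fun g => a (v g) i ^ 2) :=
          Finset.sum_le_sum fun i _ => hmean i
      _ = 8 * cubeMean (fun g => ∑ i, a (v g) i ^ 2) := by
          rw [← Finset.mul_sum, cubeMean_sum]
      _ ≤ 8 * R := by
          gcongr
          rw [← cubeMean_const (N := N) R]
          exact cubeMean_mono fun g => hR _ (hv g)
  have hP := cube_poincare F
  have e : (fun g => (F g - cubeMean F) ^ 2) =
      fun g => (F g ^ 2 - 2 * cubeMean F * F g) + cubeMean F ^ 2 := by
    funext g; ring
  rw [e, cubeMean_add, cubeMean_sub, cubeMean_const_mul, cubeMean_const]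
  linarith

lemma mean_sup_signedSum_le {N : ℕ} {κ : Type*} (B : Finset κ) (hB : B.Nonempty)
    (a : κ → Fin N → ℝ) (R : ℝ) (hR : ∀ v ∈ B, ∑ i, a v i ^ 2 ≤ R) (t : ℝ) :
    t * cubeMean (fun g => B.sup' hB (fun v => signedSum (a v) g)) ≤
      Real.log B.card + t ^ 2 * R / 2 := by
  have hcard : (0 : ℝ) < B.card := by exact_mod_cast hB.card_pos
  set s := Real.log B.card + t ^ 2 * R / 2 with hs
  have hpt : ∀ g, t * B.sup' hB (fun v => signedSum (a v) g) ≤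
      Real.exp (-s) * (∑ v ∈ B, Real.exp (t * signedSum (a v) g)) + (s - 1) := by
    intro g
    obtain ⟨v, hv, h⟩ := B.exists_mem_eq_sup' hB (fun v => signedSum (a v) g)
    rw [h]
    have h1 := Real.add_one_le_exp (t * signedSum (a v) g - s)
    have h2 : Real.exp (t * signedSum (a v) g) ≤ ∑ v ∈ B, Real.exp (t * signedSum (a v) g) :=
      Finset.single_le_sum (f := fun v => Real.exp (t * signedSum (a v) g))
        (fun v _ => (Real.exp_pos _).le) hv
    rw [sub_eq_add_neg, Real.exp_add, mul_comm (Real.exp _)] at h1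
    have h3 := mul_le_mul_of_nonneg_left h2 (Real.exp_pos (-s)).le
    linarith
  have h := cubeMean_mono hpt
  rw [cubeMean_add, cubeMean_const_mul, cubeMean_const_mul, cubeMean_sum, cubeMean_const] at h
  have h2 : ∑ v ∈ B, cubeMean (fun g => Real.exp (t * signedSum (a v) g)) ≤ Real.exp s := by
    calc _ ≤ ∑ v ∈ B, Real.exp (t ^ 2 * R / 2) := by
          refine Finset.sum_le_sum fun v hv => (cubeMean_exp_signedSum_le t (a v)).trans ?_
          gcongr
          exact hR v hv
      _ = Real.exp s := by
          rw [hs, Real.exp_add, Real.exp_log hcard]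
          simp
  have h3 := mul_le_mul_of_nonneg_left h2 (Real.exp_pos (-s)).le
  rw [← Real.exp_add, neg_add_cancel, Real.exp_zero] at h3
  linarith

/-- A Rademacher sum is comparable with its standard deviation with constant probability. -/
lemma cubeMean_indicator_ge {N : ℕ} (a : Fin N → ℝ) (b : ℝ) (hb : 0 < b)
    (h : b ^ 2 ≤ ∑ i, a i ^ 2) :
    1 / 5 ≤ cubeMean (fun g => if b / 2 ≤ |signedSum a g| then (1 : ℝ) else 0) := by
  set ρ := ∑ i, a i ^ 2 with hρ
  have hρ0 : 0 < ρ := lt_of_lt_of_le (by positivity) h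
  have hpt : ∀ g, ((3 / 5) * (1 + 3 / 40) * ρ⁻¹) * signedSum a g ^ 2 -
      ((3 / 5) * (3 / 20) * ρ⁻¹ ^ 2) * signedSum a g ^ 4 -
        (3 / 5) * (1 / 4) * (1 + 3 / 80) ≤
      if b / 2 ≤ |signedSum a g| then (1 : ℝ) else 0 := by
    intro g
    set z := ρ⁻¹ * signedSum a g ^ 2 with hz
    have e : ((3 / 5) * (1 + 3 / 40) * ρ⁻¹) * signedSum a g ^ 2 -
      ((3 / 5) * (3 / 20) * ρ⁻¹ ^ 2) * signedSum a g ^ 4 -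
        (3 / 5) * (1 / 4) * (1 + 3 / 80) = (3 / 5) * (z - 1 / 4) * (1 - (3 / 20) * (z - 1 / 4)) := by
      rw [hz]; ring
    rw [e]
    split_ifs with hc
    · nlinarith [sq_nonneg (3 / 20 * (z - 1 / 4) - 1 / 2)]
    · have h1 : signedSum a g ^ 2 ≤ ρ / 4 := by
        rw [← sq_abs]
        nlinarith [abs_nonneg (signedSum a g)]
      have h2 : z ≤ 1 / 4 := by
        rw [hz, inv_mul_le_iff₀ hρ0]
        linarith
      have h3 : 0 ≤ z := by positivity
      nlinarith
  have hm := cubeMean_mono hpt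
  rw [cubeMean_sub, cubeMean_sub, cubeMean_const_mul, cubeMean_const_mul, cubeMean_const,
    cubeMean_signedSum_sq] at hm
  have h4 := cubeMean_signedSum_pow_four_le a
  have h5 : ρ⁻¹ ^ 2 * cubeMean (fun g => signedSum a g ^ 4) ≤ 3 := by
    rw [inv_pow, inv_mul_le_iff₀ (by positivity)]
    linarith
  have h6 : ρ⁻¹ * ρ = 1 := inv_mul_cancel₀ hρ0.ne'
  rw [← hρ] at hm
  refine le_trans ?_ hm
  nlinarith

lemma exists_median {V : Type*} [Fintype V] [Nonempty V] (z : V → ℝ) :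
    ∃ m : ℝ, (Fintype.card V : ℝ) / 2 ≤ (Finset.univ.filter fun u => z u ≤ m).card ∧
      (Fintype.card V : ℝ) / 2 ≤ (Finset.univ.filter fun u => m ≤ z u).card := by
  set T := Finset.univ.filter fun w : V =>
    (Fintype.card V : ℝ) / 2 ≤ (Finset.univ.filter fun u => z u ≤ z w).card with hT
  have hTne : T.Nonempty := by
    obtain ⟨w, -, hw⟩ := Finset.exists_max_image Finset.univ z Finset.univ_nonempty
    refine ⟨w, ?_⟩
    simp only [hT, Finset.mem_filter, Finset.mem_univ, true_and]
    rw [Finset.filter_true_of_mem fun u hu => hw u hu, Finset.card_univ]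
    have : (0 : ℝ) ≤ Fintype.card V := by positivity
    linarith
  obtain ⟨w, hwT, hw⟩ := Finset.exists_min_image T z hTne
  refine ⟨z w, (Finset.mem_filter.1 hwT).2, ?_⟩
  have hsplit : (Finset.univ.filter fun u => z w ≤ z u).card +
      (Finset.univ.filter fun u => z u < z w).card = Fintype.card V := by
    simp only [← not_le]
    rw [Finset.card_filter_add_card_filter_not, Finset.card_univ]
  have hlt : ((Finset.univ.filter fun u => z u < z w).card : ℝ) ≤ (Fintype.card V : ℝ) / 2 := by
    by_contra! hcon
    have hne : (Finset.univ.filter fun u => z u < z w).Nonempty := by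
      rw [← Finset.card_pos]
      have : (0 : ℝ) ≤ (Fintype.card V : ℝ) / 2 := by positivity
      exact Nat.cast_pos.1 (this.trans_lt hcon)
    obtain ⟨w', hw', hmax⟩ := Finset.exists_max_image _ z hne
    have hw'T : w' ∈ T := by
      simp only [hT, Finset.mem_filter, Finset.mem_univ, true_and]
      refine hcon.le.trans ?_
      exact Nat.cast_le.2 (Finset.card_le_card fun u hu =>
        Finset.mem_filter.2 ⟨Finset.mem_univ _, hmax u hu⟩)
    exact (Finset.mem_filter.1 hw').2.not_ge (hw w' hw'T)
  have hs : ((Finset.univ.filter fun u => z w ≤ z u).card : ℝ) +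
      (Finset.univ.filter fun u => z u < z w).card = Fintype.card V := by exact_mod_cast hsplit
  linarith

/-- A set of ordered pairs is a matching if both coordinates are injective on it. -/
def IsPairMatching {V : Type*} (M : Finset (V × V)) : Prop :=
  Set.InjOn Prod.fst (M : Set (V × V)) ∧ Set.InjOn Prod.snd (M : Set (V × V))

lemma IsPairMatching.sum_fst_le {V : Type*} [Fintype V] {M : Finset (V × V)}
    (hM : IsPairMatching M) {f : V → ℝ} (hf : ∀ u, 0 ≤ f u) : ∑ p ∈ M, f p.1 ≤ ∑ u, f u := by
  rw [← Finset.sum_image (g := Prod.fst) (f := f) hM.1]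
  exact Finset.sum_le_univ_sum_of_nonneg hf

lemma IsPairMatching.sum_snd_le {V : Type*} [Fintype V] {M : Finset (V × V)}
    (hM : IsPairMatching M) {f : V → ℝ} (hf : ∀ u, 0 ≤ f u) : ∑ p ∈ M, f p.2 ≤ ∑ u, f u := by
  rw [← Finset.sum_image (g := Prod.snd) (f := f) hM.2]
  exact Finset.sum_le_univ_sum_of_nonneg hf

/-- A maximal matching leaves unmatched sets that are unrelated. -/
lemma exists_maximal_matching {V : Type*} (A B : Finset V) (r : V → V → Prop) :
    ∃ M : Finset (V × V), IsPairMatching M ∧ (∀ p ∈ M, p.1 ∈ A ∧ p.2 ∈ B ∧ r p.1 p.2) ∧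
      ∀ a ∈ A \ M.image Prod.fst, ∀ b ∈ B \ M.image Prod.snd, ¬ r a b := by
  set F := (A ×ˢ B).powerset.filter fun M =>
    IsPairMatching M ∧ ∀ p ∈ M, p.1 ∈ A ∧ p.2 ∈ B ∧ r p.1 p.2 with hF
  have hFne : F.Nonempty := ⟨∅, by simp [hF, IsPairMatching]⟩
  obtain ⟨M, hMF, hmax⟩ := Finset.exists_max_image F Finset.card hFne
  obtain ⟨-, hM, hMr⟩ := Finset.mem_filter.1 hMF
  refine ⟨M, hM, hMr, fun a ha b hb hr => ?_⟩
  rw [Finset.mem_sdiff] at ha hb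
  have ha' : ∀ p ∈ M, p.1 ≠ a := fun p hp h => ha.2 (Finset.mem_image.2 ⟨p, hp, h⟩)
  have hb' : ∀ p ∈ M, p.2 ≠ b := fun p hp h => hb.2 (Finset.mem_image.2 ⟨p, hp, h⟩)
  have hnot : (a, b) ∉ M := fun h => ha' _ h rfl
  have hr' : ∀ p ∈ insert (a, b) M, p.1 ∈ A ∧ p.2 ∈ B ∧ r p.1 p.2 := by
    intro p hp
    rcases Finset.mem_insert.1 hp with rfl | hp
    · exact ⟨ha.1, hb.1, hr⟩
    · exact hMr p hp
  have hmem : insert (a, b) M ∈ F := by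
    refine Finset.mem_filter.2 ⟨Finset.mem_powerset.2 fun p hp =>
      Finset.mem_product.2 ⟨(hr' p hp).1, (hr' p hp).2.1⟩, ⟨?_, ?_⟩, hr'⟩
    · rw [Finset.coe_insert, Set.injOn_insert (by simpa using hnot)]
      refine ⟨hM.1, ?_⟩
      rintro ⟨p, hp, h⟩
      exact ha' p hp h
    · rw [Finset.coe_insert, Set.injOn_insert (by simpa using hnot)]
      refine ⟨hM.2, ?_⟩
      rintro ⟨p, hp, h⟩
      exact hb' p hp h
  have := hmax _ hmem
  rw [Finset.card_insert_of_notMem hnot] at this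
  omega

lemma card_le_matching_of_not_separated {V : Type*} {d : V → V → ℝ} {c Δ : ℝ}
    (hno : ¬ ∃ L R : Finset V, c ≤ L.card ∧ c ≤ R.card ∧ ∀ u ∈ L, ∀ v ∈ R, Δ ≤ d u v)
    (A B : Finset V) (l : ℝ) (hA : l ≤ A.card) (hB : l ≤ B.card) :
    ∃ M : Finset (V × V), IsPairMatching M ∧
      (∀ p ∈ M, p.1 ∈ A ∧ p.2 ∈ B ∧ d p.1 p.2 < Δ) ∧ l - c ≤ M.card := by
  obtain ⟨M, hM, hMr, hun⟩ := exists_maximal_matching A B (fun u v => d u v < Δ)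
  refine ⟨M, hM, hMr, ?_⟩
  by_contra! hcon
  have h1 : A.card ≤ (A \ M.image Prod.fst).card + M.card := by
    have := Finset.le_card_sdiff (M.image Prod.fst) A
    have h2 : (M.image Prod.fst).card ≤ M.card := Finset.card_image_le
    omega
  have h2 : B.card ≤ (B \ M.image Prod.snd).card + M.card := by
    have := Finset.le_card_sdiff (M.image Prod.snd) B
    have h2 : (M.image Prod.snd).card ≤ M.card := Finset.card_image_le
    omega
  have h1' : (A.card : ℝ) ≤ (A \ M.image Prod.fst).card + M.card := by exact_mod_cast h1
  have h2' : (B.card : ℝ) ≤ (B \ M.image Prod.snd).card + M.card := by exact_mod_cast h2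
  exact hno ⟨_, _, by linarith, by linarith, fun u hu v hv => not_lt.1 (hun u hu v hv)⟩

/-- If no two large sets are separated, then any real function with many well-spread pairs has
a large matching of close points along which the function increases. -/
lemma exists_matching_of_not_separated {V : Type*} [Fintype V] [Nonempty V] {d : V → V → ℝ}
    {c Δ : ℝ}
    (hno : ¬ ∃ L R : Finset V, c ≤ L.card ∧ c ≤ R.card ∧ ∀ u ∈ L, ∀ v ∈ R, Δ ≤ d u v)
    (z : V → ℝ) (τ : ℝ) :
    ∃ M : Finset (V × V), IsPairMatching M ∧
      (∀ p ∈ M, d p.1 p.2 < Δ ∧ τ / 2 ≤ z p.2 - z p.1) ∧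
      ((Finset.univ.filter fun p : V × V => τ ≤ |z p.1 - z p.2|).card : ℝ) /
        (4 * Fintype.card V) - c ≤ M.card := by
  obtain ⟨m, hm1, hm2⟩ := exists_median z
  set q := (Fintype.card V : ℝ) with hq
  have hq0 : 0 < q := by rw [hq]; exact_mod_cast Fintype.card_pos
  set P := Finset.univ.filter fun p : V × V => τ ≤ |z p.1 - z p.2| with hP
  set U := Finset.univ.filter fun u => m + τ / 2 ≤ z u with hU
  set D := Finset.univ.filter fun u => z u ≤ m - τ / 2 with hD
  have hPle : (P.card : ℝ) ≤ 2 * q * (U.card + D.card) := by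
    have hsub : P ⊆ (U ∪ D) ×ˢ Finset.univ ∪ Finset.univ ×ˢ (U ∪ D) := by
      intro p hp
      have h := (Finset.mem_filter.1 hp).2
      simp only [Finset.mem_union, Finset.mem_product, Finset.mem_univ, and_true, true_and,
        hU, hD, Finset.mem_filter]
      by_contra! hcon
      have : |z p.1 - z p.2| < τ := abs_lt.2 ⟨by linarith, by linarith⟩
      linarith
    have h1 := (Finset.card_le_card hsub).trans (Finset.card_union_le _ _)
    rw [Finset.card_product, Finset.card_product, Finset.card_univ] at h1
    have h2 := Finset.card_union_le U D
    have h1' : (P.card : ℝ) ≤ ((U ∪ D).card : ℝ) * q + q * (U ∪ D).card := by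
      rw [hq]; exact_mod_cast h1
    have h2' : ((U ∪ D).card : ℝ) ≤ U.card + D.card := by exact_mod_cast h2
    nlinarith
  have hPq : (P.card : ℝ) ≤ q * q := by
    have := Finset.card_le_univ P
    rw [Fintype.card_prod] at this
    rw [hq]
    exact_mod_cast this
  have hl : (P.card : ℝ) / (4 * q) ≤ q / 2 := by
    rw [div_le_iff₀ (by positivity)]
    nlinarith
  have hl2 : (P.card : ℝ) / (4 * q) ≤ U.card ∨ (P.card : ℝ) / (4 * q) ≤ D.card := by
    rw [div_le_iff₀ (by positivity), div_le_iff₀ (by positivity)]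
    by_contra! hcon
    linarith
  rcases hl2 with h | h
  · obtain ⟨M, hM, hMr, hc⟩ := card_le_matching_of_not_separated hno _ U _ (hl.trans hm1) h
    refine ⟨M, hM, fun p hp => ⟨(hMr p hp).2.2, ?_⟩, hc⟩
    have h1 := (Finset.mem_filter.1 (hMr p hp).1).2
    have h2 := (Finset.mem_filter.1 (hMr p hp).2.1).2
    linarith
  · obtain ⟨M, hM, hMr, hc⟩ := card_le_matching_of_not_separated hno D _ _ h (hl.trans hm2)
    refine ⟨M, hM, fun p hp => ⟨(hMr p hp).2.2, ?_⟩, hc⟩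
    have h1 := (Finset.mem_filter.1 (hMr p hp).1).2
    have h2 := (Finset.mem_filter.1 (hMr p hp).2.1).2
    linarith

lemma cubeMean_abs_le {N : ℕ} (f : (Fin N → Bool) → ℝ) {τ : ℝ} (hτ : 0 < τ)
    (h : cubeMean (fun g => f g ^ 2) ≤ τ ^ 2) : cubeMean (fun g => |f g|) ≤ τ := by
  have hpt : ∀ g, 2 * τ * |f g| ≤ f g ^ 2 + τ ^ 2 := fun g => by
    have := two_mul_le_add_sq τ |f g|
    rw [sq_abs] at this
    linarith
  have hm := cubeMean_mono hpt
  rw [cubeMean_const_mul, cubeMean_add, cubeMean_const] at hm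
  by_contra! hcon
  nlinarith

/-- The chaining argument: if for every sign pattern there is a matching of close points with
increments at least `σ`, then chaining `K` matchings contradicts the bound on the expected
supremum of Rademacher sums over a ball. -/
lemma chaining_bound {V : Type*} [Fintype V] {N : ℕ} (y : V → Fin N → ℝ)
    (htri : ∀ u v w, ∑ i, (y u i - y w i) ^ 2 ≤
      ∑ i, (y u i - y v i) ^ 2 + ∑ i, (y v i - y w i) ^ 2)
    {Δ σ τ : ℝ} (hΔ : 0 ≤ Δ) (hτ : 0 < τ) (M : (Fin N → Bool) → Finset (V × V))
    (hM : ∀ g, IsPairMatching (M g))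
    (hMd : ∀ g, ∀ p ∈ M g, ∑ i, (y p.1 i - y p.2 i) ^ 2 < Δ)
    (hMσ : ∀ g, ∀ p ∈ M g, σ ≤ signedSum (y p.2 - y p.1) g)
    (hμ : 0 < cubeMean fun g => ((M g).card : ℝ)) (K : ℕ) (hK : 2 * (K * Δ) ≤ τ ^ 2)
    (hτσ : 4 * Fintype.card V * τ ≤ σ * cubeMean fun g => ((M g).card : ℝ)) (t : ℝ) (ht : 0 ≤ t) :
    t * (K * σ) ≤ 2 * (Real.log (Fintype.card V) + t ^ 2 * (K * Δ) / 2) := by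
  set μ := cubeMean fun g => ((M g).card : ℝ) with hμdef
  set ball : ℕ → V → Finset V := fun k u =>
    Finset.univ.filter fun v => ∑ i, (y u i - y v i) ^ 2 ≤ k * Δ with hball
  have hself : ∀ k u, u ∈ ball k u := fun k u => by
    simp only [hball, Finset.mem_filter, Finset.mem_univ, true_and, sub_self]
    simp only [ne_eq, OfNat.ofNat_ne_zero, not_false_eq_true, zero_pow, Finset.sum_const_zero]
    positivity
  set X : ℕ → V → (Fin N → Bool) → ℝ := fun k u g =>
    (ball k u).sup' ⟨u, hself k u⟩ (fun v => signedSum (y v - y u) g) with hX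
  set Y : ℕ → V → ℝ := fun k u => cubeMean (X k u) with hY
  have hrad : ∀ k u, ∀ v ∈ ball k u, ∑ i, (y v - y u) i ^ 2 ≤ k * Δ := by
    intro k u v hv
    have h := (Finset.mem_filter.1 hv).2
    simpa only [Pi.sub_apply, sub_sq_comm (y v _)] using h
  have hstep : ∀ k u v g, ∑ i, (y u i - y v i) ^ 2 ≤ Δ → σ ≤ signedSum (y v - y u) g →
      X k v g + σ ≤ X (k + 1) u g := by
    intro k u v g hd hs
    obtain ⟨w, hw, hXw⟩ := (ball k v).exists_mem_eq_sup' ⟨v, hself k v⟩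
      (fun w => signedSum (y w - y v) g)
    have hw' : w ∈ ball (k + 1) u := by
      have h := (Finset.mem_filter.1 hw).2
      simp only [hball, Finset.mem_filter, Finset.mem_univ, true_and]
      have := htri u v w
      push_cast
      linarith
    have h1 : signedSum (y w - y u) g ≤ X (k + 1) u g :=
      Finset.le_sup' (fun w => signedSum (y w - y u) g) hw'
    have h2 : X k v g = signedSum (y w - y v) g := hXw
    have h3 : signedSum (y w - y u) g = signedSum (y w - y v) g + signedSum (y v - y u) g := by
      rw [← signedSum_add, sub_add_sub_cancel]
    linarith
  have hdev : ∀ k ≤ K, ∀ u, cubeMean (fun g => |X k u g - Y k u|) ≤ τ := by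
    intro k hk u
    refine cubeMean_abs_le _ hτ ?_
    refine (variance_sup_signedSum_le (ball k u) ⟨u, hself k u⟩ (fun v => y v - y u) (k * Δ)
      (hrad k u)).trans ?_
    have : (k : ℝ) * Δ ≤ K * Δ := by gcongr
    linarith
  have hdevsum : ∀ k ≤ K, cubeMean (fun g => ∑ u, |X k u g - Y k u|) ≤ Fintype.card V * τ := by
    intro k hk
    rw [cubeMean_sum]
    refine (Finset.sum_le_sum fun u _ => hdev k hk u).trans ?_
    simp
  have hdevsum' : ∀ k ≤ K, cubeMean (fun g => ∑ u, |X k u (fun i => !g i) - Y k u|) ≤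
      Fintype.card V * τ := by
    intro k hk
    rw [cubeMean_comp_not (fun g => ∑ u, |X k u g - Y k u|)]
    exact hdevsum k hk
  set Φ : ℕ → ℝ := fun k => cubeMean fun g => ∑ p ∈ M g, (Y k p.1 + Y k p.2) with hΦ
  have hΦ0 : 0 ≤ Φ 0 := by
    have hY0 : ∀ u, 0 ≤ Y 0 u := fun u => by
      refine cubeMean_nonneg fun g => ?_
      have h : signedSum (y u - y u) g ≤ X 0 u g :=
        Finset.le_sup' (fun v => signedSum (y v - y u) g) (hself 0 u)
      simpa [signedSum] using h
    exact cubeMean_nonneg fun g => Finset.sum_nonneg fun p _ => add_nonneg (hY0 _) (hY0 _)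
  have hΦstep : ∀ k < K, Φ k + σ * μ ≤ Φ (k + 1) := by
    intro k hk
    have hpt : ∀ g, (∑ p ∈ M g, (Y k p.1 + Y k p.2)) + 2 * σ * (M g).card ≤
        (∑ p ∈ M g, (Y (k + 1) p.1 + Y (k + 1) p.2)) +
          ((∑ u, |X k u g - Y k u| + ∑ u, |X k u (fun i => !g i) - Y k u|) +
          (∑ u, |X (k + 1) u g - Y (k + 1) u| +
            ∑ u, |X (k + 1) u (fun i => !g i) - Y (k + 1) u|)) := by
      intro g
      have hp : ∀ p ∈ M g, (Y k p.1 + Y k p.2) + 2 * σ ≤ (Y (k + 1) p.1 + Y (k + 1) p.2) +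
          ((|X k p.2 g - Y k p.2| + |X k p.1 (fun i => !g i) - Y k p.1|) +
          (|X (k + 1) p.1 g - Y (k + 1) p.1| +
            |X (k + 1) p.2 (fun i => !g i) - Y (k + 1) p.2|)) := by
        intro p hp
        have h1 := hstep k p.1 p.2 g (hMd g p hp).le (hMσ g p hp)
        have h2 := hstep k p.2 p.1 (fun i => !g i)
          (by simpa only [sub_sq_comm (y p.2 _)] using (hMd g p hp).le)
          (by
            rw [signedSum_not, signedSum_sub]
            have := hMσ g p hp
            rw [signedSum_sub] at this
            linarith)
        have a1 := neg_abs_le (X k p.2 g - Y k p.2)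
        have a2 := neg_abs_le (X k p.1 (fun i => !g i) - Y k p.1)
        have a3 := le_abs_self (X (k + 1) p.1 g - Y (k + 1) p.1)
        have a4 := le_abs_self (X (k + 1) p.2 (fun i => !g i) - Y (k + 1) p.2)
        linarith
      have hs := Finset.sum_le_sum hp
      rw [Finset.sum_add_distrib, Finset.sum_const, nsmul_eq_mul,
        Finset.sum_add_distrib (s := M g) (f := fun p : V × V => Y (k + 1) p.1 + Y (k + 1) p.2),
        Finset.sum_add_distrib
          (f := fun p : V × V => |X k p.2 g - Y k p.2| + |X k p.1 (fun i => !g i) - Y k p.1|),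
        Finset.sum_add_distrib (f := fun p : V × V => |X k p.2 g - Y k p.2|),
        Finset.sum_add_distrib (f := fun p : V × V => |X (k + 1) p.1 g - Y (k + 1) p.1|)] at hs
      have b1 := (hM g).sum_snd_le (f := fun u => |X k u g - Y k u|) fun _ => abs_nonneg _
      have b2 := (hM g).sum_fst_le (f := fun u => |X k u (fun i => !g i) - Y k u|)
        fun _ => abs_nonneg _
      have b3 := (hM g).sum_fst_le (f := fun u => |X (k + 1) u g - Y (k + 1) u|)
        fun _ => abs_nonneg _
      have b4 := (hM g).sum_snd_le (f := fun u => |X (k + 1) u (fun i => !g i) - Y (k + 1) u|)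
        fun _ => abs_nonneg _
      linarith
    have hm := cubeMean_mono hpt
    rw [cubeMean_add, cubeMean_const_mul, cubeMean_add (fun g => ∑ p ∈ M g, _),
      cubeMean_add (fun g => ∑ u, |X k u g - Y k u| + _), cubeMean_add (fun g => ∑ u, _),
      cubeMean_add (fun g => ∑ u, _)] at hm
    have c1 := hdevsum k hk.le
    have c2 := hdevsum' k hk.le
    have c3 := hdevsum (k + 1) hk
    have c4 := hdevsum' (k + 1) hk
    have c5 : cubeMean (fun g => ((M g).card : ℝ)) = μ := rfl
    rw [c5] at hm
    simp only [hΦ]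
    linarith
  have hΦK : ∀ k ≤ K, k * (σ * μ) ≤ Φ k := by
    intro k
    induction k with
    | zero => intro _; simpa using hΦ0
    | succ k ih =>
      intro hk
      have h1 := ih (by omega)
      have h2 := hΦstep k (by omega)
      push_cast
      linarith
  have hcard : ∀ u, Real.log (ball K u).card ≤ Real.log (Fintype.card V) := fun u => by
    apply Real.log_le_log
    · exact_mod_cast Finset.card_pos.2 ⟨u, hself K u⟩
    · exact_mod_cast Finset.card_le_univ _
  have hYK : ∀ u, t * Y K u ≤ Real.log (Fintype.card V) + t ^ 2 * (K * Δ) / 2 := fun u =>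
    (mean_sup_signedSum_le (ball K u) ⟨u, hself K u⟩ (fun v => y v - y u) (K * Δ)
      (hrad K u) t).trans (by linarith [hcard u])
  set b := Real.log (Fintype.card V) + t ^ 2 * (K * Δ) / 2 with hb
  have hup : t * Φ K ≤ 2 * b * μ := by
    rw [hμdef, ← cubeMean_const_mul, ← cubeMean_const_mul]
    refine cubeMean_mono fun g => ?_
    rw [Finset.mul_sum]
    refine (Finset.sum_le_sum fun p _ => (?_ : _ ≤ 2 * b)).trans ?_
    · have h1 := hYK p.1
      have h2 := hYK p.2
      linarith
    · rw [Finset.sum_const, nsmul_eq_mul, mul_comm]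
  have h1 := mul_le_mul_of_nonneg_left (hΦK K le_rfl) ht
  have h2 : t * (K * σ) * μ ≤ 2 * b * μ := by linarith
  exact le_of_mul_le_mul_right h2 hμ

/-- The structure theorem of Arora, Rao and Vazirani: in a spread finite metric space of negative
type there are two large sets at distance of order `1 / √(log n)`. -/
theorem exists_separated_sets {V : Type*} [Fintype V] [Nonempty V] {N : ℕ} (y : V → Fin N → ℝ)
    (htri : ∀ u v w, ∑ i, (y u i - y w i) ^ 2 ≤
      ∑ i, (y u i - y v i) ^ 2 + ∑ i, (y v i - y w i) ^ 2)
    {β γ Λ : ℝ} (hβ : 0 < β) (hγ : 0 < γ) (hγ1 : γ ≤ 1) (hΛ : 1 ≤ Λ)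
    (hlog : Real.log (Fintype.card V) ≤ Λ ^ 2)
    (hfar : ∀ u, γ * Fintype.card V ≤
      ((Finset.univ.filter fun v => β ≤ ∑ i, (y u i - y v i) ^ 2).card : ℝ)) :
    ∃ L R : Finset V, γ / 40 * Fintype.card V ≤ L.card ∧ γ / 40 * Fintype.card V ≤ R.card ∧
      ∀ u ∈ L, ∀ v ∈ R, β * γ ^ 2 / (819200 * Λ) ≤ ∑ i, (y u i - y v i) ^ 2 := by
  by_contra hno
  set q := (Fintype.card V : ℝ) with hq
  have hq0 : 0 < q := by rw [hq]; exact_mod_cast Fintype.card_pos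
  set b := Real.sqrt β with hbdef
  have hb0 : 0 < b := Real.sqrt_pos.2 hβ
  have hb2 : b ^ 2 = β := Real.sq_sqrt hβ.le
  have hΛ0 : 0 < Λ := by linarith
  set Δ := β * γ ^ 2 / (819200 * Λ) with hΔ
  have hΔ0 : 0 < Δ := by positivity
  choose M hM hMd hMc using fun g : Fin N → Bool =>
    exists_matching_of_not_separated hno (fun u => signedSum (y u) g) (b / 2)
  have hfarmean : γ * q * q / 5 ≤ cubeMean fun g => ((Finset.univ.filter fun p : V × V =>
      b / 2 ≤ |signedSum (y p.1) g - signedSum (y p.2) g|).card : ℝ) := by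
    have e : (fun g => ((Finset.univ.filter fun p : V × V =>
        b / 2 ≤ |signedSum (y p.1) g - signedSum (y p.2) g|).card : ℝ)) =
        fun g => ∑ u, ∑ v, if b / 2 ≤ |signedSum (y u - y v) g| then (1 : ℝ) else 0 := by
      funext g
      rw [Finset.card_filter, Fintype.sum_prod_type]
      push_cast
      simp only [signedSum_sub]
    rw [e, cubeMean_sum]
    have hu : ∀ u, γ * q / 5 ≤ cubeMean (fun g =>
        ∑ v, if b / 2 ≤ |signedSum (y u - y v) g| then (1 : ℝ) else 0) := by
      intro u
      rw [cubeMean_sum]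
      have h0 : ∀ v, 0 ≤ cubeMean (fun g =>
          if b / 2 ≤ |signedSum (y u - y v) g| then (1 : ℝ) else 0) := fun v => by
        refine cubeMean_nonneg fun g => ?_
        split_ifs <;> norm_num
      calc γ * q / 5 ≤ ∑ v ∈ Finset.univ.filter (fun v => β ≤ ∑ i, (y u i - y v i) ^ 2),
            (1 / 5 : ℝ) := by
              rw [Finset.sum_const, nsmul_eq_mul]
              linarith [hfar u]
        _ ≤ ∑ v ∈ Finset.univ.filter (fun v => β ≤ ∑ i, (y u i - y v i) ^ 2),
            cubeMean (fun g =>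
              if b / 2 ≤ |signedSum (y u - y v) g| then (1 : ℝ) else 0) := by
              refine Finset.sum_le_sum fun v hv => cubeMean_indicator_ge _ b hb0 ?_
              rw [hb2]
              exact (Finset.mem_filter.1 hv).2
        _ ≤ _ := Finset.sum_le_univ_sum_of_nonneg h0
    calc γ * q * q / 5 = ∑ _u : V, γ * q / 5 := by
          rw [Finset.sum_const, nsmul_eq_mul, Finset.card_univ, ← hq]
          ring
      _ ≤ _ := Finset.sum_le_sum fun u _ => hu u
  have hμ : γ / 40 * q ≤ cubeMean fun g => ((M g).card : ℝ) := by
    have h := cubeMean_mono hMc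
    simp only [← hq, div_eq_inv_mul _ (4 * q)] at h
    rw [cubeMean_sub, cubeMean_const_mul, cubeMean_const] at h
    have h2 := mul_le_mul_of_nonneg_left hfarmean (inv_pos.2 (by positivity : 0 < 4 * q)).le
    have h3 : (4 * q)⁻¹ * (γ * q * q / 5) = γ / 20 * q := by
      field_simp
      ring
    linarith
  set K := ⌊Λ⌋₊ with hK
  have hKle : (K : ℝ) ≤ Λ := Nat.floor_le hΛ0.le
  have hKge : Λ / 2 ≤ K := by
    have h1 : (1 : ℝ) ≤ K := by exact_mod_cast (Nat.one_le_floor_iff Λ).2 hΛ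
    have h2 := Nat.lt_floor_add_one Λ
    rw [← hK] at h2
    linarith
  have hΔΛ : Λ * Δ = β * γ ^ 2 / 819200 := by
    rw [hΔ]; field_simp
  have hmain := chaining_bound y htri hΔ0.le (τ := b * γ / 640) (σ := b / 4) (by positivity) M hM
    (fun g p hp => (hMd g p hp).1)
    (fun g p hp => by
      rw [signedSum_sub]
      linarith [(hMd g p hp).2])
    (lt_of_lt_of_le (by positivity) hμ) K
    (by
      have : (K : ℝ) * Δ ≤ Λ * Δ := by gcongr
      have e : (b * γ / 640) ^ 2 = β * γ ^ 2 / 409600 := by rw [← hb2]; ring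
      rw [e]
      linarith)
    (by
      rw [← hq]
      nlinarith)
    (b / (8 * Δ)) (by positivity)
  have h1 : b / (8 * Δ) * (K * (b / 4)) = K * β / (32 * Δ) := by
    rw [← hb2]; field_simp; ring
  have h2 : (b / (8 * Δ)) ^ 2 * (K * Δ) / 2 = K * β / (128 * Δ) := by
    rw [← hb2]; field_simp; ring
  rw [h1, h2] at hmain
  have h3 : K * β / (32 * Δ) = 2 * (K * β / (64 * Δ)) := by field_simp; ring
  have h4 : 2 * (K * β / (128 * Δ)) = K * β / (64 * Δ) := by field_simp; ring
  have h5 : K * β / (64 * Δ) = K * Λ * (12800 / γ ^ 2) := by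
    rw [hΔ]; field_simp; ring
  have h6 : (12800 : ℝ) ≤ 12800 / γ ^ 2 := by
    rw [le_div_iff₀ (by positivity)]
    nlinarith
  have h7 : Λ / 2 * Λ * 12800 ≤ K * Λ * (12800 / γ ^ 2) := by gcongr
  nlinarith

lemma integrableOn_indicator_Ioc (a b T : ℝ) :
    MeasureTheory.IntegrableOn ((Set.Ioc a b).indicator (1 : ℝ → ℝ)) (Set.Ioc 0 T) :=
  (MeasureTheory.integrableOn_const (C := (1 : ℝ)) (by simp)).indicator measurableSet_Ioc

lemma setIntegral_indicator_Ioc (a b T : ℝ) :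
    ∫ t in Set.Ioc 0 T, (Set.Ioc a b).indicator (1 : ℝ → ℝ) t = max (min T b - max 0 a) 0 := by
  rw [MeasureTheory.setIntegral_indicator measurableSet_Ioc, Set.Ioc_inter_Ioc]
  simp [Real.volume_real_Ioc]

lemma setIntegral_indicator_Ioc_le {a b T : ℝ} (hab : a ≤ b) :
    ∫ t in Set.Ioc 0 T, (Set.Ioc a b).indicator (1 : ℝ → ℝ) t ≤ b - a := by
  rw [setIntegral_indicator_Ioc]
  exact max_le (sub_le_sub (min_le_right _ _) (le_max_right _ _)) (sub_nonneg.2 hab)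

lemma exists_threshold {κ : Type*} (s : Finset κ) (a b : κ → ℝ) (hab : ∀ i ∈ s, a i ≤ b i)
    {T : ℝ} (hT : 0 < T) :
    ∃ t, 0 < t ∧ t ≤ T ∧ T * (s.filter fun i => a i < t ∧ t ≤ b i).card ≤ ∑ i ∈ s, (b i - a i) := by
  have hint : MeasureTheory.IntegrableOn
      (fun t => ∑ i ∈ s, (Set.Ioc (a i) (b i)).indicator (1 : ℝ → ℝ) t) (Set.Ioc 0 T) :=
    MeasureTheory.integrable_finsetSum _ fun i _ => integrableOn_indicator_Ioc _ _ _
  obtain ⟨t, ht, h⟩ := MeasureTheory.exists_le_setAverage (μ := MeasureTheory.volume)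
    (by simpa using hT) (by simp) hint
  refine ⟨t, ht.1, ht.2, ?_⟩
  rw [MeasureTheory.setAverage_eq, MeasureTheory.integral_finsetSum _
    fun i _ => integrableOn_indicator_Ioc _ _ _, Real.volume_real_Ioc_of_le hT.le, sub_zero,
    smul_eq_mul, le_inv_mul_iff₀ hT] at h
  have e : ((s.filter fun i => a i < t ∧ t ≤ b i).card : ℝ) =
      ∑ i ∈ s, (Set.Ioc (a i) (b i)).indicator (1 : ℝ → ℝ) t := by
    rw [Finset.card_filter]
    push_cast
    exact Finset.sum_congr rfl fun i _ => by simp [Set.indicator_apply]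
  rw [e]
  exact h.trans (Finset.sum_le_sum fun i hi => setIntegral_indicator_Ioc_le (hab i hi))

/-- A family of vectors in an inner product space has finite-dimensional coordinates. -/
lemma exists_coordinates {V H : Type*} [Fintype V] [NormedAddCommGroup H] [InnerProductSpace ℝ H]
    (x : V → H) : ∃ (N : ℕ) (y : V → Fin N → ℝ),
      ∀ u v, ∑ i, (y u i - y v i) ^ 2 = ‖x u - x v‖ ^ 2 := by
  let W := Submodule.span ℝ (Set.range x)
  have : FiniteDimensional ℝ W := FiniteDimensional.span_of_finite ℝ (Set.finite_range x)
  let b := stdOrthonormalBasis ℝ W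
  let z : V → W := fun u => ⟨x u, Submodule.subset_span ⟨u, rfl⟩⟩
  refine ⟨Module.finrank ℝ W, fun u i => b.repr (z u) i, fun u v => ?_⟩
  have h : ‖b.repr (z u) - b.repr (z v)‖ = ‖x u - x v‖ := by
    rw [← map_sub, LinearIsometryEquiv.norm_map]
    rfl
  rw [← h, EuclideanSpace.norm_sq_eq]
  simp

/-- The indices of the hyperedges that meet both `S` and its complement. -/
def cutEdges {V ι : Type*} [Fintype ι] (ed : ι → Finset V) (S : Finset V) : Finset ι :=
  Finset.univ.filter fun i => (∃ u ∈ ed i, u ∈ S) ∧ ∃ v ∈ ed i, v ∉ S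

/-- The indices of the hyperedges inside `Q`. -/
def innerEdges {V ι : Type*} [Fintype ι] (ed : ι → Finset V) (Q : Finset V) : Finset ι :=
  Finset.univ.filter fun i => ed i ⊆ Q

lemma cutCount_eq_card_cutEdges {V ι : Type*} [DecidableEq V] [Fintype ι] (ed : ι → Finset V)
    (S : Finset V) : cutCount ed S = (cutEdges ed S).card := by
  unfold cutCount cutEdges
  congr 1
  ext i
  simp [Cuts, Finset.Nonempty]

/-- Sweep cuts with respect to the distance from a set `L`. -/
lemma exists_sweep_cut {V ι : Type*} [Fintype ι] (ed : ι → Finset V)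
    (hed : ∀ i, (ed i).Nonempty) (d : V → V → ℝ) (hd0 : ∀ u, d u u = 0)
    (htri : ∀ u v w, d u w ≤ d u v + d v w) (m : ι → ℝ)
    (hm : ∀ i, ∀ u ∈ ed i, ∀ v ∈ ed i, d u v ≤ m i) {Q L R : Finset V} (hLQ : L ⊆ Q)
    (hL : L.Nonempty) {Δ : ℝ} (hΔ : 0 < Δ) (hLR : ∀ u ∈ L, ∀ v ∈ R, Δ ≤ d u v) :
    ∃ S ⊆ Q, L ⊆ S ∧ (∀ v ∈ R, v ∉ S) ∧
      Δ * (innerEdges ed Q ∩ cutEdges ed S).card ≤ ∑ i ∈ innerEdges ed Q, m i := by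
  set f : V → ℝ := fun v => L.inf' hL fun u => d u v with hf
  have hlip : ∀ u v, f v ≤ f u + d u v := by
    intro u v
    obtain ⟨w, hw, h⟩ := L.exists_mem_eq_inf' hL fun w => d w u
    have h1 : f v ≤ d w v := Finset.inf'_le _ hw
    have h2 : f u = d w u := h
    linarith [htri w u v]
  obtain ⟨t, ht0, htΔ, ht⟩ := exists_threshold (innerEdges ed Q)
    (fun i => (ed i).inf' (hed i) f) (fun i => (ed i).sup' (hed i) f)
    (fun i _ => by
      obtain ⟨u, hu⟩ := hed i
      exact (Finset.inf'_le f hu).trans (Finset.le_sup' f hu)) hΔ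
  refine ⟨Q.filter fun v => f v < t, Finset.filter_subset _ _, fun v hv => ?_, fun v hv h => ?_, ?_⟩
  · refine Finset.mem_filter.2 ⟨hLQ hv, lt_of_le_of_lt ?_ ht0⟩
    rw [← hd0 v]
    exact Finset.inf'_le (fun u => d u v) hv
  · have h1 := (Finset.mem_filter.1 h).2
    have h2 : Δ ≤ f v := (Finset.le_inf'_iff _ _).2 fun u hu => hLR u hu v hv
    linarith
  · have hsub : innerEdges ed Q ∩ cutEdges ed (Q.filter fun v => f v < t) ⊆
        (innerEdges ed Q).filter fun i => (ed i).inf' (hed i) f < t ∧ t ≤ (ed i).sup' (hed i) f := by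
      intro i hi
      obtain ⟨hi1, hi2⟩ := Finset.mem_inter.1 hi
      obtain ⟨⟨u, hu, huS⟩, v, hv, hvS⟩ := (Finset.mem_filter.1 hi2).2
      have hvQ : v ∈ Q := (Finset.mem_filter.1 hi1).2 hv
      refine Finset.mem_filter.2 ⟨hi1, (Finset.inf'_le f hu).trans_lt (Finset.mem_filter.1 huS).2,
        le_trans ?_ (Finset.le_sup' f hv)⟩
      by_contra! h
      exact hvS (Finset.mem_filter.2 ⟨hvQ, h⟩)
    have hcard : ((innerEdges ed Q ∩ cutEdges ed (Q.filter fun v => f v < t)).card : ℝ) ≤ _ :=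
      Nat.cast_le.2 (Finset.card_le_card hsub)
    refine (mul_le_mul_of_nonneg_left hcard hΔ.le).trans (ht.trans (Finset.sum_le_sum fun i _ => ?_))
    obtain ⟨u, hu, hu'⟩ := (ed i).exists_mem_eq_sup' (hed i) f
    obtain ⟨v, hv, hv'⟩ := (ed i).exists_mem_eq_inf' (hed i) f
    rw [hu', hv']
    linarith [hlip v u, hm i v hv u hu]

/-- `P` is a partition of `Q` into cells of size at most `s` (one cell may be empty). -/
structure IsCellPartition {V : Type*} (P : Finset (Finset V)) (Q : Finset V) (s : ℝ) : Prop where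
  subset : ∀ C ∈ P, C ⊆ Q
  card_le : ∀ C ∈ P, (C.card : ℝ) ≤ s
  cover : ∀ v ∈ Q, ∃ C ∈ P, v ∈ C
  eq_of_mem : ∀ C ∈ P, ∀ C' ∈ P, ∀ v, v ∈ C → v ∈ C' → C = C'

/-- The indices of the hyperedges inside `Q` that are not inside a cell of `P`. -/
def brokenEdges {V ι : Type*} [Fintype ι] (ed : ι → Finset V) (P : Finset (Finset V))
    (Q : Finset V) : Finset ι :=
  (innerEdges ed Q).filter fun i => ¬ ∃ C ∈ P, ed i ⊆ C

lemma sum_innerEdges_add_le {V ι : Type*} [Fintype ι] (ed : ι → Finset V)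
    (hed : ∀ i, (ed i).Nonempty) (m : ι → ℝ) (hm : ∀ i, 0 ≤ m i) {Q S : Finset V} (hS : S ⊆ Q) :
    ∑ i ∈ innerEdges ed S, m i + ∑ i ∈ innerEdges ed (Q \ S), m i ≤
      ∑ i ∈ innerEdges ed Q, m i := by
  rw [← Finset.sum_union]
  · refine Finset.sum_le_sum_of_subset_of_nonneg (fun i hi => ?_) fun i _ _ => hm i
    simp only [innerEdges, Finset.mem_union, Finset.mem_filter, Finset.mem_univ, true_and] at hi ⊢
    rcases hi with h | h
    · exact h.trans hS
    · exact h.trans Finset.sdiff_subset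
  · refine Finset.disjoint_left.2 fun i h1 h2 => ?_
    simp only [innerEdges, Finset.mem_filter, Finset.mem_univ, true_and] at h1 h2
    obtain ⟨u, hu⟩ := hed i
    exact (Finset.mem_sdiff.1 (h2 hu)).2 (h1 hu)

/-- Repeatedly applying balanced cuts yields a partition into small cells. -/
lemma exists_cellPartition {V ι : Type*} [Fintype ι] (ed : ι → Finset V)
    (hed : ∀ i, (ed i).Nonempty) (m : ι → ℝ) (hm : ∀ i, 0 ≤ m i) (W : Finset V) {s θ A : ℝ}
    (hA : 0 ≤ A)
    (hcut : ∀ Q ⊆ W, s < Q.card → ∃ S ⊆ Q, (S.card : ℝ) ≤ θ * Q.card ∧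
      ((Q \ S).card : ℝ) ≤ θ * Q.card ∧
      ((innerEdges ed Q ∩ cutEdges ed S).card : ℝ) ≤ A * ∑ i ∈ innerEdges ed Q, m i)
    (hθ : 0 ≤ θ) (k : ℕ) :
    ∀ Q ⊆ W, θ ^ k * Q.card ≤ s → ∃ P, IsCellPartition P Q s ∧
      ((brokenEdges ed P Q).card : ℝ) ≤ k * (A * ∑ i ∈ innerEdges ed Q, m i) := by
  have hw : ∀ Q, 0 ≤ A * ∑ i ∈ innerEdges ed Q, m i := fun Q =>
    mul_nonneg hA (Finset.sum_nonneg fun i _ => hm i)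
  have hsmall : ∀ (k : ℕ) (Q : Finset V), (Q.card : ℝ) ≤ s → ∃ P, IsCellPartition P Q s ∧
      ((brokenEdges ed P Q).card : ℝ) ≤ k * (A * ∑ i ∈ innerEdges ed Q, m i) := by
    intro k Q hQ
    refine ⟨{Q}, ⟨by simp, by simpa using hQ, by simp, by simp⟩, ?_⟩
    have : brokenEdges ed {Q} Q = ∅ := by
      ext i
      simp [brokenEdges, innerEdges]
    rw [this]
    have := hw Q
    simp only [Finset.card_empty, Nat.cast_zero]
    positivity
  induction k with
  | zero =>
    intro Q _ hQ
    exact hsmall 0 Q (by simpa using hQ)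
  | succ k ih =>
    intro Q hQW hQ
    rcases le_or_gt (Q.card : ℝ) s with hle | hlt
    · exact hsmall _ Q hle
    obtain ⟨S, hSQ, hS1, hS2, hSc⟩ := hcut Q hQW hlt
    have hpow : ∀ c : ℝ, c ≤ θ * Q.card → θ ^ k * c ≤ s := fun c hc => by
      refine (mul_le_mul_of_nonneg_left hc (pow_nonneg hθ k)).trans ?_
      rw [← mul_assoc, ← pow_succ]
      exact hQ
    obtain ⟨P₁, hP₁, hb₁⟩ := ih S (hSQ.trans hQW) (hpow _ hS1)
    obtain ⟨P₂, hP₂, hb₂⟩ := ih (Q \ S) (Finset.sdiff_subset.trans hQW) (hpow _ hS2)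
    refine ⟨P₁ ∪ P₂, ⟨?_, ?_, ?_, ?_⟩, ?_⟩
    · intro C hC
      rcases Finset.mem_union.1 hC with h | h
      · exact (hP₁.subset C h).trans hSQ
      · exact (hP₂.subset C h).trans Finset.sdiff_subset
    · intro C hC
      rcases Finset.mem_union.1 hC with h | h
      · exact hP₁.card_le C h
      · exact hP₂.card_le C h
    · intro v hv
      by_cases hvS : v ∈ S
      · obtain ⟨C, hC, h⟩ := hP₁.cover v hvS
        exact ⟨C, Finset.mem_union_left _ hC, h⟩
      · obtain ⟨C, hC, h⟩ := hP₂.cover v (Finset.mem_sdiff.2 ⟨hv, hvS⟩)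
        exact ⟨C, Finset.mem_union_right _ hC, h⟩
    · intro C hC C' hC' v hv hv'
      rcases Finset.mem_union.1 hC with h | h <;> rcases Finset.mem_union.1 hC' with h' | h'
      · exact hP₁.eq_of_mem C h C' h' v hv hv'
      · exact absurd (hP₁.subset C h hv) (Finset.mem_sdiff.1 (hP₂.subset C' h' hv')).2
      · exact absurd (hP₁.subset C' h' hv') (Finset.mem_sdiff.1 (hP₂.subset C h hv)).2
      · exact hP₂.eq_of_mem C h C' h' v hv hv'
    · have hsub : brokenEdges ed (P₁ ∪ P₂) Q ⊆ (brokenEdges ed P₁ S ∪ brokenEdges ed P₂ (Q \ S)) ∪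
          (innerEdges ed Q ∩ cutEdges ed S) := by
        intro i hi
        simp only [brokenEdges, innerEdges, cutEdges, Finset.mem_filter, Finset.mem_univ, true_and,
          Finset.mem_union, Finset.mem_inter] at hi ⊢
        obtain ⟨hiQ, hi⟩ := hi
        by_cases h1 : ed i ⊆ S
        · exact Or.inl (Or.inl ⟨h1, fun ⟨C, hC, h⟩ => hi ⟨C, Or.inl hC, h⟩⟩)
        by_cases h2 : ed i ⊆ Q \ S
        · exact Or.inl (Or.inr ⟨h2, fun ⟨C, hC, h⟩ => hi ⟨C, Or.inr hC, h⟩⟩)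
        refine Or.inr ⟨hiQ, ?_, Finset.not_subset.1 h1⟩
        obtain ⟨u, hu, hu'⟩ := Finset.not_subset.1 h2
        refine ⟨u, hu, ?_⟩
        by_contra h
        exact hu' (Finset.mem_sdiff.2 ⟨hiQ hu, h⟩)
      have hc := (Finset.card_le_card hsub).trans ((Finset.card_union_le _ _).trans
        (Nat.add_le_add_right (Finset.card_union_le _ _) _))
      have hc' : ((brokenEdges ed (P₁ ∪ P₂) Q).card : ℝ) ≤ (brokenEdges ed P₁ S).card +
          (brokenEdges ed P₂ (Q \ S)).card + (innerEdges ed Q ∩ cutEdges ed S).card := by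
        exact_mod_cast hc
      have hs := mul_le_mul_of_nonneg_left (sum_innerEdges_add_le ed hed m hm hSQ)
        (mul_nonneg (Nat.cast_nonneg k) hA)
      push_cast
      linarith

/-- Merging small cells leaves a bounded number of cells. -/
lemma exists_cellPartition_card_le {V ι : Type*} [Fintype ι] (ed : ι → Finset V)
    {P : Finset (Finset V)} {Q : Finset V} {s : ℝ} (hs : 0 < s) (hP : IsCellPartition P Q s) :
    ∃ P', IsCellPartition P' Q s ∧ brokenEdges ed P' Q ⊆ brokenEdges ed P Q ∧
      (P'.card : ℝ) ≤ 1 + 2 * Q.card / s := by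
  have hex : ∃ n, ∃ P', IsCellPartition P' Q s ∧ brokenEdges ed P' Q ⊆ brokenEdges ed P Q ∧
      P'.card = n := ⟨_, P, hP, subset_rfl, rfl⟩
  obtain ⟨P', hP', hb, hcard⟩ := Nat.find_spec hex
  refine ⟨P', hP', hb, ?_⟩
  have hone : (P'.filter fun C => (C.card : ℝ) ≤ s / 2).card ≤ 1 := by
    refine Finset.card_le_one.2 fun C hC C' hC' => ?_
    by_contra hne
    obtain ⟨hC, hCs⟩ := Finset.mem_filter.1 hC
    obtain ⟨hC', hCs'⟩ := Finset.mem_filter.1 hC'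
    have hlt : (insert (C ∪ C') ((P'.erase C).erase C')).card < Nat.find hex := by
      rw [← hcard]
      have h1 := Finset.card_insert_le (C ∪ C') ((P'.erase C).erase C')
      have h2 : C' ∈ P'.erase C := Finset.mem_erase.2 ⟨fun h => hne h.symm, hC'⟩
      have h3 := Finset.card_erase_add_one h2
      have h4 := Finset.card_erase_add_one hC
      omega
    refine Nat.find_min hex hlt ⟨_, ⟨?_, ?_, ?_, ?_⟩, ?_, rfl⟩
    · intro D hD
      rcases Finset.mem_insert.1 hD with rfl | h
      · exact Finset.union_subset (hP'.subset _ hC) (hP'.subset _ hC')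
      · exact hP'.subset _ (Finset.mem_of_mem_erase (Finset.mem_of_mem_erase h))
    · intro D hD
      rcases Finset.mem_insert.1 hD with rfl | h
      · have : ((C ∪ C').card : ℝ) ≤ C.card + C'.card := by
          exact_mod_cast Finset.card_union_le C C'
        linarith
      · exact hP'.card_le _ (Finset.mem_of_mem_erase (Finset.mem_of_mem_erase h))
    · intro v hv
      obtain ⟨D, hD, hvD⟩ := hP'.cover v hv
      by_cases h1 : D = C
      · exact ⟨_, Finset.mem_insert_self _ _, Finset.mem_union_left _ (h1 ▸ hvD)⟩
      by_cases h2 : D = C'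
      · exact ⟨_, Finset.mem_insert_self _ _, Finset.mem_union_right _ (h2 ▸ hvD)⟩
      · exact ⟨D, Finset.mem_insert_of_mem (Finset.mem_erase.2 ⟨h2, Finset.mem_erase.2 ⟨h1, hD⟩⟩),
          hvD⟩
    · have hkey : ∀ D ∈ (P'.erase C).erase C', ∀ v, v ∈ D → v ∉ C ∪ C' := by
        intro D hD v hvD hv
        obtain ⟨h2, hD⟩ := Finset.mem_erase.1 hD
        obtain ⟨h1, hD⟩ := Finset.mem_erase.1 hD
        rcases Finset.mem_union.1 hv with h | h
        · exact h1 (hP'.eq_of_mem D hD C hC v hvD h)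
        · exact h2 (hP'.eq_of_mem D hD C' hC' v hvD h)
      intro D hD D' hD' v hv hv'
      rcases Finset.mem_insert.1 hD with rfl | h <;> rcases Finset.mem_insert.1 hD' with rfl | h'
      · rfl
      · exact absurd hv (hkey D' h' v hv')
      · exact absurd hv' (hkey D h v hv)
      · exact hP'.eq_of_mem D (Finset.mem_of_mem_erase (Finset.mem_of_mem_erase h)) D'
          (Finset.mem_of_mem_erase (Finset.mem_of_mem_erase h')) v hv hv'
    · refine subset_trans (fun i hi => ?_) hb
      obtain ⟨hi1, hi2⟩ := Finset.mem_filter.1 hi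
      refine Finset.mem_filter.2 ⟨hi1, ?_⟩
      rintro ⟨D, hD, h⟩
      refine hi2 ?_
      by_cases h1 : D = C
      · exact ⟨_, Finset.mem_insert_self _ _, (h1 ▸ h).trans Finset.subset_union_left⟩
      by_cases h2 : D = C'
      · exact ⟨_, Finset.mem_insert_self _ _, (h2 ▸ h).trans Finset.subset_union_right⟩
      · exact ⟨D, Finset.mem_insert_of_mem (Finset.mem_erase.2 ⟨h2, Finset.mem_erase.2 ⟨h1, hD⟩⟩), h⟩
  have hsum : ∑ C ∈ P', C.card ≤ Q.card := by
    rw [← Finset.card_biUnion]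
    · exact Finset.card_le_card (Finset.biUnion_subset.2 hP'.subset)
    · intro C hC C' hC' hne
      exact Finset.disjoint_left.2 fun v hv hv' => hne (hP'.eq_of_mem C hC C' hC' v hv hv')
  have hbig : ((P'.filter fun C => ¬ (C.card : ℝ) ≤ s / 2).card : ℝ) * (s / 2) ≤ Q.card := by
    calc _ = ∑ C ∈ P'.filter (fun C => ¬ (C.card : ℝ) ≤ s / 2), s / 2 := by
          rw [Finset.sum_const, nsmul_eq_mul]
      _ ≤ ∑ C ∈ P'.filter (fun C => ¬ (C.card : ℝ) ≤ s / 2), (C.card : ℝ) :=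
          Finset.sum_le_sum fun C hC => (not_le.1 (Finset.mem_filter.1 hC).2).le
      _ ≤ ∑ C ∈ P', (C.card : ℝ) :=
          Finset.sum_le_sum_of_subset_of_nonneg (Finset.filter_subset _ _) fun _ _ _ => by positivity
      _ ≤ Q.card := by exact_mod_cast hsum
  have hsplit := Finset.card_filter_add_card_filter_not (s := P') (fun C => (C.card : ℝ) ≤ s / 2)
  have hsplit' : ((P'.filter fun C => (C.card : ℝ) ≤ s / 2).card : ℝ) +
      (P'.filter fun C => ¬ (C.card : ℝ) ≤ s / 2).card = P'.card := by exact_mod_cast hsplit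
  have hone' : ((P'.filter fun C => (C.card : ℝ) ≤ s / 2).card : ℝ) ≤ 1 := by exact_mod_cast hone
  have : ((P'.filter fun C => ¬ (C.card : ℝ) ≤ s / 2).card : ℝ) ≤ 2 * Q.card / s := by
    rw [le_div_iff₀ hs]
    linarith
  linarith

/-- If every small set has expansion at least `κ`, then so does, up to the number of cells, the
union of the cells of a partition into small cells. -/
lemma mul_card_le_of_cellPartition {V ι : Type*} [Fintype ι] (ed : ι → Finset V)
    {P : Finset (Finset V)} {Q : Finset V} {s κ : ℝ} (hP : IsCellPartition P Q s) (hκ : 0 ≤ κ)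
    (h : ∀ S : Finset V, S.Nonempty → (S.card : ℝ) ≤ s → κ * S.card ≤ (cutEdges ed S).card) :
    κ * Q.card ≤ P.card * ((cutEdges ed Q).card + (brokenEdges ed P Q).card) := by
  have hQ : Q.card ≤ ∑ C ∈ P, C.card := by
    refine (Finset.card_le_card fun v hv => ?_).trans (Finset.card_biUnion_le (s := P) (t := id))
    obtain ⟨C, hC, h⟩ := hP.cover v hv
    exact Finset.mem_biUnion.2 ⟨C, hC, h⟩
  have hcell : ∀ C ∈ P, κ * C.card ≤ (cutEdges ed Q).card + (brokenEdges ed P Q).card := by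
    intro C hC
    rcases C.eq_empty_or_nonempty with rfl | hne
    · simp only [Finset.card_empty, Nat.cast_zero, mul_zero]
      positivity
    refine (h C hne (hP.card_le C hC)).trans ?_
    have hsub : cutEdges ed C ⊆ cutEdges ed Q ∪ brokenEdges ed P Q := by
      intro i hi
      obtain ⟨-, ⟨u, hu, huC⟩, v, hv, hvC⟩ := Finset.mem_filter.1 hi
      by_cases hin : ed i ⊆ Q
      · refine Finset.mem_union_right _ (Finset.mem_filter.2
          ⟨Finset.mem_filter.2 ⟨Finset.mem_univ _, hin⟩, ?_⟩)
        rintro ⟨C', hC', h'⟩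
        have := hP.eq_of_mem C hC C' hC' u huC (h' hu)
        exact hvC (this ▸ h' hv)
      · exact Finset.mem_union_left _ (Finset.mem_filter.2
          ⟨Finset.mem_univ _, ⟨u, hu, hP.subset C hC huC⟩, Finset.not_subset.1 hin⟩)
    exact_mod_cast (Finset.card_le_card hsub).trans (Finset.card_union_le _ _)
  calc κ * Q.card ≤ κ * ∑ C ∈ P, (C.card : ℝ) := by
        gcongr
        exact_mod_cast hQ
    _ = ∑ C ∈ P, κ * C.card := Finset.mul_sum _ _ _
    _ ≤ ∑ _C ∈ P, (((cutEdges ed Q).card : ℝ) + (brokenEdges ed P Q).card) :=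
        Finset.sum_le_sum hcell
    _ = _ := by rw [Finset.sum_const, nsmul_eq_mul]

lemma sq_norm_sub_le_maxDistSq {V H : Type*} [NormedAddCommGroup H] (x : V → H) {e : Finset V}
    {u v : V} (hu : u ∈ e) (hv : v ∈ e) : ‖x u - x v‖ ^ 2 ≤ maxDistSq x e := by
  refine le_csSup (Set.Finite.bddAbove (Set.Finite.subset
    ((e ×ˢ e).image fun p => ‖x p.1 - x p.2‖ ^ 2).finite_toSet ?_)) ⟨u, hu, v, hv, rfl⟩
  rintro d ⟨a, ha, b, hb, rfl⟩
  exact Finset.mem_coe.2 (Finset.mem_image.2 ⟨(a, b), Finset.mem_product.2 ⟨ha, hb⟩, rfl⟩)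

lemma maxDistSq_nonneg {V H : Type*} [NormedAddCommGroup H] (x : V → H) (e : Finset V) :
    0 ≤ maxDistSq x e := by
  refine Real.sSup_nonneg ?_
  rintro d ⟨a, -, b, -, rfl⟩
  positivity

/-- The vertices whose squared norm is within a factor two above `r`. -/
def levelSet {V H : Type*} [Fintype V] [NormedAddCommGroup H] (x : V → H) (r : ℝ) : Finset V :=
  Finset.univ.filter fun u => ‖x u‖ ^ 2 / 2 < r ∧ r ≤ ‖x u‖ ^ 2

lemma cutEdges_levelSet_card_le {V ι H : Type*} [Fintype V] [Fintype ι]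
    [NormedAddCommGroup H] (ed : ι → Finset V)
    (hed : ∀ i, (ed i).Nonempty) (x : V → H) (r : ℝ) :
    ((cutEdges ed (levelSet x r)).card : ℝ) ≤ ∑ i,
      ((Set.Ioc ((ed i).inf' (hed i) (fun u => ‖x u‖ ^ 2) / 2)
          ((ed i).sup' (hed i) (fun u => ‖x u‖ ^ 2) / 2)).indicator (1 : ℝ → ℝ) r +
        (Set.Ioc ((ed i).inf' (hed i) (fun u => ‖x u‖ ^ 2))
          ((ed i).sup' (hed i) (fun u => ‖x u‖ ^ 2))).indicator (1 : ℝ → ℝ) r) := by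
  rw [cutEdges, Finset.card_filter]
  push_cast
  refine Finset.sum_le_sum fun i _ => ?_
  have h0 : ∀ s : Set ℝ, 0 ≤ s.indicator (1 : ℝ → ℝ) r := fun s =>
    Set.indicator_nonneg (fun _ _ => zero_le_one) r
  split_ifs with h
  · obtain ⟨⟨u, hu, huW⟩, v, hv, hvW⟩ := h
    obtain ⟨-, hu1, hu2⟩ := Finset.mem_filter.1 huW
    have hv' : ¬ (‖x v‖ ^ 2 / 2 < r ∧ r ≤ ‖x v‖ ^ 2) := fun h =>
      hvW (Finset.mem_filter.2 ⟨Finset.mem_univ _, h⟩)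
    have hiu := Finset.inf'_le (fun u => ‖x u‖ ^ 2) hu
    have hiv := Finset.inf'_le (fun u => ‖x u‖ ^ 2) hv
    have hsu := Finset.le_sup' (fun u => ‖x u‖ ^ 2) hu
    have hsv := Finset.le_sup' (fun u => ‖x u‖ ^ 2) hv
    rcases le_or_gt r (‖x v‖ ^ 2 / 2) with hle | hlt
    · refine le_add_of_le_of_nonneg (le_of_eq ?_) (h0 _)
      rw [Set.indicator_of_mem (Set.mem_Ioc.2 ⟨by linarith, by linarith⟩), Pi.one_apply]
    · have : ‖x v‖ ^ 2 < r := not_le.1 fun h => hv' ⟨hlt, h⟩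
      refine le_add_of_nonneg_of_le (h0 _) (le_of_eq ?_)
      rw [Set.indicator_of_mem (Set.mem_Ioc.2 ⟨by linarith, by linarith⟩), Pi.one_apply]
  · exact add_nonneg (h0 _) (h0 _)

lemma sum_innerEdges_levelSet_le {V ι H : Type*} [Fintype V] [Fintype ι]
    [NormedAddCommGroup H] (ed : ι → Finset V)
    (hed : ∀ i, (ed i).Nonempty) (x : V → H) {r : ℝ} (hr : 0 < r) (m : ι → ℝ)
    (hm : ∀ i, 0 ≤ m i) :
    ∑ i ∈ innerEdges ed (levelSet x r), m i / r ≤ ∑ i,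
      m i * (2 / (ed i).sup' (hed i) (fun u => ‖x u‖ ^ 2)) *
        (Set.Ioc ((ed i).sup' (hed i) (fun u => ‖x u‖ ^ 2) / 2)
          ((ed i).sup' (hed i) (fun u => ‖x u‖ ^ 2))).indicator (1 : ℝ → ℝ) r := by
  rw [innerEdges, Finset.sum_filter]
  refine Finset.sum_le_sum fun i _ => ?_
  obtain ⟨u, hu, hsup⟩ := (ed i).exists_mem_eq_sup' (hed i) fun u => ‖x u‖ ^ 2
  rw [hsup]
  split_ifs with h
  · obtain ⟨-, h1, h2⟩ := Finset.mem_filter.1 (h hu)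
    rw [Set.indicator_of_mem (Set.mem_Ioc.2 ⟨h1, h2⟩), Pi.one_apply, mul_one, div_eq_mul_one_div]
    refine mul_le_mul_of_nonneg_left ?_ (hm i)
    rw [div_le_div_iff₀ hr (hr.trans_le h2)]
    linarith
  · exact mul_nonneg (mul_nonneg (hm i) (by positivity))
      (Set.indicator_nonneg (fun _ _ => zero_le_one) r)

section Feasible

variable {V H : Type*} [Fintype V] [NormedAddCommGroup H] [InnerProductSpace ℝ H]
  {x : V → H} {δ : ℝ}

lemma SDPFeasible.sq_norm_sub_sq_norm_le (hx : SDPFeasible x δ) (u v : V) :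
    ‖x v‖ ^ 2 - ‖x u‖ ^ 2 ≤ ‖x u - x v‖ ^ 2 := by
  have h1 := (hx.2.2.2 u v).2
  have h2 := norm_sub_sq_real (x u) (x v)
  linarith

lemma SDPFeasible.sub_le_inner (hx : SDPFeasible x δ) (u v : V) :
    ‖x u‖ ^ 2 - ‖x u - x v‖ ^ 2 ≤ (⟪x u, x v⟫ : ℝ) := by
  have h1 := hx.sq_norm_sub_sq_norm_le v u
  rw [norm_sub_rev] at h1
  have h2 := norm_sub_sq_real (x u) (x v)
  linarith

lemma SDPFeasible.one_le (hx : SDPFeasible x δ) : 1 ≤ δ * Fintype.card V := by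
  have hpos : 0 < ∑ u : V, ‖x u‖ ^ 2 := by
    rw [hx.2.1]
    exact one_pos
  obtain ⟨u, -, hu⟩ := Finset.exists_lt_of_sum_lt (s := Finset.univ) (f := fun _ : V => (0 : ℝ))
    (g := fun u => ‖x u‖ ^ 2) (by simpa using hpos)
  have h1 : ‖x u‖ ^ 2 ≤ ∑ v, (⟪x u, x v⟫ : ℝ) := by
    rw [← real_inner_self_eq_norm_sq]
    exact Finset.single_le_sum (f := fun v => (⟪x u, x v⟫ : ℝ))
      (fun v _ => (hx.2.2.2 u v).1) (Finset.mem_univ u)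
  have h2 := h1.trans (hx.1 u)
  nlinarith

lemma SDPFeasible.sq_norm_le_one (hx : SDPFeasible x δ) (u : V) : ‖x u‖ ^ 2 ≤ 1 := by
  rw [← hx.2.1]
  exact Finset.single_le_sum (f := fun v => ‖x v‖ ^ 2) (fun v _ => by positivity)
    (Finset.mem_univ u)

/-- Few vectors are close to a given one. -/
lemma SDPFeasible.card_near_le (hx : SDPFeasible x δ) {β r : ℝ} {u : V} (hr : 0 < r)
    (hβ : 0 ≤ β) (hu : r ≤ ‖x u‖ ^ 2) (Q : Finset V) :
    (1 - β) * (Q.filter fun v => ‖x u - x v‖ ^ 2 < β * r).card ≤ δ * Fintype.card V := by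
  have hpos : 0 < ‖x u‖ ^ 2 := hr.trans_le hu
  have h : (Q.filter fun v => ‖x u - x v‖ ^ 2 < β * r).card * ((1 - β) * ‖x u‖ ^ 2) ≤
      δ * Fintype.card V * ‖x u‖ ^ 2 := by
    refine le_trans ?_ (hx.1 u)
    calc _ = ∑ v ∈ Q.filter (fun v => ‖x u - x v‖ ^ 2 < β * r), (1 - β) * ‖x u‖ ^ 2 := by
          rw [Finset.sum_const, nsmul_eq_mul]
      _ ≤ ∑ v ∈ Q.filter (fun v => ‖x u - x v‖ ^ 2 < β * r), (⟪x u, x v⟫ : ℝ) := by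
          refine Finset.sum_le_sum fun v hv => ?_
          have h1 := (Finset.mem_filter.1 hv).2
          have h2 := hx.sub_le_inner u v
          have h3 := mul_le_mul_of_nonneg_left hu hβ
          linarith
      _ ≤ ∑ v, (⟪x u, x v⟫ : ℝ) :=
          Finset.sum_le_sum_of_subset_of_nonneg (Finset.subset_univ _)
            fun v _ _ => (hx.2.2.2 u v).1
  refine le_of_mul_le_mul_right ?_ hpos
  linarith

lemma SDPFeasible.exists_balanced_cut (hx : SDPFeasible x δ) {ι : Type*} [Fintype ι]
    (ed : ι → Finset V) (hed : ∀ i, (ed i).Nonempty) {ε r Λ : ℝ} (hε : 0 < ε) (hε1 : ε < 1)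
    (hr : 0 < r) (hΛ : 1 ≤ Λ) (hlog : Real.log (Fintype.card V) ≤ Λ ^ 2) {Q : Finset V}
    (hQr : ∀ u ∈ Q, r ≤ ‖x u‖ ^ 2) (hQ : (1 + ε) * δ * Fintype.card V < Q.card) :
    ∃ S ⊆ Q, (S.card : ℝ) ≤ (1 - ε / 160) * Q.card ∧
      ((Q \ S).card : ℝ) ≤ (1 - ε / 160) * Q.card ∧
      ((innerEdges ed Q ∩ cutEdges ed S).card : ℝ) ≤
        52428800 * Λ / (ε ^ 3 * r) * ∑ i ∈ innerEdges ed Q, maxDistSq x (ed i) := by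
  have hδn := hx.one_le
  have hQpos : (0 : ℝ) < Q.card := lt_of_le_of_lt (by nlinarith) hQ
  have hQne : Q.Nonempty := Finset.card_pos.1 (by exact_mod_cast hQpos)
  have : Nonempty Q := hQne.to_subtype
  obtain ⟨N, y, hy⟩ := exists_coordinates fun u : Q => x u
  have hlogQ : Real.log (Fintype.card Q) ≤ Λ ^ 2 := by
    refine le_trans (Real.log_le_log ?_ ?_) hlog
    · exact_mod_cast Fintype.card_pos
    · rw [Fintype.card_coe]
      exact_mod_cast Finset.card_le_univ Q
  have hfar : ∀ u : Q, ε / 4 * Fintype.card Q ≤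
      ((Finset.univ.filter fun v : Q => ε / 4 * r ≤ ∑ i, (y u i - y v i) ^ 2).card : ℝ) := by
    intro u
    have h1 : (Finset.univ.filter fun v : Q => ε / 4 * r ≤ ∑ i, (y u i - y v i) ^ 2).card =
        (Q.filter fun v => ¬ ‖x u - x v‖ ^ 2 < ε / 4 * r).card := by
      rw [← Finset.card_map (Function.Embedding.subtype (· ∈ Q))]
      congr 1
      ext v
      simp [hy, and_comm]
    have h2 := Finset.card_filter_add_card_filter_not (s := Q)
      (fun v => ‖x u - x v‖ ^ 2 < ε / 4 * r)
    have h2' : ((Q.filter fun v => ‖x u - x v‖ ^ 2 < ε / 4 * r).card : ℝ) +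
        (Q.filter fun v => ¬ ‖x u - x v‖ ^ 2 < ε / 4 * r).card = Q.card := by exact_mod_cast h2
    have h3 := hx.card_near_le hr (by positivity : 0 ≤ ε / 4) (hQr u u.2) Q
    rw [h1, Fintype.card_coe]
    set a : ℝ := ((Q.filter fun v => ‖x u - x v‖ ^ 2 < ε / 4 * r).card : ℝ)
    have ha : a ≤ (1 + ε / 2) * (δ * Fintype.card V) := by
      have ha0 : 0 ≤ a := by positivity
      have := mul_le_mul_of_nonneg_left h3 (by positivity : 0 ≤ 1 + ε / 2)
      nlinarith [mul_nonneg ha0 (by nlinarith : 0 ≤ ε / 4 - ε ^ 2 / 8)]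
    have hb : (1 + ε / 2) * (δ * Fintype.card V) ≤ (1 - ε / 4) * Q.card := by
      have := mul_le_mul_of_nonneg_left hQ.le (by linarith : 0 ≤ 1 - ε / 4)
      nlinarith [mul_nonneg (by linarith : 0 ≤ δ * Fintype.card V)
        (by nlinarith : 0 ≤ ε / 4 - ε ^ 2 / 4)]
    linarith
  obtain ⟨L, R, hL, hR, hLR⟩ := exists_separated_sets y
    (fun u v w => by simpa only [hy] using hx.2.2.1 u v w) (by positivity : 0 < ε / 4 * r)
    (by positivity : 0 < ε / 4) (by linarith) hΛ hlogQ hfar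
  rw [Fintype.card_coe] at hL hR
  have hLne : L.Nonempty := by
    refine Finset.card_pos.1 ?_
    have : (0 : ℝ) < L.card := lt_of_lt_of_le (by positivity) hL
    exact_mod_cast this
  have hΔ : ε / 4 * r * (ε / 4) ^ 2 / (819200 * Λ) = ε ^ 3 * r / (52428800 * Λ) := by
    field_simp
    norm_num
  have hmap : ∀ T : Finset Q, T.map (Function.Embedding.subtype (· ∈ Q)) ⊆ Q := by
    intro T v hv
    obtain ⟨w, -, rfl⟩ := Finset.mem_map.1 hv
    exact w.2
  obtain ⟨S, hSQ, hLS, hRS, hcut⟩ := exists_sweep_cut ed hed (fun u v => ‖x u - x v‖ ^ 2)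
    (by simp) hx.2.2.1 (fun i => maxDistSq x (ed i))
    (fun i u hu v hv => sq_norm_sub_le_maxDistSq x hu hv)
    (L := L.map (Function.Embedding.subtype (· ∈ Q)))
    (R := R.map (Function.Embedding.subtype (· ∈ Q))) (hmap L) (by simpa using hLne)
    (by positivity : 0 < ε ^ 3 * r / (52428800 * Λ)) (by
      intro u hu v hv
      obtain ⟨u', hu', rfl⟩ := Finset.mem_map.1 hu
      obtain ⟨v', hv', rfl⟩ := Finset.mem_map.1 hv
      have := hLR u' hu' v' hv'
      rw [hy, hΔ] at this
      exact this)
  have hsum : ((Q \ S).card : ℝ) + S.card = Q.card := by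
    exact_mod_cast Finset.card_sdiff_add_card_eq_card hSQ
  have h1 : (L.card : ℝ) ≤ S.card := by
    have := Finset.card_le_card hLS
    rw [Finset.card_map] at this
    exact_mod_cast this
  have h2 : (R.card : ℝ) ≤ (Q \ S).card := by
    have : R.map (Function.Embedding.subtype (· ∈ Q)) ⊆ Q \ S := fun v hv =>
      Finset.mem_sdiff.2 ⟨hmap R hv, hRS v hv⟩
    have := Finset.card_le_card this
    rw [Finset.card_map] at this
    exact_mod_cast this
  refine ⟨S, hSQ, by linarith, by linarith, ?_⟩
  have hpos : 0 < ε ^ 3 * r / (52428800 * Λ) := by positivity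
  rw [← le_div_iff₀' hpos] at hcut
  refine hcut.trans (le_of_eq ?_)
  rw [div_div_eq_mul_div, div_mul_eq_mul_div, mul_comm]

lemma SDPFeasible.mul_card_levelSet_le (hx : SDPFeasible x δ) {ι : Type*} [Fintype ι]
    (ed : ι → Finset V) (hed : ∀ i, (ed i).Nonempty) {ε r Λ κ : ℝ} (hε : 0 < ε) (hε1 : ε < 1)
    (hδ : 0 < δ) (hδ1 : δ < 1 / 2)
    (hr : 0 < r) (hΛ : 1 ≤ Λ) (hlog : Real.log (Fintype.card V) ≤ Λ ^ 2) (hκ : 0 ≤ κ)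
    (h : ∀ S : Finset V, S.Nonempty → (S.card : ℝ) ≤ (1 + ε) * δ * Fintype.card V →
      κ * S.card ≤ (cutEdges ed S).card) :
    κ * (levelSet x r).card ≤ 3 / δ * ((cutEdges ed (levelSet x r)).card +
      8388608000 * Λ * Real.logb 2 (2 / δ) / ε ^ 4 *
        ∑ i ∈ innerEdges ed (levelSet x r), maxDistSq x (ed i) / r) := by
  have hδn := hx.one_le
  have hnpos : (0 : ℝ) < Fintype.card V := by
    by_contra! hn
    nlinarith
  have hs : 0 < (1 + ε) * δ * Fintype.card V := by positivity
  have hWn : ((levelSet x r).card : ℝ) ≤ Fintype.card V := by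
    exact_mod_cast Finset.card_le_univ _
  set k := ⌈160 * Real.log (1 / δ) / ε⌉₊ with hk
  have hlogδ : 0 < Real.log (1 / δ) := Real.log_pos (by rw [lt_div_iff₀ hδ]; linarith)
  have hkle : (k : ℝ) ≤ 160 * Real.logb 2 (2 / δ) / ε := by
    have h1 : (k : ℝ) < 160 * Real.log (1 / δ) / ε + 1 := Nat.ceil_lt_add_one (by positivity)
    have h2 : Real.log (1 / δ) ≤ Real.logb 2 (1 / δ) := by
      rw [Real.logb, le_div_iff₀ (Real.log_pos one_lt_two)]
      nlinarith [Real.log_two_lt_d9]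
    have h3 : Real.logb 2 (2 / δ) = 1 + Real.logb 2 (1 / δ) := by
      rw [← mul_one_div, Real.logb_mul (by norm_num) (by positivity),
        Real.logb_self_eq_one one_lt_two]
    refine h1.le.trans ?_
    rw [h3, div_add_one hε.ne']
    gcongr
    linarith
  have hpow : (1 - ε / 160) ^ k * ((levelSet x r).card : ℝ) ≤ (1 + ε) * δ * Fintype.card V := by
    have h1 : (1 - ε / 160) ^ k ≤ δ := by
      calc (1 - ε / 160) ^ k ≤ Real.exp (-(ε / 160)) ^ k := by
            refine pow_le_pow_left₀ (by linarith) ?_ k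
            linarith [Real.add_one_le_exp (-(ε / 160))]
        _ = Real.exp (-(k * ε / 160)) := by
            rw [← Real.exp_nat_mul]
            ring_nf
        _ ≤ Real.exp (-Real.log (1 / δ)) := by
            refine Real.exp_le_exp.2 (neg_le_neg ?_)
            have := Nat.le_ceil (160 * Real.log (1 / δ) / ε)
            rw [← hk, div_le_iff₀ hε] at this
            linarith
        _ = δ := by rw [one_div, Real.log_inv, neg_neg, Real.exp_log hδ]
    have h2 : (1 - ε / 160) ^ k * ((levelSet x r).card : ℝ) ≤ δ * Fintype.card V :=
      mul_le_mul h1 hWn (by positivity) hδ.le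
    nlinarith
  obtain ⟨P, hP, hPb⟩ := exists_cellPartition ed hed (fun i => maxDistSq x (ed i))
    (fun i => maxDistSq_nonneg x _) (levelSet x r)
    (by positivity : 0 ≤ 52428800 * Λ / (ε ^ 3 * r))
    (fun Q hQ hsQ => hx.exists_balanced_cut ed hed hε hε1 hr hΛ hlog
      (fun u hu => (Finset.mem_filter.1 (hQ hu)).2.2) hsQ) (by linarith) k _ subset_rfl hpow
  obtain ⟨P', hP', hPb', hcard⟩ := exists_cellPartition_card_le ed hs hP
  refine (mul_card_le_of_cellPartition ed hP' hκ h).trans ?_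
  have hcount : (P'.card : ℝ) ≤ 3 / δ := by
    refine hcard.trans ?_
    have h1 : 2 * ((levelSet x r).card : ℝ) / ((1 + ε) * δ * Fintype.card V) ≤ 2 / δ := by
      rw [div_le_div_iff₀ hs hδ]
      nlinarith [mul_nonneg hε.le (mul_nonneg hδ.le hnpos.le), mul_le_mul_of_nonneg_left hWn hδ.le]
    have h2 : (1 : ℝ) ≤ 1 / δ := by
      rw [le_div_iff₀ hδ]
      linarith
    have h3 : 3 / δ = 1 / δ + 2 / δ := by ring
    linarith
  refine mul_le_mul hcount ?_ (by positivity) (by positivity)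
  have hb : ((brokenEdges ed P' (levelSet x r)).card : ℝ) ≤
      (brokenEdges ed P (levelSet x r)).card := by exact_mod_cast Finset.card_le_card hPb'
  have hm : 0 ≤ ∑ i ∈ innerEdges ed (levelSet x r), maxDistSq x (ed i) :=
    Finset.sum_nonneg fun i _ => maxDistSq_nonneg x _
  gcongr
  refine (hb.trans hPb).trans ?_
  calc (k : ℝ) * (52428800 * Λ / (ε ^ 3 * r) * ∑ i ∈ innerEdges ed (levelSet x r),
        maxDistSq x (ed i))
      ≤ 160 * Real.logb 2 (2 / δ) / ε * (52428800 * Λ / (ε ^ 3 * r) *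
        ∑ i ∈ innerEdges ed (levelSet x r), maxDistSq x (ed i)) := by gcongr
    _ = _ := by
      rw [← Finset.sum_div]
      field_simp
      ring

/-- Averaging a bound over all level sets. -/
lemma SDPFeasible.le_of_levelSet (hx : SDPFeasible x δ) {ι : Type*} [Fintype ι]
    (ed : ι → Finset V) (hed : ∀ i, (ed i).Nonempty) {κ A B : ℝ} (hA : 0 ≤ A) (hB : 0 ≤ B)
    (h : ∀ r, 0 < r → κ * (levelSet x r).card ≤ B * ((cutEdges ed (levelSet x r)).card +
      A * ∑ i ∈ innerEdges ed (levelSet x r), maxDistSq x (ed i) / r)) :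
    κ * (1 / 2) ≤ B * ((3 / 2 + A) * sdpValue ed x) := by
  set a : ι → ℝ := fun i => (ed i).inf' (hed i) fun u => ‖x u‖ ^ 2 with ha
  set b : ι → ℝ := fun i => (ed i).sup' (hed i) fun u => ‖x u‖ ^ 2 with hb
  set m : ι → ℝ := fun i => maxDistSq x (ed i) with hm
  have hab : ∀ i, a i ≤ b i := fun i => by
    obtain ⟨u, hu⟩ := hed i
    exact (Finset.inf'_le (fun u => ‖x u‖ ^ 2) hu).trans
      (Finset.le_sup' (fun u => ‖x u‖ ^ 2) hu)
  have hb0 : ∀ i, 0 ≤ b i := fun i => by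
    obtain ⟨u, hu⟩ := hed i
    exact (sq_nonneg ‖x u‖).trans (Finset.le_sup' (fun u => ‖x u‖ ^ 2) hu)
  have hm0 : ∀ i, 0 ≤ m i := fun i => maxDistSq_nonneg x _
  have hbam : ∀ i, b i - a i ≤ m i := fun i => by
    obtain ⟨u, hu, hu'⟩ := (ed i).exists_mem_eq_sup' (hed i) fun u => ‖x u‖ ^ 2
    obtain ⟨v, hv, hv'⟩ := (ed i).exists_mem_eq_inf' (hed i) fun u => ‖x u‖ ^ 2
    simp only [ha, hb, hu', hv']
    exact (hx.sq_norm_sub_sq_norm_le v u).trans (sq_norm_sub_le_maxDistSq x hv hu)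
  set I : ℝ → ℝ → ℝ → ℝ := fun p q => (Set.Ioc p q).indicator (1 : ℝ → ℝ) with hI
  have hint : ∀ p q, MeasureTheory.IntegrableOn (I p q) (Set.Ioc 0 1) := fun p q =>
    integrableOn_indicator_Ioc p q 1
  have hint2 : ∀ i, MeasureTheory.IntegrableOn
      (fun r => I (a i / 2) (b i / 2) r + I (a i) (b i) r) (Set.Ioc 0 1) := fun i =>
    (hint _ _).add (hint _ _)
  have hint3 : ∀ i, MeasureTheory.IntegrableOn
      (fun r => m i * (2 / b i) * I (b i / 2) (b i) r) (Set.Ioc 0 1) := fun i =>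
    (hint _ _).const_mul _
  have hL : MeasureTheory.IntegrableOn
      (fun r => κ * ∑ u, I (‖x u‖ ^ 2 / 2) (‖x u‖ ^ 2) r) (Set.Ioc 0 1) :=
    (MeasureTheory.integrable_finsetSum _ fun u _ => hint _ _).const_mul _
  have hR1 : MeasureTheory.IntegrableOn
      (fun r => ∑ i, (I (a i / 2) (b i / 2) r + I (a i) (b i) r)) (Set.Ioc 0 1) :=
    MeasureTheory.integrable_finsetSum _ fun i _ => hint2 i
  have hR2 : MeasureTheory.IntegrableOn
      (fun r => A * ∑ i, m i * (2 / b i) * I (b i / 2) (b i) r) (Set.Ioc 0 1) :=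
    (MeasureTheory.integrable_finsetSum _ fun i _ => hint3 i).const_mul _
  have hmono := MeasureTheory.setIntegral_mono_on hL ((hR1.add hR2).const_mul B)
    measurableSet_Ioc (fun r hr => by
      have h1 : ((levelSet x r).card : ℝ) = ∑ u, I (‖x u‖ ^ 2 / 2) (‖x u‖ ^ 2) r := by
        rw [levelSet, Finset.card_filter]
        push_cast
        exact Finset.sum_congr rfl fun u _ => by simp [hI, Set.indicator_apply]
      rw [← h1]
      refine (h r hr.1).trans (mul_le_mul_of_nonneg_left (add_le_add ?_ ?_) hB)
      · exact cutEdges_levelSet_card_le ed hed x r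
      · exact mul_le_mul_of_nonneg_left (sum_innerEdges_levelSet_le ed hed x hr.1 m hm0) hA)
  have hleft : ∫ r in Set.Ioc 0 1, κ * ∑ u, I (‖x u‖ ^ 2 / 2) (‖x u‖ ^ 2) r = κ * (1 / 2) := by
    rw [MeasureTheory.integral_const_mul, MeasureTheory.integral_finsetSum _ fun u _ => hint _ _]
    congr 1
    have hsum : (1 : ℝ) / 2 = ∑ u, ‖x u‖ ^ 2 / 2 := by rw [← Finset.sum_div, hx.2.1]
    rw [hsum]
    refine Finset.sum_congr rfl fun u _ => ?_
    have h0 : 0 ≤ ‖x u‖ ^ 2 := by positivity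
    rw [hI, setIntegral_indicator_Ioc, min_eq_right (hx.sq_norm_le_one u),
      max_eq_right (div_nonneg h0 zero_le_two),
      max_eq_left (by linarith)]
    ring
  have hright : ∫ r in Set.Ioc 0 1, B * ((∑ i, (I (a i / 2) (b i / 2) r + I (a i) (b i) r)) +
      A * ∑ i, m i * (2 / b i) * I (b i / 2) (b i) r) ≤ B * ((3 / 2 + A) * sdpValue ed x) := by
    rw [MeasureTheory.integral_const_mul, MeasureTheory.integral_add hR1 hR2,
      MeasureTheory.integral_finsetSum _ fun i _ => hint2 i, MeasureTheory.integral_const_mul,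
      MeasureTheory.integral_finsetSum _ fun i _ => hint3 i, add_mul]
    refine mul_le_mul_of_nonneg_left (add_le_add ?_ (mul_le_mul_of_nonneg_left ?_ hA)) hB
    · rw [sdpValue, Finset.mul_sum]
      refine Finset.sum_le_sum fun i _ => ?_
      rw [MeasureTheory.integral_add (hint _ _) (hint _ _)]
      have h1 := setIntegral_indicator_Ioc_le (T := 1) (hab i)
      have h2 := setIntegral_indicator_Ioc_le (T := 1) (by linarith [hab i] : a i / 2 ≤ b i / 2)
      have h3 : b i - a i ≤ maxDistSq x (ed i) := hbam i
      simp only [hI]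
      linarith
    · refine Finset.sum_le_sum fun i _ => ?_
      rw [MeasureTheory.integral_const_mul]
      have h1 := setIntegral_indicator_Ioc_le (T := 1) (by linarith [hb0 i] : b i / 2 ≤ b i)
      have h2 : 0 ≤ m i * (2 / b i) := mul_nonneg (hm0 i) (div_nonneg zero_le_two (hb0 i))
      refine (mul_le_mul_of_nonneg_left h1 h2).trans ?_
      rcases (hb0 i).eq_or_lt with h0 | h0
      · rw [← h0]
        simpa using hm0 i
      · refine le_of_eq ?_
        change _ = m i
        field_simp
        ring
  exact hleft.symm.le.trans (hmono.trans hright)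

/-- Some small set has expansion bounded by the value of the relaxation. -/
lemma SDPFeasible.exists_small_cut (hx : SDPFeasible x δ) {ι : Type*} [Fintype ι]
    (ed : ι → Finset V) (hed : ∀ i, (ed i).Nonempty) {ε Λ : ℝ} (hε : 0 < ε) (hε1 : ε < 1)
    (hδ : 0 < δ) (hδ1 : δ < 1 / 2) (hΛ : 1 ≤ Λ) (hlog : Real.log (Fintype.card V) ≤ Λ ^ 2) :
    ∃ S : Finset V, S.Nonempty ∧ (S.card : ℝ) ≤ (1 + ε) * δ * Fintype.card V ∧
      ((cutEdges ed S).card : ℝ) ≤ 125829120000 * ε⁻¹ ^ 4 * δ⁻¹ * Real.logb 2 (2 / δ) * Λ *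
        sdpValue ed x * S.card := by
  have hδn := hx.one_le
  have hV : Nonempty V := by
    by_contra! hV
    have := hx.2.1
    simp at this
  obtain ⟨v⟩ := hV
  have hv : ({v} : Finset V) ∈ Finset.univ.filter fun S : Finset V => S.Nonempty ∧
      (S.card : ℝ) ≤ (1 + ε) * δ * Fintype.card V := by
    refine Finset.mem_filter.2 ⟨Finset.mem_univ _, Finset.singleton_nonempty v, ?_⟩
    rw [Finset.card_singleton, Nat.cast_one]
    nlinarith
  obtain ⟨S, hS, hmin⟩ := Finset.exists_min_image _
    (fun S => ((cutEdges ed S).card : ℝ) / S.card) ⟨_, hv⟩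
  obtain ⟨-, hSne, hSs⟩ := Finset.mem_filter.1 hS
  refine ⟨S, hSne, hSs, ?_⟩
  have hcard : ∀ T : Finset V, T.Nonempty → (0 : ℝ) < T.card := fun T hT => by
    exact_mod_cast hT.card_pos
  set κ : ℝ := ((cutEdges ed S).card : ℝ) / S.card with hκ
  have hκ0 : 0 ≤ κ := by positivity
  have hlog2 : 1 ≤ Real.logb 2 (2 / δ) := by
    rw [Real.le_logb_iff_rpow_le one_lt_two (by positivity), Real.rpow_one, le_div_iff₀ hδ]
    linarith
  have hbound := hx.le_of_levelSet ed hed (κ := κ) (B := 3 / δ)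
    (A := 8388608000 * Λ * Real.logb 2 (2 / δ) / ε ^ 4) (by positivity) (by positivity)
    fun r hr => hx.mul_card_levelSet_le ed hed hε hε1 hδ hδ1 hr hΛ hlog hκ0 fun T hT hTs => by
      rw [← le_div_iff₀ (hcard T hT)]
      exact hmin T (Finset.mem_filter.2 ⟨Finset.mem_univ _, hT, hTs⟩)
  have hsdp : 0 ≤ sdpValue ed x := Finset.sum_nonneg fun i _ => maxDistSq_nonneg x _
  have hA : 3 / 2 ≤ 3 / 2 * (8388608000 * Λ * Real.logb 2 (2 / δ) / ε ^ 4) := by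
    have h1 : ε ^ 4 ≤ 1 := pow_le_one₀ hε.le hε1.le
    have h2 : 1 ≤ Λ * Real.logb 2 (2 / δ) := one_le_mul_of_one_le_of_one_le hΛ hlog2
    have h3 : 1 ≤ 8388608000 * Λ * Real.logb 2 (2 / δ) / ε ^ 4 := by
      rw [le_div_iff₀ (by positivity)]
      linarith
    linarith
  rw [← div_le_iff₀ (hcard S hSne), ← hκ]
  calc κ ≤ 2 * (3 / δ * ((3 / 2 + 8388608000 * Λ * Real.logb 2 (2 / δ) / ε ^ 4) *
        sdpValue ed x)) := by linarith
    _ ≤ 2 * (3 / δ * ((3 / 2 * (8388608000 * Λ * Real.logb 2 (2 / δ) / ε ^ 4) +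
        8388608000 * Λ * Real.logb 2 (2 / δ) / ε ^ 4) * sdpValue ed x)) := by gcongr
    _ = _ := by
      field_simp
      ring

end Feasible

theorem stmt_12 : ∃ C c : ℝ, 0 < C ∧ 0 < c ∧
    ∀ (V : Type) [Fintype V] [DecidableEq V] (ι : Type) [Fintype ι]
      (H : Type) [NormedAddCommGroup H] [InnerProductSpace ℝ H]
      (ed : ι → Finset V), (∀ i, (ed i).Nonempty) →
      2 ≤ Fintype.card V →
      ∀ ε δ : ℝ, 0 < ε → ε < 1 → 0 < δ → δ < 1 / 2 →
      ∀ x : V → H, SDPFeasible x δ →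
      ∃ S : Finset V, S.Nonempty ∧
        (S.card : ℝ) ≤ (1 + ε) * δ * Fintype.card V ∧
        (cutCount ed S : ℝ) ≤
          C * ε ^ (-c) * δ⁻¹ * Real.logb 2 (2 / δ) *
            Real.logb 2 (2 * Real.logb 2 (2 / δ)) *
            Real.sqrt (Real.logb 2 (Fintype.card V)) *
            sdpValue ed x * S.card := by
  refine ⟨125829120000, 4, by norm_num, by norm_num, ?_⟩
  intro V _ inst ι _ H _ _ ed hed hn ε δ hε hε1 hδ hδ1 x hx
  have hn' : (2 : ℝ) ≤ Fintype.card V := by exact_mod_cast hn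
  have hlogn : 1 ≤ Real.logb 2 (Fintype.card V) := by
    rwa [Real.le_logb_iff_rpow_le one_lt_two (by linarith), Real.rpow_one]
  have hlog : Real.log (Fintype.card V) ≤ Real.sqrt (Real.logb 2 (Fintype.card V)) ^ 2 := by
    rw [Real.sq_sqrt (by linarith), Real.logb, le_div_iff₀ (Real.log_pos one_lt_two)]
    nlinarith [Real.log_two_lt_d9, Real.log_nonneg (by linarith : (1 : ℝ) ≤ Fintype.card V)]
  obtain ⟨S, hS, hSs, hcut⟩ := hx.exists_small_cut ed hed hε hε1 hδ hδ1
    (Real.one_le_sqrt.2 hlogn) hlog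
  refine ⟨S, hS, hSs, ?_⟩
  rw [cutCount_eq_card_cutEdges]
  refine hcut.trans ?_
  have hsdp : 0 ≤ sdpValue ed x := Finset.sum_nonneg fun i _ => maxDistSq_nonneg x _
  have hlog2 : 1 ≤ Real.logb 2 (2 / δ) := by
    rw [Real.le_logb_iff_rpow_le one_lt_two (by positivity), Real.rpow_one, le_div_iff₀ hδ]
    linarith
  have hlog3 : 1 ≤ Real.logb 2 (2 * Real.logb 2 (2 / δ)) := by
    rw [Real.le_logb_iff_rpow_le one_lt_two (by positivity), Real.rpow_one]
    linarith
  have hrpow : ε ^ (-4 : ℝ) = ε⁻¹ ^ 4 := by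
    rw [Real.rpow_neg hε.le, inv_pow]
    norm_cast
  rw [hrpow]
  refine mul_le_mul_of_nonneg_right (mul_le_mul_of_nonneg_right (mul_le_mul_of_nonneg_right
    (le_mul_of_one_le_right ?_ hlog3) ?_) hsdp) ?_ <;> positivity

end
end

section
/- There exist absolute constants C > 0 and c > 0 such that the following holds. For every hypergraph H = (V,E) on n ≥ 2 vertices, all parameters ε ∈ (0,1) and δ ∈ (0,1/2], and every feasible SDP solution (ū)_{u∈V} for H-SSE with parameter δ and SDP value sdp, there exists a set S ⊆ V with 0 < |S| ≤ (1+ε)δn such that |E_cut(S)| ≤ C·ε^{-c}·( δ^{-1}·log₂(2/δ)·log₂(2·log₂(2/δ))·√(η̂(H)·sdp) + δ^{-1}·sdp )·|S|. -/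
open scoped Classical BigOperators RealInnerProductSpace

noncomputable section

section Rounding

open MeasureTheory ProbabilityTheory

open scoped unitInterval

theorem integral_floor_add (a : ℝ) : ∫ s in (0 : ℝ)..1, (⌊a + s⌋ : ℝ) = a := by
  have hper : Function.Periodic (fun s : ℝ => Int.fract s) 1 := fun s => by simp
  have hfr : ∫ s in (0 : ℝ)..1, Int.fract (a + s) = 1 / 2 := by
    rw [intervalIntegral.integral_comp_add_left (fun s => Int.fract s) a]
    have h := hper.intervalIntegral_add_eq a 0
    simp only [zero_add, add_zero] at h ⊢
    rw [h]
    have h2 : ∫ s in (0 : ℝ)..1, Int.fract s = ∫ s in (0 : ℝ)..1, s := by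
      refine intervalIntegral.integral_congr_ae ?_
      have : ∀ᵐ s : ℝ, s ≠ 1 := by simp [ae_iff]
      filter_upwards [this] with s hs1 hs
      rw [Set.uIoc_of_le zero_le_one] at hs
      exact Int.fract_eq_self.2 ⟨hs.1.le, lt_of_le_of_ne hs.2 hs1⟩
    rw [h2]; simp
  have hintegrable : IntervalIntegrable (fun s : ℝ => Int.fract (a + s)) volume 0 1 := by
    rw [intervalIntegrable_iff_integrableOn_Ioc_of_le zero_le_one]
    refine Integrable.of_bound (C := 1)
      (measurable_fract.comp (measurable_const.add measurable_id)).aestronglyMeasurable ?_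
    refine Filter.Eventually.of_forall fun s => ?_
    rw [Real.norm_eq_abs, abs_of_nonneg (Int.fract_nonneg _)]
    exact (Int.fract_lt_one _).le
  have : ∀ s : ℝ, (⌊a + s⌋ : ℝ) = (a + s) - Int.fract (a + s) := fun s => by
    rw [Int.self_sub_fract]
  simp_rw [this]
  rw [intervalIntegral.integral_sub
    (Continuous.intervalIntegrable (by fun_prop) _ _) hintegrable, hfr,
    intervalIntegral.integral_add (Continuous.intervalIntegrable (by fun_prop) _ _)
      (Continuous.intervalIntegrable (by fun_prop) _ _)]
  simp

theorem integrable_floor_add (a : ℝ) : Integrable (fun s : I => (⌊a + s⌋ : ℝ)) := by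
  refine Integrable.of_bound (C := |a| + 2) ?_ ?_
  · exact (measurable_from_top.comp (Int.measurable_floor.comp
      (measurable_const.add measurable_subtype_coe))).aestronglyMeasurable
  · refine Filter.Eventually.of_forall fun s => ?_
    have h1 := Int.floor_le (a + (s : ℝ))
    have h2 := Int.lt_floor_add_one (a + (s : ℝ))
    have h3 := s.2.1
    have h4 := s.2.2
    rw [Real.norm_eq_abs, abs_le]
    constructor <;> cases abs_cases a <;> linarith

theorem integral_unitInterval_floor_add (a : ℝ) : ∫ s : I, (⌊a + s⌋ : ℝ) = a := by
  have h := unitInterval.measurePreserving_coe.integral_comp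
    unitInterval.measurableEmbedding_coe (fun s : ℝ => (⌊a + s⌋ : ℝ))
  rw [h, integral_Icc_eq_integral_Ioc, ← intervalIntegral.integral_of_le zero_le_one,
    integral_floor_add]

theorem measurableSet_floor_ne (a b : ℝ) :
    MeasurableSet {s : I | ⌊a + (s : ℝ)⌋ ≠ ⌊b + (s : ℝ)⌋} :=
  (measurableSet_eq_fun (Int.measurable_floor.comp
      (measurable_const.add measurable_subtype_coe)) (Int.measurable_floor.comp
      (measurable_const.add measurable_subtype_coe))).compl

theorem volume_floor_ne_le {a b : ℝ} (hab : a ≤ b) :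
    (volume : Measure I).real {s : I | ⌊a + (s : ℝ)⌋ ≠ ⌊b + (s : ℝ)⌋} ≤ b - a := by
  rw [← integral_indicator_one (measurableSet_floor_ne a b)]
  calc _ ≤ ∫ s : I, ((⌊b + s⌋ : ℝ) - ⌊a + s⌋) := by
        refine integral_mono ((integrable_const _).indicator (measurableSet_floor_ne a b))
          ((integrable_floor_add b).sub (integrable_floor_add a)) fun s => ?_
        have hle : ⌊a + (s : ℝ)⌋ ≤ ⌊b + (s : ℝ)⌋ := Int.floor_mono (by linarith)
        by_cases h : ⌊a + (s : ℝ)⌋ = ⌊b + (s : ℝ)⌋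
        · simp [h]
        · have : ⌊a + (s : ℝ)⌋ + 1 ≤ ⌊b + (s : ℝ)⌋ := by omega
          have : (⌊a + (s : ℝ)⌋ : ℝ) + 1 ≤ ⌊b + (s : ℝ)⌋ := by exact_mod_cast this
          rw [Set.indicator_of_mem (by exact h), Pi.one_apply]
          linarith
    _ = b - a := by
        rw [integral_sub (integrable_floor_add b) (integrable_floor_add a),
          integral_unitInterval_floor_add, integral_unitInterval_floor_add]

theorem le_volume_floor_ne {a b : ℝ} (hab : a + 1 / 2 ≤ b) :
    1 / 2 ≤ (volume : Measure I).real {s : I | ⌊a + (s : ℝ)⌋ ≠ ⌊b + (s : ℝ)⌋} := by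
  by_cases h1 : a + 1 ≤ b
  · have : {s : I | ⌊a + (s : ℝ)⌋ ≠ ⌊b + (s : ℝ)⌋} = Set.univ := by
      refine Set.eq_univ_of_forall fun s => ?_
      have : ⌊a + (s : ℝ)⌋ + 1 ≤ ⌊b + (s : ℝ)⌋ := by
        rw [← Int.floor_add_one]; exact Int.floor_mono (by linarith)
      simp only [Set.mem_ofPred_eq]; omega
    rw [this]; simp; norm_num
  rw [← integral_indicator_one (measurableSet_floor_ne a b)]
  calc (1 : ℝ) / 2 ≤ b - a := by linarith
    _ = ∫ s : I, ((⌊b + s⌋ : ℝ) - ⌊a + s⌋) := by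
        rw [integral_sub (integrable_floor_add b) (integrable_floor_add a),
          integral_unitInterval_floor_add, integral_unitInterval_floor_add]
    _ ≤ _ := by
        refine integral_mono ((integrable_floor_add b).sub (integrable_floor_add a))
          ((integrable_const _).indicator (measurableSet_floor_ne a b)) fun s => ?_
        have hle : ⌊b + (s : ℝ)⌋ ≤ ⌊a + (s : ℝ)⌋ + 1 := by
          rw [← Int.floor_add_one]; exact Int.floor_mono (by linarith)
        have hle' : (⌊b + (s : ℝ)⌋ : ℝ) ≤ ⌊a + (s : ℝ)⌋ + 1 := by exact_mod_cast hle
        by_cases h : ⌊a + (s : ℝ)⌋ = ⌊b + (s : ℝ)⌋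
        · simp [h]
        · rw [Set.indicator_of_mem (by exact h), Pi.one_apply]
          linarith

/-- The law of the labelling of `V` obtained by rounding down the real process `t`, shifted by a
uniform random element of the unit interval. -/
def floorLaw {V Ω : Type} [MeasurableSpace Ω] (P : Measure Ω) (t : V → Ω → ℝ) :
    Measure (V → ℤ) :=
  (P.prod (volume : Measure I)).map (fun z u => ⌊t u z.1 + (z.2 : ℝ)⌋)

section FloorLaw

variable {V Ω : Type} [MeasurableSpace Ω] {P : Measure Ω} {t : V → Ω → ℝ}

theorem measurable_floor_shift (ht : ∀ u, Measurable (t u)) :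
    Measurable (fun (z : Ω × I) (u : V) => ⌊t u z.1 + (z.2 : ℝ)⌋) :=
  measurable_pi_lambda _ fun u => Int.measurable_floor.comp
    (((ht u).comp measurable_fst).add (measurable_subtype_coe.comp measurable_snd))

theorem isProbabilityMeasure_floorLaw [IsProbabilityMeasure P] (ht : ∀ u, Measurable (t u)) :
    IsProbabilityMeasure (floorLaw P t) :=
  Measure.isProbabilityMeasure_map (measurable_floor_shift ht).aemeasurable

theorem floorLaw_apply [Finite V] (ht : ∀ u, Measurable (t u)) (A : Set (V → ℤ)) :
    floorLaw P t A = ∫⁻ ω, volume {s : I | (fun u => ⌊t u ω + (s : ℝ)⌋) ∈ A} ∂P := by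
  rw [floorLaw, Measure.map_apply (measurable_floor_shift ht) (MeasurableSet.of_discrete),
    Measure.prod_apply (measurable_floor_shift ht MeasurableSet.of_discrete)]
  rfl

theorem floorLaw_eq_le [Finite V] [IsProbabilityMeasure P] (ht : ∀ u, Measurable (t u)) {u v : V}
    (h : P.real {ω | |t u ω - t v ω| ≤ 1 / 2} ≤ 2 / 5) :
    (floorLaw P t).real {p | p u = p v} ≤ 7 / 10 := by
  set E : Set Ω := {ω | |t u ω - t v ω| ≤ 1 / 2} with hE
  have hEm : MeasurableSet E := measurableSet_le ((ht u).sub (ht v)).abs measurable_const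
  have hslice : ∀ ω, volume {s : I | (fun u => ⌊t u ω + (s : ℝ)⌋) ∈ {p : V → ℤ | p u = p v}}
      ≤ ENNReal.ofReal (1 / 2 + E.indicator (fun _ => 1 / 2) ω) := by
    intro ω
    by_cases hω : ω ∈ E
    · rw [Set.indicator_of_mem hω]
      refine prob_le_one.trans ?_
      norm_num
    · rw [Set.indicator_of_notMem hω, add_zero]
      rw [← ofReal_measureReal]
      refine ENNReal.ofReal_le_ofReal ?_
      have hset : {s : I | (fun u => ⌊t u ω + (s : ℝ)⌋) ∈ {p : V → ℤ | p u = p v}}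
          = {s : I | ⌊t u ω + (s : ℝ)⌋ ≠ ⌊t v ω + (s : ℝ)⌋}ᶜ := by
        ext s; simp
      rw [hset, measureReal_compl (measurableSet_floor_ne _ _)]
      have hω' : 1 / 2 < |t u ω - t v ω| := not_le.1 hω
      simp only [probReal_univ]
      rcases lt_abs.1 hω' with h1 | h1
      · have := le_volume_floor_ne (a := t v ω) (b := t u ω) (by linarith)
        simp_rw [ne_comm (a := ⌊t v ω + _⌋)] at this
        linarith
      · have := le_volume_floor_ne (a := t u ω) (b := t v ω) (by linarith)
        linarith
  have hintegrable : Integrable (fun ω => 1 / 2 + E.indicator (fun _ => (1 : ℝ) / 2) ω) P :=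
    (integrable_const _).add ((integrable_const _).indicator hEm)
  have key : floorLaw P t {p | p u = p v}
      ≤ ENNReal.ofReal (∫ ω, (1 / 2 + E.indicator (fun _ => (1 : ℝ) / 2) ω) ∂P) := by
    rw [floorLaw_apply ht, ofReal_integral_eq_lintegral_ofReal hintegrable]
    · exact lintegral_mono hslice
    · exact Filter.Eventually.of_forall fun ω =>
        add_nonneg (by norm_num) (Set.indicator_nonneg (fun _ _ => by norm_num) ω)
  have hval : ∫ ω, (1 / 2 + E.indicator (fun _ => (1 : ℝ) / 2) ω) ∂P ≤ 7 / 10 := by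
    rw [integral_add (integrable_const _) ((integrable_const _).indicator hEm),
      integral_indicator_const _ hEm]
    simp only [integral_const, probReal_univ, smul_eq_mul]
    linarith
  exact (ENNReal.toReal_mono ENNReal.ofReal_ne_top key).trans
    (by rw [ENNReal.toReal_ofReal (integral_nonneg fun ω =>
          add_nonneg (by norm_num) (Set.indicator_nonneg (fun _ _ => by norm_num) ω))]
        exact hval)

theorem floorLaw_split_le [Finite V] [IsProbabilityMeasure P] (ht : ∀ u, Measurable (t u))
    (e : Finset V) {R : Ω → ℝ}
    (hR : Integrable R P) (hR0 : ∀ ω, 0 ≤ R ω)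
    (htR : ∀ ω, ∀ u ∈ e, ∀ v ∈ e, t u ω - t v ω ≤ R ω) :
    (floorLaw P t).real {p | ∃ u ∈ e, ∃ v ∈ e, p u ≠ p v} ≤ ∫ ω, R ω ∂P := by
  rcases e.eq_empty_or_nonempty with rfl | he
  · simpa using integral_nonneg hR0
  have hslice : ∀ ω, volume {s : I | (fun u => ⌊t u ω + (s : ℝ)⌋) ∈
      {p : V → ℤ | ∃ u ∈ e, ∃ v ∈ e, p u ≠ p v}} ≤ ENNReal.ofReal (R ω) := by
    intro ω
    obtain ⟨a, ha, hamin⟩ := e.exists_min_image (fun u => t u ω) he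
    obtain ⟨b, hb, hbmax⟩ := e.exists_max_image (fun u => t u ω) he
    rw [← ofReal_measureReal]
    refine ENNReal.ofReal_le_ofReal ((measureReal_mono ?_).trans
      ((volume_floor_ne_le (hamin b hb)).trans (htR ω b hb a ha)))
    rintro s ⟨u, hu, v, hv, huv⟩ hab
    apply huv
    have hfl : ∀ w ∈ e, ⌊t w ω + (s : ℝ)⌋ = ⌊t a ω + (s : ℝ)⌋ := fun w hw =>
      le_antisymm (hab ▸ Int.floor_mono (by linarith [hbmax w hw]))
        (Int.floor_mono (by linarith [hamin w hw]))
    exact (hfl u hu).trans (hfl v hv).symm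
  have key : floorLaw P t {p | ∃ u ∈ e, ∃ v ∈ e, p u ≠ p v} ≤ ENNReal.ofReal (∫ ω, R ω ∂P) := by
    rw [floorLaw_apply ht, ofReal_integral_eq_lintegral_ofReal hR]
    · exact lintegral_mono hslice
    · exact Filter.Eventually.of_forall hR0
  exact (ENNReal.toReal_mono ENNReal.ofReal_ne_top key).trans
    (by rw [ENNReal.toReal_ofReal (integral_nonneg hR0)])

end FloorLaw

theorem gaussianReal_abs_le_half {v : NNReal} (hv : 1 ≤ v) :
    (gaussianReal 0 v).real {y | |y| ≤ 1 / 2} ≤ 2 / 5 := by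
  have hset : {y : ℝ | |y| ≤ 1 / 2} = Set.Icc (-(1 / 2)) (1 / 2) := by
    ext y; simp [abs_le]
  have hv0 : v ≠ 0 := (zero_lt_one.trans_le hv).ne'
  have hpdf : ∀ y, gaussianPDFReal 0 v y ≤ 2 / 5 := by
    intro y
    rw [gaussianPDFReal]
    have hs : (5 : ℝ) / 2 ≤ √(2 * Real.pi * v) := by
      apply Real.le_sqrt_of_sq_le
      have h1 : (1 : ℝ) ≤ v := by exact_mod_cast hv
      nlinarith [Real.pi_gt_d2]
    have he : Real.exp (-(y - 0) ^ 2 / (2 * v)) ≤ 1 := by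
      rw [Real.exp_le_one_iff]
      exact div_nonpos_of_nonpos_of_nonneg (by nlinarith [sq_nonneg (y - 0)]) (by positivity)
    calc _ ≤ (5 / 2 : ℝ)⁻¹ * 1 := by gcongr
      _ = 2 / 5 := by norm_num
  have key : gaussianReal 0 v (Set.Icc (-(1 / 2)) (1 / 2)) ≤ ENNReal.ofReal (2 / 5) := by
    rw [gaussianReal_apply _ hv0]
    calc _ ≤ ∫⁻ _ in Set.Icc (-(1 / 2) : ℝ) (1 / 2), ENNReal.ofReal (2 / 5) :=
          lintegral_mono fun y => ENNReal.ofReal_le_ofReal (hpdf y)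
      _ = ENNReal.ofReal (2 / 5) := by
          rw [setLIntegral_const, Real.volume_Icc]; norm_num
  rw [hset]
  exact (ENNReal.toReal_mono ENNReal.ofReal_ne_top key).trans
    (by rw [ENNReal.toReal_ofReal (by norm_num)])

section Gaussian

variable {E : Type} [NormedAddCommGroup E] [InnerProductSpace ℝ E] [FiniteDimensional ℝ E]
  [MeasurableSpace E] [BorelSpace E]

theorem stdGaussian_map_inner (z : E) :
    (stdGaussian E).map (fun g => (⟪z, g⟫ : ℝ)) = gaussianReal 0 (‖z‖₊ ^ 2) := by
  have h := IsGaussian.map_eq_gaussianReal (μ := stdGaussian E) (innerSL ℝ z)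
  rw [integral_strongDual_stdGaussian, variance_dual_stdGaussian, innerSL_apply_norm] at h
  have h2 : (‖z‖ ^ 2).toNNReal = ‖z‖₊ ^ 2 := by
    rw [Real.toNNReal_pow (norm_nonneg _), norm_toNNReal]
  rw [h2] at h
  exact h

theorem stdGaussian_abs_inner_le_half {z : E} (hz : 1 ≤ ‖z‖) :
    (stdGaussian E).real {g | |(⟪z, g⟫ : ℝ)| ≤ 1 / 2} ≤ 2 / 5 := by
  have h1 : (1 : NNReal) ≤ ‖z‖₊ ^ 2 := one_le_pow₀ (by exact_mod_cast hz)
  have h := gaussianReal_abs_le_half h1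
  rw [← stdGaussian_map_inner, map_measureReal_apply (by fun_prop)
    (measurableSet_le (by fun_prop) (by fun_prop))] at h
  exact h

theorem integrable_exp_inner_stdGaussian (z : E) (l : ℝ) :
    Integrable (fun g => Real.exp (l * ⟪z, g⟫)) (stdGaussian E) := by
  have h := integrable_exp_mul_gaussianReal (μ := 0) (v := ‖z‖₊ ^ 2) l
  rw [← stdGaussian_map_inner] at h
  exact (integrable_map_measure (f := fun g => (⟪z, g⟫ : ℝ)) (g := fun r => Real.exp (l * r))
    (by fun_prop) (by fun_prop)).1 h

theorem integral_exp_inner_stdGaussian (z : E) (l : ℝ) :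
    ∫ g, Real.exp (l * ⟪z, g⟫) ∂(stdGaussian E) = Real.exp (‖z‖ ^ 2 * l ^ 2 / 2) := by
  have h := mgf_gaussianReal (stdGaussian_map_inner z) l
  rw [mgf] at h
  rw [h]
  simp

/-- A pointwise exponential majorant of the spread of a Gaussian process over a finite set, with
mean at most `2 * √(log #e) * D`, where `D` is the largest standard deviation of an increment. -/
theorem exists_majorant_stdGaussian {V : Type} (y : V → E) (e : Finset V) (he : 2 ≤ e.card)
    {D : ℝ} (hD : 0 < D) (hy : ∀ u ∈ e, ∀ v ∈ e, ‖y u - y v‖ ≤ D) :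
    ∃ R : E → ℝ, Integrable R (stdGaussian E) ∧ (∀ g, 0 ≤ R g) ∧
      (∀ g, ∀ u ∈ e, ∀ v ∈ e, (⟪y u, g⟫ : ℝ) - ⟪y v, g⟫ ≤ R g) ∧
      ∫ g, R g ∂(stdGaussian E) ≤ 2 * √(Real.log e.card) * D := by
  have hcard : (2 : ℝ) ≤ e.card := by exact_mod_cast he
  set s := √(Real.log e.card) with hs
  have hlog : 0 < Real.log e.card := Real.log_pos (by linarith)
  have hs0 : 0 < s := Real.sqrt_pos.2 hlog
  have hss : s ^ 2 = Real.log e.card := Real.sq_sqrt hlog.le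
  set l : ℝ := 2 * s / D with hl
  have hl0 : 0 < l := by positivity
  set A : ℝ := (e.card : ℝ) ^ 2 * Real.exp (D ^ 2 * l ^ 2 / 2) with hA
  have hA0 : 0 < A := by positivity
  have hlogA : Real.log A = 4 * s ^ 2 := by
    rw [hA, Real.log_mul (by positivity) (by positivity), Real.log_pow, Real.log_exp, ← hss, hl]
    field_simp
    push_cast
    ring
  have hpt : ∀ z : E, ∀ g, (⟪z, g⟫ : ℝ) ≤ (Real.log A + Real.exp (l * ⟪z, g⟫) / A - 1) / l := by
    intro z g
    rw [le_div_iff₀ hl0]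
    have h := Real.log_le_sub_one_of_pos (x := Real.exp (l * ⟪z, g⟫) / A) (by positivity)
    rw [Real.log_div (by positivity) (by positivity), Real.log_exp] at h
    linarith
  have hintegrable : ∀ q : V × V, Integrable (fun g => Real.exp (l * ⟪y q.1 - y q.2, g⟫) / A)
      (stdGaussian E) := fun q => (integrable_exp_inner_stdGaussian _ l).div_const A
  have hsumint : Integrable (fun g => ∑ q ∈ e ×ˢ e, Real.exp (l * ⟪y q.1 - y q.2, g⟫) / A)
      (stdGaussian E) := integrable_finsetSum _ fun q _ => hintegrable q
  have hadd : Integrable (fun g => Real.log A +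
      ∑ q ∈ e ×ˢ e, Real.exp (l * ⟪y q.1 - y q.2, g⟫) / A) (stdGaussian E) :=
    (integrable_const _).add hsumint
  have hmaj : ∀ g, ∀ u ∈ e, ∀ v ∈ e, (⟪y u, g⟫ : ℝ) - ⟪y v, g⟫ ≤
      (Real.log A + ∑ q ∈ e ×ˢ e, Real.exp (l * ⟪y q.1 - y q.2, g⟫) / A - 1) / l := by
    intro g u hu v hv
    rw [← inner_sub_left]
    refine (hpt _ g).trans ?_
    gcongr
    exact Finset.single_le_sum (f := fun q : V × V => Real.exp (l * ⟪y q.1 - y q.2, g⟫) / A)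
      (fun q _ => by positivity) (Finset.mem_product.2 ⟨hu, hv⟩ : (u, v) ∈ e ×ˢ e)
  refine ⟨fun g => (Real.log A + ∑ q ∈ e ×ˢ e,
    Real.exp (l * ⟪y q.1 - y q.2, g⟫) / A - 1) / l, ?_, ?_, hmaj, ?_⟩
  · exact (hadd.sub (integrable_const _)).div_const l
  · intro g
    obtain ⟨u, hu⟩ : e.Nonempty := Finset.card_pos.1 (by omega)
    have := hmaj g u hu u hu
    rwa [sub_self] at this
  · rw [integral_div, integral_sub hadd (integrable_const _),
      integral_add (integrable_const _) hsumint,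
      integral_finsetSum _ fun q _ => hintegrable q]
    simp only [integral_const, probReal_univ, smul_eq_mul, one_mul, integral_div,
      integral_exp_inner_stdGaussian]
    have hsum : ∑ q ∈ e ×ˢ e, Real.exp (‖y q.1 - y q.2‖ ^ 2 * l ^ 2 / 2) / A ≤ 1 := by
      calc _ ≤ ∑ q ∈ e ×ˢ e, Real.exp (D ^ 2 * l ^ 2 / 2) / A := by
            refine Finset.sum_le_sum fun q hq => ?_
            have := hy q.1 (Finset.mem_product.1 hq).1 q.2 (Finset.mem_product.1 hq).2
            gcongr
        _ = 1 := by
            rw [Finset.sum_const, Finset.card_product, nsmul_eq_mul, hA]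
            push_cast
            field_simp
    rw [div_le_iff₀ hl0, hlogA, hl]
    have : 2 * s * D * (2 * s / D) = 4 * s ^ 2 := by field_simp; ring
    linarith

theorem exists_labelling_of_finiteDimensional {V : Type} [Fintype V] (y : V → E) :
    ∃ P : Measure (V → ℤ), IsProbabilityMeasure P ∧
      (∀ u v, 1 ≤ ‖y u - y v‖ → P.real {p | p u = p v} ≤ 7 / 10) ∧
      ∀ e : Finset V, 2 ≤ e.card → ∀ D : ℝ, (∀ u ∈ e, ∀ v ∈ e, ‖y u - y v‖ ≤ D) →
        P.real {p | ∃ u ∈ e, ∃ v ∈ e, p u ≠ p v} ≤ 2 * √(Real.log e.card) * D := by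
  have ht : ∀ u, Measurable (fun g : E => (⟪y u, g⟫ : ℝ)) := fun u => by fun_prop
  refine ⟨floorLaw (stdGaussian E) fun u g => ⟪y u, g⟫, isProbabilityMeasure_floorLaw ht,
    fun u v huv => floorLaw_eq_le ht ?_, fun e he D hD => ?_⟩
  · simp_rw [← inner_sub_left]
    exact stdGaussian_abs_inner_le_half huv
  · obtain ⟨w, hw⟩ : e.Nonempty := Finset.card_pos.1 (by omega)
    have hD0 : 0 ≤ D := (norm_nonneg _).trans (hD w hw w hw)
    rcases hD0.eq_or_lt with rfl | hDpos
    · have hy : ∀ u ∈ e, ∀ v ∈ e, y u = y v := fun u hu v hv =>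
        sub_eq_zero.1 (norm_le_zero_iff.1 (hD u hu v hv))
      refine (floorLaw_split_le ht e (R := fun _ => 0) (integrable_const _) (fun _ => le_rfl)
        fun g u hu v hv => ?_).trans (by simp)
      rw [hy u hu v hv, sub_self]
    · obtain ⟨R, hR, hR0, htR, hRD⟩ := exists_majorant_stdGaussian y e he hDpos hD
      exact (floorLaw_split_le ht e hR hR0 htR).trans hRD

end Gaussian

theorem exists_labelling {V H : Type} [Fintype V] [NormedAddCommGroup H] [InnerProductSpace ℝ H]
    (y : V → H) :
    ∃ P : Measure (V → ℤ), IsProbabilityMeasure P ∧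
      (∀ u v, 1 ≤ ‖y u - y v‖ → P.real {p | p u = p v} ≤ 7 / 10) ∧
      ∀ e : Finset V, 2 ≤ e.card → ∀ D : ℝ, (∀ u ∈ e, ∀ v ∈ e, ‖y u - y v‖ ≤ D) →
        P.real {p | ∃ u ∈ e, ∃ v ∈ e, p u ≠ p v} ≤ 2 * √(Real.log e.card) * D := by
  let E := Submodule.span ℝ (Set.range y)
  have : FiniteDimensional ℝ E := FiniteDimensional.span_of_finite ℝ (Set.finite_range y)
  let : MeasurableSpace E := borel E
  have : BorelSpace E := ⟨rfl⟩
  exact exists_labelling_of_finiteDimensional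
    (fun u => (⟨y u, Submodule.subset_span ⟨u, rfl⟩⟩ : E))

/-- Independent repetition of a random labelling. -/
theorem exists_iterated_labelling {V H : Type} [Fintype V] [NormedAddCommGroup H]
    [InnerProductSpace ℝ H] (y : V → H) (k : ℕ) :
    ∃ P : Measure (Fin k → V → ℤ), IsProbabilityMeasure P ∧
      (∀ u v, 1 ≤ ‖y u - y v‖ → P.real {p | ∀ i, p i u = p i v} ≤ (7 / 10) ^ k) ∧
      ∀ e : Finset V, 2 ≤ e.card → ∀ D : ℝ, (∀ u ∈ e, ∀ v ∈ e, ‖y u - y v‖ ≤ D) →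
        P.real {p | ∃ i, ∃ u ∈ e, ∃ v ∈ e, p i u ≠ p i v}
          ≤ k * (2 * √(Real.log e.card) * D) := by
  obtain ⟨P, hP, hfar, hsplit⟩ := exists_labelling y
  refine ⟨Measure.pi fun _ => P, inferInstance, fun u v huv => ?_, fun e he D hD => ?_⟩
  · have hset : {p : Fin k → V → ℤ | ∀ i, p i u = p i v}
        = Set.univ.pi fun _ => {p : V → ℤ | p u = p v} := by
      ext p; simp
    rw [hset, measureReal_def, Measure.pi_pi, ENNReal.toReal_prod, Finset.prod_const]
    simp only [Finset.card_univ, Fintype.card_fin]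
    exact pow_le_pow_left₀ ENNReal.toReal_nonneg (hfar u v huv) k
  · have hset : {p : Fin k → V → ℤ | ∃ i, ∃ u ∈ e, ∃ v ∈ e, p i u ≠ p i v}
        = ⋃ i, Function.eval i ⁻¹' {p : V → ℤ | ∃ u ∈ e, ∃ v ∈ e, p u ≠ p v} := by
      ext p; simp
    rw [hset]
    refine (measureReal_iUnion_fintype_le _).trans ?_
    calc _ ≤ ∑ _i : Fin k, 2 * √(Real.log e.card) * D := by
          refine Finset.sum_le_sum fun i _ => ?_
          rw [(measurePreserving_eval (fun _ => P) i).measureReal_preimage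
            (MeasurableSet.of_discrete).nullMeasurableSet]
          exact hsplit e he D hD
      _ = _ := by simp

theorem exists_law_finset {V X : Type} [Fintype V] [MeasurableSpace X] (μ : Measure X)
    [IsProbabilityMeasure μ] (S : X → Finset V) (hS : ∀ u, MeasurableSet {z | u ∈ S z}) :
    ∃ w : Finset V → ℝ, IsProbDist w ∧
      ∀ p : Finset V → Prop, Pr w p = μ.real {z | p (S z)} := by
  have hm : ∀ T, MeasurableSet (S ⁻¹' {T}) := by
    intro T
    have : S ⁻¹' {T} = ⋂ u, {z | u ∈ S z ↔ u ∈ T} := by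
      ext z; simp [Finset.ext_iff]
    rw [this]
    refine MeasurableSet.iInter fun u => ?_
    by_cases hu : u ∈ T
    · simpa [hu] using hS u
    · simp only [hu, iff_false]
      exact (hS u).compl
  have hPr : ∀ p : Finset V → Prop, Pr (fun T => μ.real (S ⁻¹' {T})) p
      = μ.real {z | p (S z)} := by
    intro p
    rw [Pr, ← Finset.sum_filter, sum_measureReal_preimage_singleton _ fun T _ => hm T]
    congr 1
    ext z
    simp
  refine ⟨fun T => μ.real (S ⁻¹' {T}), ⟨fun T => measureReal_nonneg, ?_⟩, hPr⟩
  have := hPr fun _ => True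
  simpa [Pr] using this

theorem volume_pi_eval_lt {V : Type} [Fintype V] (α : I) (v : V) :
    (volume : Measure (V → I)) {f | f v < α} = ENNReal.ofReal α := by
  have h := (measurePreserving_eval (fun _ : V => (volume : Measure I)) v).measure_preimage
    (measurableSet_Iio (a := α)).nullMeasurableSet
  rw [unitInterval.volume_Iio] at h
  exact h

theorem volume_pi_eval_lt_and {V : Type} [Fintype V] (α : I) {u v : V} (huv : u ≠ v) :
    (volume : Measure (V → I)) {f | f u < α ∧ f v < α} = ENNReal.ofReal α ^ 2 := by
  have hset : {f : V → I | f u < α ∧ f v < α}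
      = Set.univ.pi fun w => if w ∈ ({u, v} : Finset V) then Set.Iio α else Set.univ := by
    ext f
    simp only [Set.mem_ofPred_eq, Set.mem_univ_pi]
    constructor
    · rintro ⟨hu, hv⟩ w
      split_ifs with hw
      · rcases Finset.mem_insert.1 hw with rfl | hw
        · exact hu
        · rw [Finset.mem_singleton.1 hw]; exact hv
      · trivial
    · intro h
      have hu := h u
      have hv := h v
      simp at hu hv
      exact ⟨hu, hv⟩
  rw [hset, volume_pi, Measure.pi_pi]
  have : ∀ w, (volume : Measure I) (if w ∈ ({u, v} : Finset V) then Set.Iio α else Set.univ)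
      = if w ∈ ({u, v} : Finset V) then ENNReal.ofReal α else 1 := by
    intro w; split_ifs <;> simp
  simp_rw [this]
  rw [Finset.prod_ite_mem, Finset.univ_inter, Finset.prod_const, Finset.card_pair huv]

/-- Given a random labelling of `V`, keep each class of equal labels independently with
probability `α`, and among the kept vertices keep those whose weight `a` exceeds a uniform
threshold. -/
theorem exists_random_subset {V Q L : Type} [Fintype V] [DecidableEq V] [MeasurableSpace Q]
    [DiscreteMeasurableSpace Q] (P : Measure Q) [IsProbabilityMeasure P] (lab : Q → V → L)
    (a : V → I) (α : I) :
    ∃ w : Finset V → ℝ, IsProbDist w ∧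
      (∀ u, Pr w (fun T => u ∈ T) = α * a u) ∧
      (∀ u v, Pr w (fun T => u ∈ T ∧ v ∈ T)
        ≤ α * a u * (P.real {q | lab q u = lab q v} + α)) ∧
      (∀ e : Finset V, ∀ lo hi : I, lo ≤ hi → (∀ u ∈ e, lo ≤ a u ∧ a u ≤ hi) →
        Pr w (fun T => Cuts T e)
          ≤ (hi - lo) + lo * P.real {q | ∃ u ∈ e, ∃ v ∈ e, lab q u ≠ lab q v}) := by
  let rep : Q → V → V := fun q u => (Quotient.mk (Setoid.ker (lab q)) u).out
  have hrep : ∀ q u v, rep q u = rep q v ↔ lab q u = lab q v := by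
    intro q u v
    simp only [rep, Quotient.out_inj, Quotient.eq]
    rfl
  let μ : Measure ((Q × I) × (V → I)) := (P.prod volume).prod volume
  let S : (Q × I) × (V → I) → Finset V :=
    fun z => Finset.univ.filter fun u => z.1.2 < a u ∧ z.2 (rep z.1.1 u) < α
  have hmem : ∀ z u, u ∈ S z ↔ z.1.2 < a u ∧ z.2 (rep z.1.1 u) < α := fun z u => by simp [S]
  have hthr : ∀ u, MeasurableSet {z : (Q × I) × (V → I) | z.1.2 < a u} := fun u =>
    measurableSet_lt (measurable_snd.comp measurable_fst) measurable_const
  have hsel : ∀ u, MeasurableSet {z : (Q × I) × (V → I) | z.2 (rep z.1.1 u) < α} := by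
    intro u
    have : {z : (Q × I) × (V → I) | z.2 (rep z.1.1 u) < α}
        = ⋃ v, ({z | rep z.1.1 u = v} ∩ {z | z.2 v < α}) := by
      ext z; simp
    rw [this]
    refine MeasurableSet.iUnion fun v => MeasurableSet.inter ?_ ?_
    · exact (measurable_fst.comp measurable_fst)
        (MeasurableSet.of_discrete (s := {q : Q | rep q u = v}))
    · exact measurableSet_lt ((measurable_pi_apply v).comp measurable_snd) measurable_const
  have hS : ∀ u, MeasurableSet {z | u ∈ S z} := fun u => by
    simp only [hmem]
    exact (hthr u).inter (hsel u)
  obtain ⟨w, hw, hPr⟩ := exists_law_finset μ S hS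
  have hbase : ∀ (B : Set Q) (r : I), (P.prod (volume : Measure I)) (B ×ˢ Set.Iio r)
      = P B * ENNReal.ofReal r := fun B r => by
    rw [Measure.prod_prod, unitInterval.volume_Iio]
  have hbasem : ∀ (B : Set Q) (r : I), MeasurableSet (B ×ˢ Set.Iio r) := fun B r =>
    MeasurableSet.of_discrete.prod measurableSet_Iio
  refine ⟨w, hw, fun u => ?_, fun u v => ?_, fun e lo hi hlohi he => ?_⟩
  · rw [hPr, measureReal_def, Measure.prod_apply (hS u)]
    have hslice : ∀ z : Q × I, (volume : Measure (V → I)) (Prod.mk z ⁻¹' {z | u ∈ S z})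
        = (Set.univ ×ˢ Set.Iio (a u)).indicator (fun _ => ENNReal.ofReal α) z := by
      intro z
      by_cases hz : z.2 < a u
      · rw [Set.indicator_of_mem (by simpa using hz), ← volume_pi_eval_lt α (rep z.1 u)]
        congr 1
        ext f
        simp [hmem, hz]
      · rw [Set.indicator_of_notMem (by simpa using hz)]
        convert measure_empty (μ := (volume : Measure (V → I)))
        ext f
        simp [hmem, hz]
    simp_rw [hslice]
    rw [lintegral_indicator_const (hbasem _ _), hbase, measure_univ, one_mul, ENNReal.toReal_mul,
      ENNReal.toReal_ofReal α.2.1, ENNReal.toReal_ofReal (a u).2.1]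
  · rw [hPr]
    have hslice : ∀ z : Q × I,
        (volume : Measure (V → I)) (Prod.mk z ⁻¹' {z | u ∈ S z ∧ v ∈ S z})
        ≤ ({q | lab q u = lab q v} ×ˢ Set.Iio (a u)).indicator (fun _ => ENNReal.ofReal α) z
          + (Set.univ ×ˢ Set.Iio (a u)).indicator (fun _ => ENNReal.ofReal α ^ 2) z := by
      intro z
      by_cases hz : z.2 < a u
      · by_cases hl : lab z.1 u = lab z.1 v
        · rw [Set.indicator_of_mem (by simpa using ⟨hl, hz⟩)]
          refine le_add_right ?_
          rw [← volume_pi_eval_lt α (rep z.1 u)]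
          refine measure_mono fun f hf => ?_
          exact ((hmem _ _).1 hf.1).2
        · rw [Set.indicator_of_mem (s := Set.univ ×ˢ Set.Iio (a u)) (by simpa using hz)]
          refine le_add_left ?_
          rw [← volume_pi_eval_lt_and α (mt (hrep z.1 u v).1 hl)]
          refine measure_mono fun f hf => ?_
          exact ⟨((hmem _ _).1 hf.1).2, ((hmem _ _).1 hf.2).2⟩
      · have : Prod.mk z ⁻¹' {z | u ∈ S z ∧ v ∈ S z} = ∅ := by
          ext f; simp [hmem, hz]
        rw [this, measure_empty]
        exact zero_le
    have key : μ {z | u ∈ S z ∧ v ∈ S z} ≤ ENNReal.ofReal α *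
        (P {q | lab q u = lab q v} * ENNReal.ofReal (a u)) +
        ENNReal.ofReal α ^ 2 * ENNReal.ofReal (a u) := by
      have hm : MeasurableSet {z | u ∈ S z ∧ v ∈ S z} := (hS u).inter (hS v)
      rw [Measure.prod_apply hm]
      refine (lintegral_mono hslice).trans ?_
      rw [lintegral_add_left (measurable_const.indicator (hbasem _ _)),
        lintegral_indicator_const (hbasem _ _), lintegral_indicator_const (hbasem _ _),
        hbase, hbase, measure_univ, one_mul]
    have hne : ENNReal.ofReal α * (P {q | lab q u = lab q v} * ENNReal.ofReal (a u)) +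
        ENNReal.ofReal α ^ 2 * ENNReal.ofReal (a u) ≠ ⊤ := by finiteness
    refine (ENNReal.toReal_mono hne key).trans (le_of_eq ?_)
    rw [ENNReal.toReal_add (by finiteness) (by finiteness)]
    simp only [ENNReal.toReal_mul, ENNReal.toReal_pow, ENNReal.toReal_ofReal α.2.1,
      ENNReal.toReal_ofReal (a u).2.1, measureReal_def]
    ring
  · rw [hPr]
    have hsub : {z | Cuts (S z) e} ⊆
        ((Set.univ ×ˢ Set.Ico lo hi) ×ˢ Set.univ) ∪
        (({q | ∃ u ∈ e, ∃ v ∈ e, lab q u ≠ lab q v} ×ˢ Set.Iio lo) ×ˢ Set.univ) := by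
      rintro z ⟨⟨u, hu⟩, ⟨v, hv⟩⟩
      rw [Finset.mem_inter, hmem] at hu
      rw [Finset.mem_sdiff, hmem] at hv
      by_cases hz : z.1.2 < lo
      · refine Or.inr ⟨⟨⟨u, hu.1, v, hv.1, fun hl => hv.2 ⟨hz.trans_le (he v hv.1).1, ?_⟩⟩, hz⟩,
          trivial⟩
        rw [← (hrep _ _ _).2 hl]
        exact hu.2.2
      · exact Or.inl ⟨⟨trivial, not_lt.1 hz, hu.2.1.trans_le (he u hu.1).2⟩, trivial⟩
    refine (measureReal_mono hsub).trans ((measureReal_union_le _ _).trans (le_of_eq ?_))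
    simp only [μ, measureReal_prod_prod, probReal_univ, one_mul, mul_one]
    rw [measureReal_def, measureReal_def, unitInterval.volume_Ico,
      measureReal_def, unitInterval.volume_Iio,
      ENNReal.toReal_ofReal (sub_nonneg.2 hlohi), ENNReal.toReal_ofReal lo.2.1]
    ring

section Averaging

variable {V : Type} [Fintype V] {w : Finset V → ℝ}

theorem Pr_mono (hw : IsProbDist w) {p q : Finset V → Prop} (h : ∀ T, p T → q T) :
    Pr w p ≤ Pr w q := by
  refine Finset.sum_le_sum fun T _ => ?_
  by_cases hp : p T
  · simp [hp, h T hp]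
  · simp only [hp, if_false]
    split_ifs
    exacts [hw.1 T, le_rfl]

theorem sum_Pr_and_mem (A : Finset V) (p : Finset V → Prop) :
    ∑ v ∈ A, Pr w (fun T => p T ∧ v ∈ T) = ∑ T, if p T then w T * (A ∩ T).card else 0 := by
  simp only [Pr]
  rw [Finset.sum_comm]
  refine Finset.sum_congr rfl fun T _ => ?_
  by_cases hp : p T
  · simp only [hp, true_and, if_true]
    rw [← Finset.sum_filter, Finset.sum_const, nsmul_eq_mul, mul_comm, Finset.filter_mem_eq_inter]
  · simp [hp]

/-- If `u` shares the random set with few vertices outside `A` on average, then the random set is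
rarely much larger than `A` when it contains `u`. -/
theorem Pr_le_Pr_and_card_le (hw : IsProbDist w) (u : V) (A : Finset V) {s₁ x κ : ℝ} (hx : 0 < x)
    (hA : (A.card : ℝ) ≤ s₁) (hκ : 0 ≤ κ)
    (hpair : ∀ v ∉ A, Pr w (fun T => u ∈ T ∧ v ∈ T) ≤ κ) :
    Pr w (fun T => u ∈ T) ≤
      Pr w (fun T => u ∈ T ∧ (T.card : ℝ) ≤ s₁ + x) + Fintype.card V * κ / x := by
  have hsplit : Pr w (fun T => u ∈ T) = Pr w (fun T => u ∈ T ∧ (T.card : ℝ) ≤ s₁ + x) +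
      Pr w (fun T => u ∈ T ∧ ¬ (T.card : ℝ) ≤ s₁ + x) := by
    simp only [Pr]
    rw [← Finset.sum_add_distrib]
    refine Finset.sum_congr rfl fun T _ => ?_
    by_cases h1 : u ∈ T <;> by_cases h2 : (T.card : ℝ) ≤ s₁ + x <;> simp [h1, h2]
  have hmarkov : Pr w (fun T => u ∈ T ∧ ¬ (T.card : ℝ) ≤ s₁ + x) * x
      ≤ ∑ v ∈ Aᶜ, Pr w (fun T => u ∈ T ∧ v ∈ T) := by
    rw [sum_Pr_and_mem, Pr, Finset.sum_mul]
    refine Finset.sum_le_sum fun T _ => ?_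
    by_cases h1 : u ∈ T
    · by_cases h2 : (T.card : ℝ) ≤ s₁ + x
      · simp only [h1, h2, not_true, and_false, if_false, if_true, zero_mul]
        exact mul_nonneg (hw.1 T) (Nat.cast_nonneg _)
      · simp only [h1, h2, not_false_eq_true, and_true, if_true]
        refine mul_le_mul_of_nonneg_left ?_ (hw.1 T)
        have h3 : T.card ≤ (Aᶜ ∩ T).card + A.card := by
          refine (Finset.card_le_card (t := (Aᶜ ∩ T) ∪ A) fun v hv => ?_).trans
            (Finset.card_union_le _ _)
          by_cases hvA : v ∈ A <;> simp [hv, hvA]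
        have h4 : (T.card : ℝ) ≤ (Aᶜ ∩ T).card + A.card := by exact_mod_cast h3
        linarith [not_le.1 h2]
    · simp [h1]
  have hsum : ∑ v ∈ Aᶜ, Pr w (fun T => u ∈ T ∧ v ∈ T) ≤ Fintype.card V * κ := by
    calc _ ≤ ∑ _v ∈ Aᶜ, κ := Finset.sum_le_sum fun v hv => hpair v (Finset.mem_compl.1 hv)
      _ = (Aᶜ).card * κ := by rw [Finset.sum_const, nsmul_eq_mul]
      _ ≤ _ := mul_le_mul_of_nonneg_right (by exact_mod_cast Finset.card_le_univ _) hκ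
  rw [hsplit]
  gcongr
  rw [le_div_iff₀ hx]
  exact hmarkov.trans hsum

theorem exists_cutCount_le [DecidableEq V] {ι : Type} [Fintype ι] (ed : ι → Finset V)
    (hw : IsProbDist w) {s b Y : ℝ} {B : ι → ℝ} (hb : 0 < b) (hY : 0 ≤ Y)
    (hmass : b ≤ ∑ u, Pr w (fun T => (T.card : ℝ) ≤ s ∧ u ∈ T))
    (hcut : ∀ i, Pr w (fun T => Cuts T (ed i)) ≤ B i) (hBY : ∑ i, B i ≤ b * Y) :
    ∃ T : Finset V, T.Nonempty ∧ (T.card : ℝ) ≤ s ∧ (cutCount ed T : ℝ) ≤ Y * T.card := by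
  by_contra! hcon
  rw [sum_Pr_and_mem] at hmass
  simp only [Finset.univ_inter] at hmass
  obtain ⟨T₀, -, hT₀⟩ : ∃ T ∈ Finset.univ, 0 < if (T.card : ℝ) ≤ s then w T * T.card else 0 :=
    Finset.exists_lt_of_sum_lt (by simpa using hb.trans_le hmass)
  have hlt : ∑ T : Finset V, Y * (if (T.card : ℝ) ≤ s then w T * T.card else 0)
      < ∑ T : Finset V, w T * cutCount ed T := by
    have hpt : ∀ T : Finset V, T.Nonempty → (T.card : ℝ) ≤ s → Y * T.card < cutCount ed T := hcon
    refine Finset.sum_lt_sum (fun T _ => ?_) ⟨T₀, Finset.mem_univ _, ?_⟩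
    · split_ifs with hs
      · rcases T.eq_empty_or_nonempty with rfl | hT
        · simpa using mul_nonneg (hw.1 ∅) (Nat.cast_nonneg _)
        · nlinarith [hpt T hT hs, hw.1 T]
      · simpa using mul_nonneg (hw.1 T) (Nat.cast_nonneg _)
    · split_ifs at hT₀ ⊢ with hs
      · have hwpos : 0 < w T₀ := pos_of_mul_pos_left hT₀ (Nat.cast_nonneg _)
        have hne : T₀.Nonempty := by
          rw [Finset.nonempty_iff_ne_empty]
          rintro rfl
          simp at hT₀
        nlinarith [hpt T₀ hne hs]
      · exact absurd hT₀ (lt_irrefl _)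
  have hE : ∑ T : Finset V, w T * cutCount ed T = ∑ i, Pr w (fun T => Cuts T (ed i)) := by
    simp only [Pr]
    rw [Finset.sum_comm]
    refine Finset.sum_congr rfl fun T _ => ?_
    rw [← Finset.sum_filter, Finset.sum_const, nsmul_eq_mul, mul_comm]
    rfl
  rw [← Finset.mul_sum] at hlt
  have h1 := Finset.sum_le_sum fun i (_ : i ∈ Finset.univ) => hcut i
  have h2 := mul_le_mul_of_nonneg_left hmass hY
  linarith

end Averaging

theorem sum_logb_card_mul_le_etaHat {V ι : Type} [Fintype V] [Fintype ι] (ed : ι → Finset V)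
    (hne : ∀ i, (ed i).Nonempty) (m : V → ℝ) (hm0 : ∀ u, 0 ≤ m u) (hm : ∑ u, m u = 1)
    (l : ι → ℝ) (hl : ∀ i, ∀ u ∈ ed i, l i ≤ m u) :
    ∑ i, Real.logb 2 (ed i).card * l i ≤ etaHat ed := by
  have hmem : etaHat ed ∈ {b : ℝ | ∃ c : ι → Finset V, (∀ i, c i ⊆ ed i ∧ (c i).Nonempty) ∧
      b = ⨆ u : V, eta ed c u} := by
    refine Set.Nonempty.csInf_mem ⟨_, ed, fun i => ⟨subset_rfl, hne i⟩, rfl⟩ ?_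
    refine (Set.finite_range fun c : ι → Finset V => ⨆ u : V, eta ed c u).subset ?_
    rintro b ⟨c, -, rfl⟩
    exact ⟨c, rfl⟩
  obtain ⟨c, hc, hη⟩ := hmem
  have hlog : ∀ i, 0 ≤ Real.logb 2 (ed i).card := fun i =>
    Real.logb_nonneg (by norm_num) (by exact_mod_cast (hne i).card_pos)
  calc ∑ i, Real.logb 2 (ed i).card * l i
      ≤ ∑ i, ∑ u, m u * (if u ∈ c i then Real.logb 2 (ed i).card / (c i).card else 0) := by
        refine Finset.sum_le_sum fun i _ => ?_
        have hci : (0 : ℝ) < (c i).card := by exact_mod_cast (hc i).2.card_pos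
        calc _ = ∑ u ∈ c i, l i * (Real.logb 2 (ed i).card / (c i).card) := by
              rw [Finset.sum_const, nsmul_eq_mul]; field_simp
          _ ≤ ∑ u ∈ c i, m u * (Real.logb 2 (ed i).card / (c i).card) := by
              refine Finset.sum_le_sum fun u hu => mul_le_mul_of_nonneg_right
                (hl i u ((hc i).1 hu)) (div_nonneg (hlog i) hci.le)
          _ = _ := by simp [Finset.sum_ite_mem]
    _ = ∑ u, m u * eta ed c u := by
        rw [Finset.sum_comm]
        simp only [eta, Finset.mul_sum]
    _ ≤ ∑ u, m u * etaHat ed := by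
        refine Finset.sum_le_sum fun u _ => mul_le_mul_of_nonneg_left ?_ (hm0 u)
        rw [hη]
        exact le_ciSup (f := fun u => eta ed c u) (Set.finite_range _).bddAbove u
    _ = etaHat ed := by rw [← Finset.sum_mul, hm, one_mul]

section Geometry

variable {H : Type} [NormedAddCommGroup H] [InnerProductSpace ℝ H]

theorem norm_sq_normalize_sub {a b : H} (ha : a ≠ 0) (hb : b ≠ 0) :
    ‖(‖a‖⁻¹ • a - ‖b‖⁻¹ • b : H)‖ ^ 2 = 2 - 2 * (⟪a, b⟫ / (‖a‖ * ‖b‖)) := by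
  have ha' := norm_pos_iff.2 ha
  have hb' := norm_pos_iff.2 hb
  rw [norm_sub_sq_real, norm_smul, norm_smul, norm_inv, norm_inv, norm_norm, norm_norm,
    real_inner_smul_left, real_inner_smul_right]
  field_simp
  ring

theorem le_norm_sq_normalize_sub {a b : H} {β : ℝ} (ha : a ≠ 0) (hb : b ≠ 0) (hβ : β ≤ 1)
    (h0 : 0 ≤ (⟪a, b⟫ : ℝ)) (hab : (⟪a, b⟫ : ℝ) ≤ (1 - β) * ‖a‖ ^ 2)
    (hb2 : (⟪a, b⟫ : ℝ) ≤ ‖b‖ ^ 2) :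
    β ≤ ‖(‖a‖⁻¹ • a - ‖b‖⁻¹ • b : H)‖ ^ 2 := by
  rw [norm_sq_normalize_sub ha hb]
  have ha' := norm_pos_iff.2 ha
  have hb' := norm_pos_iff.2 hb
  have hsq : ((⟪a, b⟫ : ℝ) / (‖a‖ * ‖b‖)) ^ 2 ≤ 1 - β := by
    rw [div_pow, div_le_iff₀ (by positivity), pow_two, mul_pow]
    calc (⟪a, b⟫ : ℝ) * ⟪a, b⟫ ≤ ((1 - β) * ‖a‖ ^ 2) * ‖b‖ ^ 2 := by gcongr
      _ = _ := by ring
  have : (⟪a, b⟫ : ℝ) / (‖a‖ * ‖b‖) ≤ 1 - β / 2 := by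
    refine abs_le_of_sq_le_sq' ?_ (by linarith) |>.2
    nlinarith [sq_nonneg β]
  linarith

theorem norm_normalize_sub_le {a b : H} {r : ℝ} (hr : 0 < r) (ha : r ≤ ‖a‖) (hb : r ≤ ‖b‖) :
    ‖(‖a‖⁻¹ • a - ‖b‖⁻¹ • b : H)‖ ≤ ‖a - b‖ / r := by
  have ha' := hr.trans_le ha
  have hb' := hr.trans_le hb
  refine le_of_sq_le_sq ?_ (by positivity)
  rw [norm_sq_normalize_sub (norm_pos_iff.1 ha') (norm_pos_iff.1 hb'), div_pow]
  have h1 : 2 - 2 * ((⟪a, b⟫ : ℝ) / (‖a‖ * ‖b‖)) ≤ ‖a - b‖ ^ 2 / (‖a‖ * ‖b‖) := by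
    rw [norm_sub_sq_real, le_div_iff₀ (by positivity)]
    have : (2 - 2 * ((⟪a, b⟫ : ℝ) / (‖a‖ * ‖b‖))) * (‖a‖ * ‖b‖)
        = 2 * (‖a‖ * ‖b‖) - 2 * ⟪a, b⟫ := by field_simp
    rw [this]
    nlinarith [sq_nonneg (‖a‖ - ‖b‖)]
  refine h1.trans ?_
  gcongr
  nlinarith

end Geometry

theorem norm_sub_sq_le_maxDistSq {V H : Type} [NormedAddCommGroup H] (x : V → H)
    (e : Finset V) {u v : V} (hu : u ∈ e)
    (hv : v ∈ e) : ‖x u - x v‖ ^ 2 ≤ maxDistSq x e := by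
  refine le_csSup ?_ ⟨u, hu, v, hv, rfl⟩
  refine (((e ×ˢ e).finite_toSet.image fun q : V × V => ‖x q.1 - x q.2‖ ^ 2).subset ?_).bddAbove
  rintro d ⟨u, hu, v, hv, rfl⟩
  exact ⟨(u, v), by simp [hu, hv], rfl⟩

theorem two_le_logb_two_div {δ : ℝ} (hδ : 0 < δ) (hδ2 : δ ≤ 1 / 2) : 2 ≤ Real.logb 2 (2 / δ) := by
  rw [Real.le_logb_iff_rpow_le (by norm_num) (by positivity), le_div_iff₀ hδ]
  norm_num
  linarith

theorem exists_repetitions {ε δ : ℝ} (hε : 0 < ε) (hε1 : ε < 1) (hδ : 0 < δ) (hδ2 : δ ≤ 1 / 2) :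
    ∃ k : ℕ, (7 / 10 : ℝ) ^ k ≤ ε * δ / 16 ∧ (k : ℝ) ≤ 11 * Real.logb 2 (2 / δ) / ε := by
  have hL := two_le_logb_two_div hδ hδ2
  set L := Real.logb 2 (2 / δ) with hLdef
  have hlog2 : 0 < Real.log 2 := Real.log_pos (by norm_num)
  have hlogε : Real.logb 2 (1 / ε) ≤ 2 / ε := by
    rw [Real.logb, div_le_iff₀ hlog2]
    have h1 : Real.log (1 / ε) ≤ 1 / ε := (Real.log_le_sub_one_of_pos (by positivity)).trans
      (by linarith)
    have h2 : 2 / ε * Real.log 2 = 1 / ε * (2 * Real.log 2) := by ring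
    rw [h2]
    refine h1.trans (le_mul_of_one_le_right (by positivity) ?_)
    linarith [Real.log_two_gt_d9]
  set Z := Real.logb 2 (16 / (ε * δ)) with hZ
  have hZle : Z ≤ 3 + 2 / ε + L := by
    have h : 16 / (ε * δ) = 8 * (1 / ε) * (2 / δ) := by field_simp; norm_num
    have h8 : Real.logb 2 8 = 3 := by
      rw [show (8 : ℝ) = 2 ^ (3 : ℝ) by norm_num, Real.logb_rpow (by norm_num) (by norm_num)]
    rw [hZ, h, Real.logb_mul (by positivity) (by positivity),
      Real.logb_mul (by norm_num) (by positivity), h8]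
    linarith
  have hZ0 : 0 ≤ Z := by
    refine Real.logb_nonneg (by norm_num) ?_
    rw [le_div_iff₀ (by positivity)]
    nlinarith
  refine ⟨⌈3 * Z⌉₊, ?_, ?_⟩
  · have hlog7 : Real.log (7 / 10) ≤ -(Real.log 2 / 3) := by
      have h1 : Real.log ((7 / 10) ^ 3) ≤ Real.log 2⁻¹ :=
        Real.log_le_log (by norm_num) (by norm_num)
      rw [Real.log_pow, Real.log_inv] at h1
      push_cast at h1
      linarith
    rw [← Real.log_le_log_iff (by positivity) (by positivity), Real.log_pow]
    have hceil : 3 * Z ≤ ⌈3 * Z⌉₊ := Nat.le_ceil _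
    have hZlog : Z * Real.log 2 = -Real.log (ε * δ / 16) := by
      rw [hZ, Real.logb, div_mul_cancel₀ _ hlog2.ne', ← Real.log_inv, inv_div]
    have h2 : (⌈3 * Z⌉₊ : ℝ) * Real.log (7 / 10) ≤ ⌈3 * Z⌉₊ * -(Real.log 2 / 3) := by gcongr
    have h3 : 3 * Z * (Real.log 2 / 3) ≤ ⌈3 * Z⌉₊ * (Real.log 2 / 3) := by gcongr
    linarith
  · have hceil := (Nat.ceil_lt_add_one (by positivity : 0 ≤ 3 * Z)).le
    rw [le_div_iff₀ hε]
    have h1 : ((⌈3 * Z⌉₊ : ℕ) : ℝ) ≤ 10 + 6 / ε + 3 * L := by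
      have : 6 / ε = 3 * (2 / ε) := by ring
      linarith
    calc (⌈3 * Z⌉₊ : ℝ) * ε ≤ (10 + 6 / ε + 3 * L) * ε := by gcongr
      _ = 10 * ε + 6 + 3 * L * ε := by field_simp
      _ ≤ 10 * 1 + 6 + 3 * L * 1 := by gcongr
      _ ≤ 11 * L := by linarith

theorem card_filter_inner_le {V H : Type} [Fintype V] [NormedAddCommGroup H]
    [InnerProductSpace ℝ H] {ε δ : ℝ} (hε : 0 < ε) (hε1 : ε < 1) {x : V → H}
    (hx : SDPFeasible x δ) {u : V} (hu : x u ≠ 0) :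
    ((Finset.univ.filter fun v => (1 - ε / 4) * ‖x u‖ ^ 2 ≤ ⟪x u, x v⟫).card : ℝ)
      ≤ (1 + ε / 2) * δ * Fintype.card V := by
  set A := Finset.univ.filter fun v => (1 - ε / 4) * ‖x u‖ ^ 2 ≤ (⟪x u, x v⟫ : ℝ) with hA
  have hu2 : 0 < ‖x u‖ ^ 2 := by have := norm_pos_iff.2 hu; positivity
  have h1 : (A.card : ℝ) * ((1 - ε / 4) * ‖x u‖ ^ 2) ≤ δ * Fintype.card V * ‖x u‖ ^ 2 := by
    calc (A.card : ℝ) * ((1 - ε / 4) * ‖x u‖ ^ 2)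
        = ∑ _v ∈ A, (1 - ε / 4) * ‖x u‖ ^ 2 := by rw [Finset.sum_const, nsmul_eq_mul]
      _ ≤ ∑ v ∈ A, (⟪x u, x v⟫ : ℝ) := Finset.sum_le_sum fun v hv => (Finset.mem_filter.1 hv).2
      _ ≤ ∑ v, (⟪x u, x v⟫ : ℝ) := Finset.sum_le_sum_of_subset_of_nonneg (Finset.subset_univ _)
          fun v _ _ => (hx.2.2.2 u v).1
      _ ≤ _ := hx.1 u
  have h2 : (A.card : ℝ) * (1 - ε / 4) ≤ δ * Fintype.card V := by
    rw [← mul_assoc] at h1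
    exact le_of_mul_le_mul_right h1 hu2
  calc (A.card : ℝ) ≤ A.card * ((1 + ε / 2) * (1 - ε / 4)) :=
        le_mul_of_one_le_right (Nat.cast_nonneg _) (by nlinarith)
    _ = (1 + ε / 2) * (A.card * (1 - ε / 4)) := by ring
    _ ≤ (1 + ε / 2) * (δ * Fintype.card V) := by gcongr
    _ = _ := by ring

/-- Randomized rounding of a feasible solution: the random set contains each vertex `u` with
probability proportional to `‖x u‖ ^ 2` while being small, and rarely cuts a hyperedge. -/
theorem exists_rounding {V H : Type} [Fintype V] [DecidableEq V] [Nonempty V]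
    [NormedAddCommGroup H] [InnerProductSpace ℝ H] {ε δ : ℝ} (hε : 0 < ε) (hε1 : ε < 1)
    (hδ : 0 < δ) (hδ2 : δ ≤ 1 / 2) {k : ℕ} (hk : (7 / 10 : ℝ) ^ k ≤ ε * δ / 16)
    {x : V → H} (hx : SDPFeasible x δ) :
    ∃ w : Finset V → ℝ, IsProbDist w ∧
      (∀ u, 3 / 4 * (ε * δ / 16) * ‖x u‖ ^ 2
        ≤ Pr w (fun T => (T.card : ℝ) ≤ (1 + ε) * δ * Fintype.card V ∧ u ∈ T)) ∧
      ∀ e : Finset V, ∀ z ∈ e, (∀ u ∈ e, ‖x z‖ ≤ ‖x u‖) →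
        Pr w (fun T => Cuts T e) ≤
          maxDistSq x e + 4 * k / √ε * (√(Real.log e.card) * ‖x z‖ * √(maxDistSq x e)) := by
  have hx1 : ∀ u, ‖x u‖ ^ 2 ≤ 1 := fun u => hx.2.1 ▸
    Finset.single_le_sum (f := fun u => ‖x u‖ ^ 2) (fun v _ => by positivity) (Finset.mem_univ u)
  have hεs : 0 < √ε := Real.sqrt_pos.2 hε
  have hεδ : ε * δ / 16 ≤ 1 := by nlinarith
  let y : V → H := fun u => (2 / √ε) • (‖x u‖⁻¹ • x u)
  have hy : ∀ u v, ‖y u - y v‖ = 2 / √ε * ‖‖x u‖⁻¹ • x u - ‖x v‖⁻¹ • x v‖ := fun u v => by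
    rw [← smul_sub, norm_smul, Real.norm_of_nonneg (by positivity)]
  obtain ⟨P, hP, hPfar, hPcut⟩ := exists_iterated_labelling y k
  obtain ⟨w, hw, hwmem, hwpair, hwcut⟩ := exists_random_subset P (fun q u i => q i u)
    (fun u => (⟨‖x u‖ ^ 2, by positivity, hx1 u⟩ : I)) ⟨ε * δ / 16, by positivity, hεδ⟩
  simp only at hwmem hwpair
  refine ⟨w, hw, fun u => ?_, fun e z hz hmin => ?_⟩
  · have hcomm : ∀ s : ℝ, Pr w (fun T => (T.card : ℝ) ≤ s ∧ u ∈ T)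
        = Pr w (fun T => u ∈ T ∧ (T.card : ℝ) ≤ s) := fun s => by
      simp only [and_comm]
    rw [hcomm]
    by_cases hu : x u = 0
    · rw [hu, norm_zero]
      refine le_trans (by simp) (Finset.sum_nonneg fun T _ => ?_)
      split_ifs
      exacts [hw.1 T, le_rfl]
    have hn : (0 : ℝ) < Fintype.card V := by exact_mod_cast Fintype.card_pos
    have h := Pr_le_Pr_and_card_le hw u _ (x := ε * δ * Fintype.card V / 2)
      (κ := ε * δ / 16 * ‖x u‖ ^ 2 * (ε * δ / 8)) (by positivity)
      (card_filter_inner_le hε hε1 hx hu) (by positivity) fun v hv => ?_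
    · rw [hwmem, show (1 + ε / 2) * δ * Fintype.card V + ε * δ * Fintype.card V / 2
        = (1 + ε) * δ * Fintype.card V by ring] at h
      have h2 : Fintype.card V * (ε * δ / 16 * ‖x u‖ ^ 2 * (ε * δ / 8)) /
          (ε * δ * Fintype.card V / 2) = 1 / 4 * (ε * δ / 16 * ‖x u‖ ^ 2) := by
        field_simp
        norm_num
      rw [h2] at h
      linarith
    · by_cases hv0 : x v = 0
      · refine (Pr_mono hw fun T hT => hT.2).trans ?_
        rw [hwmem, hv0, norm_zero]
        simp only [ne_eq, OfNat.ofNat_ne_zero, not_false_eq_true, zero_pow, mul_zero]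
        positivity
      · have hfar : 1 ≤ ‖y u - y v‖ := by
          have h1 : (⟪x u, x v⟫ : ℝ) ≤ (1 - ε / 4) * ‖x u‖ ^ 2 := by
            simpa using (not_le.1 fun h => hv (by simpa using h)).le
          have h2 := le_norm_sq_normalize_sub hu hv0 (by linarith) (hx.2.2.2 u v).1 h1
            (real_inner_comm (x u) (x v) ▸ (hx.2.2.2 v u).2)
          have h3 : √ε / 2 ≤ ‖‖x u‖⁻¹ • x u - ‖x v‖⁻¹ • x v‖ := by
            refine le_of_sq_le_sq ?_ (norm_nonneg _)
            rw [div_pow, Real.sq_sqrt hε.le]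
            linarith
          rw [hy]
          calc (1 : ℝ) = 2 / √ε * (√ε / 2) := by field_simp
            _ ≤ _ := by gcongr
        refine (hwpair u v).trans ?_
        have h4 := hPfar u v hfar
        simp only [funext_iff]
        gcongr
        linarith
  · have hm : ∀ u ∈ e, ∀ v ∈ e, ‖x u - x v‖ ≤ √(maxDistSq x e) := fun u hu v hv =>
      Real.le_sqrt_of_sq_le (norm_sub_sq_le_maxDistSq x e hu hv)
    have hm0 : 0 ≤ maxDistSq x e := (sq_nonneg _).trans (norm_sub_sq_le_maxDistSq x e hz hz)
    obtain ⟨t, ht, hmax⟩ := e.exists_max_image (fun u => ‖x u‖) ⟨z, hz⟩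
    rcases lt_or_ge e.card 2 with hcard | hcard
    · have : Pr w (fun T => Cuts T e) = 0 := by
        refine Finset.sum_eq_zero fun T _ => if_neg ?_
        rintro ⟨⟨p, hp⟩, ⟨q, hq⟩⟩
        rw [Finset.mem_inter] at hp
        rw [Finset.mem_sdiff] at hq
        exact hq.2 (Finset.card_le_one.1 (by omega) _ hp.1 _ hq.1 ▸ hp.2)
      rw [this]
      positivity
    · have hmono : ∀ {p q : V}, ‖x p‖ ≤ ‖x q‖ → ‖x p‖ ^ 2 ≤ ‖x q‖ ^ 2 := fun h => by gcongr
      have h := hwcut e ⟨‖x z‖ ^ 2, by positivity, hx1 z⟩ ⟨‖x t‖ ^ 2, by positivity, hx1 t⟩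
        (hmono (hmin t ht)) fun u hu => ⟨hmono (hmin u hu), hmono (hmax u hu)⟩
      simp only [funext_iff, ne_eq, not_forall] at h
      have hlohi : ‖x t‖ ^ 2 - ‖x z‖ ^ 2 ≤ maxDistSq x e := by
        refine le_trans ?_ (norm_sub_sq_le_maxDistSq x e ht hz)
        rw [norm_sub_sq_real]
        have := (hx.2.2.2 z t).2
        rw [real_inner_comm] at this
        linarith
      refine h.trans (add_le_add hlohi ?_)
      rcases (norm_nonneg (x z)).eq_or_lt with h0 | h0
      · rw [← h0]; simp
      · have hsplit := hPcut e hcard (2 / √ε * (√(maxDistSq x e) / ‖x z‖)) fun u hu v hv => by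
          rw [hy]
          gcongr
          refine (norm_normalize_sub_le h0 (hmin u hu) (hmin v hv)).trans ?_
          gcongr
          exact hm u hu v hv
        have hset : {q : Fin k → V → ℤ | ∃ u ∈ e, ∃ v ∈ e, ∃ i, ¬ q i u = q i v}
            = {q | ∃ i, ∃ u ∈ e, ∃ v ∈ e, q i u ≠ q i v} := by
          ext q
          constructor
          · rintro ⟨u, hu, v, hv, i, hi⟩
            exact ⟨i, u, hu, v, hv, hi⟩
          · rintro ⟨i, u, hu, v, hv, hi⟩
            exact ⟨u, hu, v, hv, i, hi⟩
        rw [hset]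
        calc _ ≤ ‖x z‖ ^ 2 * (k * (2 * √(Real.log e.card)
              * (2 / √ε * (√(maxDistSq x e) / ‖x z‖)))) := by gcongr
          _ = _ := by field_simp; ring

theorem sum_sqrt_log_card_mul_le {V ι H : Type} [Fintype V] [Fintype ι] [NormedAddCommGroup H]
    (ed : ι → Finset V) (hne : ∀ i, (ed i).Nonempty) {x : V → H} (hx : ∑ u, ‖x u‖ ^ 2 = 1)
    {z : ι → V} (hz : ∀ i, ∀ u ∈ ed i, ‖x (z i)‖ ≤ ‖x u‖) (hm : ∀ i, 0 ≤ maxDistSq x (ed i)) :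
    ∑ i, √(Real.log (ed i).card) * ‖x (z i)‖ * √(maxDistSq x (ed i))
      ≤ √(etaHat ed * sdpValue ed x) := by
  have hlog : ∀ i, 0 ≤ Real.log (ed i).card := fun i => Real.log_natCast_nonneg _
  have hη := sum_logb_card_mul_le_etaHat ed hne (fun u => ‖x u‖ ^ 2) (fun u => by positivity) hx
    (fun i => ‖x (z i)‖ ^ 2) fun i u hu => by have := hz i u hu; gcongr
  have h1 : ∑ i, (√(Real.log (ed i).card) * ‖x (z i)‖) ^ 2 ≤ etaHat ed := by
    refine le_trans (Finset.sum_le_sum fun i _ => ?_) hη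
    rw [mul_pow, Real.sq_sqrt (hlog i)]
    gcongr
    rw [Real.logb, le_div_iff₀ (Real.log_pos (by norm_num))]
    exact mul_le_of_le_one_right (hlog i) (by linarith [Real.log_two_lt_d9])
  have h0 : 0 ≤ etaHat ed := (Finset.sum_nonneg fun i _ => sq_nonneg _).trans h1
  have h2 : ∑ i, √(maxDistSq x (ed i)) ^ 2 = sdpValue ed x :=
    Finset.sum_congr rfl fun i _ => Real.sq_sqrt (hm i)
  refine (Real.sum_mul_le_sqrt_mul_sqrt _ _ _).trans ?_
  rw [h2, Real.sqrt_mul h0]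
  gcongr

end Rounding

theorem stmt_13 : ∃ C c : ℝ, 0 < C ∧ 0 < c ∧
    ∀ (V : Type) [Fintype V] [DecidableEq V] (ι : Type) [Fintype ι]
      (H : Type) [NormedAddCommGroup H] [InnerProductSpace ℝ H]
      (ed : ι → Finset V), (∀ i, (ed i).Nonempty) →
      2 ≤ Fintype.card V →
      ∀ ε δ : ℝ, 0 < ε → ε < 1 → 0 < δ → δ ≤ 1 / 2 →
      ∀ x : V → H, SDPFeasible x δ →
      ∃ S : Finset V, S.Nonempty ∧
        (S.card : ℝ) ≤ (1 + ε) * δ * Fintype.card V ∧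
        (cutCount ed S : ℝ) ≤
          C * ε ^ (-c) *
            (δ⁻¹ * Real.logb 2 (2 / δ) * Real.logb 2 (2 * Real.logb 2 (2 / δ)) *
                Real.sqrt (etaHat ed * sdpValue ed x) +
              δ⁻¹ * sdpValue ed x) * S.card := by
  refine ⟨1000, 3, by norm_num, by norm_num, ?_⟩
  intro V _ _ ι _ H _ _ ed hne hcard ε δ hε hε1 hδ hδ2 x hx
  have : Nonempty V := Fintype.card_pos_iff.1 (by omega)
  obtain ⟨k, hk, hkL⟩ := exists_repetitions hε hε1 hδ hδ2
  obtain ⟨w, hw, hmass, hcut⟩ := exists_rounding hε hε1 hδ hδ2 hk hx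
  choose z hz hmin using fun i => (ed i).exists_min_image (fun u => ‖x u‖) (hne i)
  have hm : ∀ i, 0 ≤ maxDistSq x (ed i) := fun i =>
    (sq_nonneg _).trans (norm_sub_sq_le_maxDistSq x (ed i) (hz i) (hz i))
  have hsum := sum_sqrt_log_card_mul_le ed hne hx.2.1 hmin hm
  have hsdp : 0 ≤ sdpValue ed x := Finset.sum_nonneg fun i _ => hm i
  have hL := two_le_logb_two_div hδ hδ2
  set L := Real.logb 2 (2 / δ)
  have hLL : 1 ≤ Real.logb 2 (2 * L) := by
    rw [Real.le_logb_iff_rpow_le (by norm_num) (by positivity), Real.rpow_one]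
    linarith
  set R := √(etaHat ed * sdpValue ed x)
  have hpow : ε ^ (-3 : ℝ) = (ε ^ 3)⁻¹ := by
    rw [Real.rpow_neg hε.le]
    norm_cast
  rw [hpow]
  refine exists_cutCount_le ed hw (b := 3 / 4 * (ε * δ / 16)) (by positivity) (by positivity) ?_
    (fun i => hcut (ed i) (z i) (hz i) (hmin i)) ?_
  · calc 3 / 4 * (ε * δ / 16) = ∑ u, 3 / 4 * (ε * δ / 16) * ‖x u‖ ^ 2 := by
          rw [← Finset.mul_sum, hx.2.1, mul_one]
      _ ≤ _ := Finset.sum_le_sum fun u _ => hmass u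
  · rw [Finset.sum_add_distrib, ← Finset.mul_sum]
    have hεs : ε ≤ √ε := Real.le_sqrt_of_sq_le (by nlinarith)
    have hcoef : 4 * k / √ε ≤ 44 * (L / ε ^ 2) := by
      calc 4 * k / √ε ≤ 4 * (11 * L / ε) / ε := by gcongr
        _ = _ := by field_simp; norm_num
    have hε2 : 1 ≤ (ε ^ 2)⁻¹ := (one_le_inv₀ (by positivity)).2 (by nlinarith)
    have h1 : L / ε ^ 2 * R ≤ L / ε ^ 2 * (Real.logb 2 (2 * L) * R) := by
      gcongr
      exact le_mul_of_one_le_left (Real.sqrt_nonneg _) hLL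
    have h2 : sdpValue ed x ≤ (ε ^ 2)⁻¹ * sdpValue ed x := le_mul_of_one_le_left hsdp hε2
    have h3 : 0 ≤ L / ε ^ 2 * (Real.logb 2 (2 * L) * R) := by positivity
    calc _ ≤ sdpValue ed x + 44 * (L / ε ^ 2) * R := by
          refine add_le_add le_rfl (mul_le_mul hcoef hsum ?_ (by positivity))
          exact Finset.sum_nonneg fun i _ => by positivity
      _ ≤ 3000 / 64 * ((ε ^ 2)⁻¹ * sdpValue ed x)
          + 3000 / 64 * (L / ε ^ 2 * (Real.logb 2 (2 * L) * R)) := by nlinarith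
      _ = _ := by field_simp; ring

end
end

section
/- Let V be a finite set, let (w̄)_{w∈V} be vectors in a real inner product space with Σ_{w∈V} ‖w̄‖² = 1, let E be a finite multiset of subsets of V each of size at least 2, for each e ∈ E let e° ⊆ e be a nonempty subset, and let D : ℕ → ℝ≥0. Then Σ_{e∈E} D(|e|)·min_{w∈e} ‖w̄‖·max_{u,v∈e} ‖ū − v̄‖ ≤ √( max_{w∈V} Σ_{e∈E : w∈e°} D(|e|)²/|e°| ) · √( Σ_{e∈E} max_{u,v∈e} ‖ū − v̄‖² ). -/
open scoped Classical BigOperators RealInnerProductSpace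

noncomputable section

lemma minNorm_nonneg {V H : Type*} [NormedAddCommGroup H] (x : V → H) (e : Finset V) :
    0 ≤ minNorm x e := by
  apply Real.sInf_nonneg
  rintro _ ⟨w, -, rfl⟩
  exact norm_nonneg _

lemma minNorm_le {V H : Type*} [NormedAddCommGroup H] (x : V → H) {e : Finset V} {w : V}
    (hw : w ∈ e) : minNorm x e ≤ ‖x w‖ := by
  refine csInf_le ⟨0, ?_⟩ ⟨w, hw, rfl⟩
  rintro _ ⟨v, -, rfl⟩
  exact norm_nonneg _

lemma maxDist_sq_le_maxDistSq {V H : Type*} [NormedAddCommGroup H] (x : V → H) {e : Finset V}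
    (he : e.Nonempty) : maxDist x e ^ 2 ≤ maxDistSq x e := by
  have hfin (f : V → V → ℝ) : {d : ℝ | ∃ u ∈ e, ∃ v ∈ e, d = f u v}.Finite := by
    refine ((e ×ˢ e).finite_toSet.image fun p => f p.1 p.2).subset ?_
    rintro _ ⟨u, hu, v, hv, rfl⟩
    exact ⟨(u, v), by simp [hu, hv], rfl⟩
  obtain ⟨a, ha⟩ := he
  have hne : {d : ℝ | ∃ u ∈ e, ∃ v ∈ e, d = ‖x u - x v‖}.Nonempty := ⟨_, a, ha, a, ha, rfl⟩
  obtain ⟨u, hu, v, hv, h⟩ := hne.csSup_mem (hfin fun u v => ‖x u - x v‖)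
  rw [maxDist, h]
  exact le_csSup (hfin fun u v => ‖x u - x v‖ ^ 2).bddAbove ⟨u, hu, v, hv, rfl⟩

/-- Distributing weights `a i` evenly over the sets `c i`: if each `m i` is at most `f` on `c i`,
then `∑ a i * m i` is at most the largest load times the total mass of `f`. -/
lemma sum_mul_le_iSup_load_mul_sum {V ι : Type*} [Fintype V] [Fintype ι] (c : ι → Finset V)
    (hc : ∀ i, (c i).Nonempty) (a m : ι → ℝ) (ha : ∀ i, 0 ≤ a i) (f : V → ℝ)
    (hf : ∀ w, 0 ≤ f w) (hm : ∀ i, ∀ w ∈ c i, m i ≤ f w) :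
    ∑ i, a i * m i ≤
      (⨆ w : V, ∑ i, if w ∈ c i then a i / ((c i).card : ℝ) else 0) * ∑ w, f w := by
  calc ∑ i, a i * m i
      = ∑ i, ∑ w ∈ c i, a i / ((c i).card : ℝ) * m i := by
        refine Finset.sum_congr rfl fun i _ => ?_
        have : ((c i).card : ℝ) ≠ 0 := by exact_mod_cast (hc i).card_ne_zero
        rw [Finset.sum_const, nsmul_eq_mul]
        field_simp
    _ ≤ ∑ i, ∑ w ∈ c i, a i / ((c i).card : ℝ) * f w :=
        Finset.sum_le_sum fun i _ => Finset.sum_le_sum fun w hw =>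
          mul_le_mul_of_nonneg_left (hm i w hw) (div_nonneg (ha i) (Nat.cast_nonneg _))
    _ = ∑ w, (∑ i, if w ∈ c i then a i / ((c i).card : ℝ) else 0) * f w := by
        simp_rw [Finset.sum_mul, ite_mul, zero_mul]
        rw [Finset.sum_comm]
        simp
    _ ≤ ∑ w, (⨆ w : V, ∑ i, if w ∈ c i then a i / ((c i).card : ℝ) else 0) * f w :=
        Finset.sum_le_sum fun w _ => mul_le_mul_of_nonneg_right
          (le_ciSup (f := fun w => ∑ i, if w ∈ c i then a i / ((c i).card : ℝ) else 0)
            (Set.finite_range _).bddAbove w) (hf w)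
    _ = _ := (Finset.mul_sum ..).symm

theorem stmt_14 {V ι H : Type*} [Fintype V] [Fintype ι]
    [NormedAddCommGroup H] [InnerProductSpace ℝ H]
    (x : V → H) (hx : ∑ w : V, ‖x w‖ ^ 2 = 1)
    (ed : ι → Finset V) (hed : ∀ i, 2 ≤ (ed i).card)
    (c : ι → Finset V) (hc : ∀ i, c i ⊆ ed i ∧ (c i).Nonempty)
    (D : ℕ → ℝ) (hD : ∀ r : ℕ, 0 ≤ D r) :
    ∑ i : ι, D (ed i).card * minNorm x (ed i) * maxDist x (ed i) ≤
      Real.sqrt (⨆ w : V, ∑ i : ι,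
          if w ∈ c i then (D (ed i).card) ^ 2 / ((c i).card : ℝ) else 0) *
        Real.sqrt (∑ i : ι, maxDistSq x (ed i)) := by
  refine (Real.sum_mul_le_sqrt_mul_sqrt _ _ _).trans ?_
  gcongr with i
  · have key := sum_mul_le_iSup_load_mul_sum c (fun i => (hc i).2) (fun i => D (ed i).card ^ 2)
      (fun i => minNorm x (ed i) ^ 2) (fun i => sq_nonneg _) (fun w => ‖x w‖ ^ 2)
      (fun w => sq_nonneg _) (fun i w hw =>
        pow_le_pow_left₀ (minNorm_nonneg x _) (minNorm_le x ((hc i).1 hw)) 2)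
    rw [hx, mul_one] at key
    simpa only [mul_pow] using key
  · exact maxDist_sq_le_maxDistSq x ((hc i).2.mono (hc i).1)

end
end
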